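/- Let d be a positive integer and let c be an integer with c ≥ d! + d. For every d-dimensional integral polytope P in ℝ^d there exists a positive integer N such that for all nonnegative integers r and s with r + s > 0, the polytope (r·c^N + s·(d!)^N)·P admits a unimodular triangulation. -/

import Mathlib

open Pointwise

/-- A point of `ℝ^d` with integer coordinates. -/
def IsLatticePt {d : ℕ} (x : Fin d → ℝ) : Prop := ∀ i, ∃ z : ℤ, x i = (z : ℝ)

/-- The subgroup `ℤ^d` of integral points of `ℝ^d`. -/
def intLattice (d : ℕ) : AddSubgroup (Fin d → ℝ) where
  carrier := {x | IsLatticePt x}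
  zero_mem' := fun i => ⟨0, by simp⟩
  add_mem' := by
    rintro a b ha hb i
    obtain ⟨z, hz⟩ := ha i
    obtain ⟨w, hw⟩ := hb i
    exact ⟨z + w, by simp [hz, hw]⟩
  neg_mem' := by
    rintro a ha i
    obtain ⟨z, hz⟩ := ha i
    exact ⟨-z, by simp [hz]⟩

/-- A polytope: the convex hull of a nonempty finite set of points. -/
def IsPolytope {d : ℕ} (P : Set (Fin d → ℝ)) : Prop :=
  ∃ V : Finset (Fin d → ℝ), V.Nonempty ∧ P = convexHull ℝ (V : Set (Fin d → ℝ))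

/-- An integral polytope: the convex hull of a nonempty finite set of integral points. -/
def IsIntegralPolytope {d : ℕ} (P : Set (Fin d → ℝ)) : Prop :=
  ∃ V : Finset (Fin d → ℝ), V.Nonempty ∧ (∀ v ∈ V, IsLatticePt v) ∧
    P = convexHull ℝ (V : Set (Fin d → ℝ))

/-- A simplex: the convex hull of a nonempty affinely independent finite set. -/
def IsSimplex {d : ℕ} (P : Set (Fin d → ℝ)) : Prop :=
  ∃ V : Finset (Fin d → ℝ), V.Nonempty ∧
    AffineIndependent ℝ (Subtype.val : ↥(V : Set (Fin d → ℝ)) → (Fin d → ℝ)) ∧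
    P = convexHull ℝ (V : Set (Fin d → ℝ))

/-- An integral simplex. -/
def IsIntegralSimplex {d : ℕ} (P : Set (Fin d → ℝ)) : Prop :=
  ∃ V : Finset (Fin d → ℝ), V.Nonempty ∧ (∀ v ∈ V, IsLatticePt v) ∧
    AffineIndependent ℝ (Subtype.val : ↥(V : Set (Fin d → ℝ)) → (Fin d → ℝ)) ∧
    P = convexHull ℝ (V : Set (Fin d → ℝ))

/-- The set of differences of vertices (= extreme points) of a polytope. -/
def vertexDiffs {d : ℕ} (P : Set (Fin d → ℝ)) : Set (Fin d → ℝ) :=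
  {w | ∃ u ∈ P.extremePoints ℝ, ∃ v ∈ P.extremePoints ℝ, w = u - v}

/-- `L(P)`: the subgroup of `ℤ^d` generated by differences of vertices of `P`. -/
def latL {d : ℕ} (P : Set (Fin d → ℝ)) : AddSubgroup (Fin d → ℝ) :=
  AddSubgroup.closure (vertexDiffs P)

/-- `N(P)`: the intersection of the real span of `L(P)` with `ℤ^d`. -/
def latN {d : ℕ} (P : Set (Fin d → ℝ)) : AddSubgroup (Fin d → ℝ) :=
  (Submodule.span ℝ (vertexDiffs P)).toAddSubgroup ⊓ intLattice d

/-- The (normalized) index of an integral polytope: the group index `[N(P) : L(P)]`. -/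
noncomputable def polyIndex {d : ℕ} (P : Set (Fin d → ℝ)) : ℕ :=
  ((latL P).addSubgroupOf (latN P)).index

/-- A unimodular simplex: an integral simplex of index 1. -/
def IsUnimodularSimplex {d : ℕ} (P : Set (Fin d → ℝ)) : Prop :=
  IsIntegralSimplex P ∧ polyIndex P = 1

/-- `F` is a face of `P`: the (nonempty) set of maximizers on `P` of a linear functional. -/
def IsFaceOf {d : ℕ} (F P : Set (Fin d → ℝ)) : Prop :=
  F.Nonempty ∧ ∃ φ : (Fin d → ℝ) →ₗ[ℝ] ℝ, F = {x ∈ P | ∀ y ∈ P, φ y ≤ φ x}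

/-- A triangulation of `Q`: a finite, face-closed collection of simplices with union `Q`,
any two of which meet in a (possibly empty) common face. -/
def IsTriangulation {d : ℕ} (T : Set (Set (Fin d → ℝ))) (Q : Set (Fin d → ℝ)) : Prop :=
  T.Finite ∧ (∀ S ∈ T, IsSimplex S) ∧ ⋃₀ T = Q ∧
    (∀ S ∈ T, ∀ F, IsFaceOf F S → F ∈ T) ∧
    ∀ S₁ ∈ T, ∀ S₂ ∈ T, S₁ ∩ S₂ = ∅ ∨ (IsFaceOf (S₁ ∩ S₂) S₁ ∧ IsFaceOf (S₁ ∩ S₂) S₂)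

/-- A unimodular triangulation: all of its simplices are unimodular. -/
def IsUnimodularTriangulation {d : ℕ} (T : Set (Set (Fin d → ℝ))) (Q : Set (Fin d → ℝ)) : Prop :=
  IsTriangulation T Q ∧ ∀ S ∈ T, IsUnimodularSimplex S

section Fans

open Classical

variable {E : Type} [AddCommGroup E] [Module ℝ E]

/-- The point of `E` with the given barycentric coordinates. -/
noncomputable def lc : (E →₀ ℝ) →ₗ[ℝ] E := Finsupp.linearCombination ℝ id

@[simp] lemma lc_single (v : E) (t : ℝ) : lc (Finsupp.single v t) = t • v := by
  simp [lc, Finsupp.linearCombination_single]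

lemma lc_erase (l : E →₀ ℝ) (n : E) : lc (l.erase n) = lc l - l n • n := by
  conv_rhs => rw [← Finsupp.single_add_erase n l]
  simp

/-- Nonnegative coordinate vectors supported on a cell of `K`. -/
def realization (K : Set (Finset E)) : Set (E →₀ ℝ) := {l | (∀ v, 0 ≤ l v) ∧ l.support ∈ K}

/-- A simplicial fan, given by the generator sets of its cones. -/
structure IsFan (K : Set (Finset E)) : Prop where
  finite : K.Finite
  mono : ∀ S ∈ K, ∀ R ⊆ S, R ∈ K
  inj : Set.InjOn lc (realization K)

/-- The support of a simplicial fan. -/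
def spt (K : Set (Finset E)) : Set E := lc '' realization K

/-- Every generator set of `K'` lies in a cone of `K`. -/
def Refines (K' K : Set (Finset E)) : Prop :=
  ∀ S' ∈ K', ∃ S ∈ K, ∀ w ∈ S', ∃ l : E →₀ ℝ, (∀ v, 0 ≤ l v) ∧ l.support ⊆ S ∧ lc l = w

/-- `K'` is a simplicial subdivision of `K`. -/
structure Subdivides (K' K : Set (Finset E)) : Prop where
  fan : IsFan K'
  spt_eq : spt K' = spt K
  refines : Refines K' K

lemma single_nonneg_apply {E : Type} (v w : E) : 0 ≤ (Finsupp.single v (1 : ℝ)) w := by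
  rw [Finsupp.single_apply]; split_ifs <;> norm_num

lemma lc_support_eq_sum (l : E →₀ ℝ) {S : Finset E} (h : l.support ⊆ S) :
    lc l = ∑ v ∈ S, l v • v := by
  simp only [lc, Finsupp.linearCombination_apply]
  exact Finsupp.sum_of_support_subset _ h _ (by simp)

lemma map_lc_eq_sum {F : Type} [AddCommGroup F] [Module ℝ F] (g : E →ₗ[ℝ] F)
    (l : E →₀ ℝ) {S : Finset E} (h : l.support ⊆ S) :
    g (lc l) = ∑ v ∈ S, l v • g v := by
  rw [lc_support_eq_sum l h]; simp

/-- Substituting nonnegative coordinates for the generators of a cell. -/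
lemma exists_coords {S S' : Finset E}
    (h : ∀ w ∈ S', ∃ l : E →₀ ℝ, (∀ v, 0 ≤ l v) ∧ l.support ⊆ S ∧ lc l = w)
    (l' : E →₀ ℝ) (h0 : ∀ v, 0 ≤ l' v) (hl : l'.support ⊆ S') :
    ∃ l : E →₀ ℝ, (∀ v, 0 ≤ l v) ∧ l.support ⊆ S ∧ lc l = lc l' := by
  choose! f hf using h
  refine ⟨∑ w ∈ S', l' w • f w, fun v => ?_, ?_, ?_⟩
  · rw [Finsupp.finsetSum_apply]
    refine Finset.sum_nonneg fun w hw => ?_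
    simpa using mul_nonneg (h0 w) ((hf w hw).1 v)
  · intro v hv
    by_contra hvS
    rw [Finsupp.mem_support_iff, Finsupp.finsetSum_apply] at hv
    refine hv (Finset.sum_eq_zero fun w hw => ?_)
    have : f w v = 0 := by
      by_contra h; exact hvS ((hf w hw).2.1 (Finsupp.mem_support_iff.2 h))
    simp [this]
  · rw [map_sum, lc_support_eq_sum l' hl]
    exact Finset.sum_congr rfl fun w hw => by rw [map_smul, (hf w hw).2.2]

lemma Subdivides.refl {K : Set (Finset E)} (h : IsFan K) : Subdivides K K :=
  ⟨h, rfl, fun S hS => ⟨S, hS, fun w hw => ⟨Finsupp.single w 1, single_nonneg_apply w,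
    fun v hv => by
      have := Finsupp.support_single_subset hv
      rw [Finset.mem_singleton] at this; rwa [this], by simp⟩⟩⟩

lemma Subdivides.trans {K₁ K₂ K₃ : Set (Finset E)} (h : Subdivides K₁ K₂)
    (h' : Subdivides K₂ K₃) : Subdivides K₁ K₃ := by
  refine ⟨h.fan, h.spt_eq.trans h'.spt_eq, fun S hS => ?_⟩
  obtain ⟨S₂, hS₂, h2⟩ := h.refines S hS
  obtain ⟨S₃, hS₃, h3⟩ := h'.refines S₂ hS₂
  refine ⟨S₃, hS₃, fun w hw => ?_⟩
  obtain ⟨l, h0, hl, rfl⟩ := h2 w hw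
  exact exists_coords h3 l h0 hl

/-- In a fan, a generator lying in a cone is one of the generators of this cone. -/
lemma IsFan.mem_of_cone {K : Set (Finset E)} (hK : IsFan K) {v : E} (hv : {v} ∈ K)
    {S : Finset E} (hS : S ∈ K) {l : E →₀ ℝ} (h0 : ∀ w, 0 ≤ l w) (hl : l.support ⊆ S)
    (hlv : lc l = v) : v ∈ S := by
  have h1 : Finsupp.single v (1 : ℝ) ∈ realization K :=
    ⟨single_nonneg_apply v, by rwa [Finsupp.support_single _ one_ne_zero]⟩
  have h2 : l ∈ realization K := ⟨h0, hK.mono _ hS _ hl⟩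
  have := hK.inj h1 h2 (by simp [hlv])
  apply hl
  rw [← this, Finsupp.support_single _ one_ne_zero]
  simp

lemma Subdivides.mem_of_vertices {K' K : Set (Finset E)} (h : Subdivides K' K) (hK : IsFan K)
    {S : Finset E} (hS : S ∈ K') (hv : ∀ v ∈ S, {v} ∈ K) : S ∈ K := by
  obtain ⟨T, hT, hw⟩ := h.refines S hS
  refine hK.mono T hT S fun v hvS => ?_
  obtain ⟨l, h0, hl, hlv⟩ := hw v hvS
  exact hK.mem_of_cone (hv v hvS) hT h0 hl hlv

/-- The stellar subdivision at the point `lc a`. -/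
def stellar (K : Set (Finset E)) (a : E →₀ ℝ) : Set (Finset E) :=
  {S | S ∈ K ∧ ¬ a.support ⊆ S} ∪
    {S | ∃ R, S = insert (lc a) R ∧ ¬ a.support ⊆ R ∧ R ∪ a.support ∈ K}

lemma lc_unstar (l a : E →₀ ℝ) : lc (l.erase (lc a) + l (lc a) • a) = lc l := by
  simp [lc_erase]

lemma IsFan.lc_notMem {K : Set (Finset E)} (hK : IsFan K) {a : E →₀ ℝ} (ha : ∀ v, 0 ≤ a v)
    (hc : 1 < a.support.card) (haK : a.support ∈ K) {S : Finset E} (hS : S ∈ K) : lc a ∉ S := by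
  intro h
  have h1 : {lc a} ∈ K := hK.mono S hS _ (by simpa using h)
  have h2 : Finsupp.single (lc a) (1 : ℝ) ∈ realization K :=
    ⟨single_nonneg_apply _, by rwa [Finsupp.support_single _ one_ne_zero]⟩
  have := hK.inj h2 ⟨ha, haK⟩ (by simp)
  rw [← this, Finsupp.support_single _ one_ne_zero] at hc
  simp at hc

lemma star_subdivides {K : Set (Finset E)} (hK : IsFan K) {a : E →₀ ℝ} (ha : ∀ v, 0 ≤ a v)
    (hc : 1 < a.support.card) : Subdivides (stellar K a) K := by
  by_cases haK : a.support ∈ K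
  swap
  · have : stellar K a = K := by
      ext S
      constructor
      · rintro (h | ⟨R, rfl, -, h⟩)
        · exact h.1
        · exact absurd (hK.mono _ h _ Finset.subset_union_right) haK
      · intro h
        exact Or.inl ⟨h, fun h' => haK (hK.mono _ h _ h')⟩
    rw [this]; exact Subdivides.refl hK
  have hn : ∀ S ∈ K, lc a ∉ S := fun S hS => hK.lc_notMem ha hc haK hS
  have key : ∀ l ∈ realization (stellar K a), (∃ u ∈ a.support, l u = 0) ∧
      l.erase (lc a) + l (lc a) • a ∈ realization K := by
    rintro l ⟨h0, h⟩
    have hnn : ∀ v, 0 ≤ (l.erase (lc a) + l (lc a) • a) v := by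
      intro v
      simp only [Finsupp.add_apply, Finsupp.smul_apply, smul_eq_mul, Finsupp.erase_apply]
      have := mul_nonneg (h0 (lc a)) (ha v)
      split_ifs
      · simpa using this
      · exact add_nonneg (h0 v) this
    rcases h with ⟨h, h'⟩ | ⟨R, h, h', hR⟩
    · have hln : l (lc a) = 0 := Finsupp.notMem_support_iff.1 (hn _ h)
      obtain ⟨u, hu, hu'⟩ := Finset.not_subset.1 h'
      refine ⟨⟨u, hu, Finsupp.notMem_support_iff.1 hu'⟩, hnn, ?_⟩
      rw [Finsupp.erase_of_notMem_support (hn _ h), hln, zero_smul, add_zero]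
      exact h
    · obtain ⟨u, hu, hu'⟩ := Finset.not_subset.1 h'
      refine ⟨⟨u, hu, Finsupp.notMem_support_iff.1 ?_⟩, hnn, ?_⟩
      · rw [h, Finset.mem_insert, not_or]
        refine ⟨fun h => ?_, hu'⟩
        exact hn _ haK (h ▸ hu)
      · refine hK.mono _ hR _ (Finsupp.support_add.trans (Finset.union_subset_union ?_ ?_))
        · rw [Finsupp.support_erase, h]
          exact Finset.erase_insert_subset _ _
        · exact Finsupp.support_smul
  refine ⟨⟨?_, ?_, ?_⟩, ?_, ?_⟩
  · refine ((hK.finite.subset fun S h => h.1).union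
      ((hK.finite.image (insert (lc a))).subset ?_))
    rintro S ⟨R, rfl, -, h⟩
    exact ⟨R, hK.mono _ h _ Finset.subset_union_left, rfl⟩
  · rintro S (⟨h, h'⟩ | ⟨R, rfl, h', hR⟩) S' hS'
    · exact Or.inl ⟨hK.mono _ h _ hS', fun h'' => h' (h''.trans hS')⟩
    · by_cases hn' : lc a ∈ S'
      · have hsub : S'.erase (lc a) ⊆ R :=
          (Finset.erase_subset_erase _ hS').trans (Finset.erase_insert_subset _ _)
        exact Or.inr ⟨S'.erase (lc a), (Finset.insert_erase hn').symm,
          fun h => h' (h.trans hsub), hK.mono _ hR _ (Finset.union_subset_union_left hsub)⟩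
      · have hsub : S' ⊆ R := (Finset.subset_insert_iff_of_notMem hn').1 hS'
        exact Or.inl ⟨hK.mono _ hR _ (hsub.trans Finset.subset_union_left),
          fun h => h' (h.trans hsub)⟩
  · intro l₁ h₁ l₂ h₂ h
    obtain ⟨⟨u₁, hu₁, hz₁⟩, hr₁⟩ := key l₁ h₁
    obtain ⟨⟨u₂, hu₂, hz₂⟩, hr₂⟩ := key l₂ h₂
    have heq := hK.inj hr₁ hr₂ (by rw [lc_unstar, lc_unstar, h])
    have hev : ∀ v, v ≠ lc a → l₁ v + l₁ (lc a) * a v = l₂ v + l₂ (lc a) * a v := by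
      intro v hv
      have := DFunLike.congr_fun heq v
      simpa [Finsupp.erase_apply, hv] using this
    have hpos : ∀ u ∈ a.support, 0 < a u := fun u hu =>
      lt_of_le_of_ne (ha u) (Ne.symm (Finsupp.mem_support_iff.1 hu))
    have hne : ∀ u ∈ a.support, u ≠ lc a := fun u hu h => hn _ haK (h ▸ hu)
    have ht : l₁ (lc a) = l₂ (lc a) := by
      have e1 := hev u₁ (hne u₁ hu₁)
      have e2 := hev u₂ (hne u₂ hu₂)
      rw [hz₁] at e1
      rw [hz₂] at e2
      have := h₁.1 u₂
      have := h₂.1 u₁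
      apply le_antisymm
      · exact le_of_mul_le_mul_right (by linarith) (hpos u₂ hu₂)
      · exact le_of_mul_le_mul_right (by linarith) (hpos u₁ hu₁)
    ext v
    by_cases hv : v = lc a
    · rw [hv, ht]
    · have := hev v hv
      rw [ht] at this
      linarith
  · apply Set.Subset.antisymm
    · rintro _ ⟨l, hl, rfl⟩
      exact ⟨_, (key l hl).2, lc_unstar l a⟩
    · rintro _ ⟨l, ⟨h0, hl⟩, rfl⟩
      by_cases hs : a.support ⊆ l.support
      swap
      · exact ⟨l, ⟨h0, Or.inl ⟨hl, hs⟩⟩, rfl⟩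
      obtain ⟨u, hu, hmin⟩ := a.support.exists_min_image (fun v => l v / a v)
        (Finset.card_pos.1 (by omega))
      have hpos : ∀ u ∈ a.support, 0 < a u := fun u hu =>
        lt_of_le_of_ne (ha u) (Ne.symm (Finsupp.mem_support_iff.1 hu))
      set t := l u / a u with ht
      have htpos : 0 < t := div_pos (lt_of_le_of_ne (h0 u)
        (Ne.symm (Finsupp.mem_support_iff.1 (hs hu)))) (hpos u hu)
      have hln : l (lc a) = 0 := Finsupp.notMem_support_iff.1 (hn _ hl)
      have han : a (lc a) = 0 := Finsupp.notMem_support_iff.1 (hn _ haK)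
      have hR : (l - t • a).support ⊆ l.support := by
        refine Finsupp.support_sub.trans (Finset.union_subset le_rfl
          (Finsupp.support_smul.trans hs))
      have hnR : lc a ∉ (l - t • a).support := by simp [hln, han]
      have hsupp : (l - t • a + Finsupp.single (lc a) t).support
          = insert (lc a) (l - t • a).support := by
        ext v
        by_cases hv : v = lc a
        · subst hv; simp [hln, han, htpos.ne']
        · simp [hv]
      refine ⟨l - t • a + Finsupp.single (lc a) t, ⟨fun v => ?_, Or.inr ⟨_, hsupp, ?_, ?_⟩⟩, ?_⟩
      · have : 0 ≤ l v - t * a v := by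
          by_cases hv : v ∈ a.support
          · have := (le_div_iff₀ (hpos v hv)).1 (hmin v hv)
            linarith
          · rw [Finsupp.notMem_support_iff.1 hv]; simpa using h0 v
        have h2 : 0 ≤ (Finsupp.single (lc a) t) v := by
          rw [Finsupp.single_apply]; split_ifs <;> [exact htpos.le; exact le_rfl]
        simpa using add_nonneg this h2
      · intro h
        have := h hu
        simp [ht, (hpos u hu).ne'] at this
      · exact hK.mono _ hl _ (Finset.union_subset hR hs)
      · simp
  · rintro S (⟨h, -⟩ | ⟨R, rfl, h', hR⟩)
    · exact (Subdivides.refl hK).refines S h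
    · obtain ⟨T, hT, h⟩ := (Subdivides.refl hK).refines _ hR
      refine ⟨_, hR, fun w hw => ?_⟩
      rcases Finset.mem_insert.1 hw with rfl | hw
      · exact ⟨a, ha, Finset.subset_union_right, rfl⟩
      · exact ⟨Finsupp.single w 1, single_nonneg_apply w, fun v hv => by
          have := Finsupp.support_single_subset hv
          rw [Finset.mem_singleton] at this
          rw [this]; exact Finset.mem_union_left _ hw, by simp⟩

/-- Cells of a stellar subdivision satisfy every property of finite sets that holds for the
retained cells and for the new ones. -/
lemma star_forall {K : Set (Finset E)} {a : E →₀ ℝ} {Q : Finset E → Prop}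
    (h₁ : ∀ S ∈ K, ¬ a.support ⊆ S → Q S)
    (h₂ : ∀ T ∈ K, a.support ⊆ T → ∀ R ⊆ T, ∀ u ∈ a.support, u ∉ R →
      Q (insert (lc a) R)) : ∀ S ∈ stellar K a, Q S := by
  rintro S (⟨h, h'⟩ | ⟨R, rfl, h', hR⟩)
  · exact h₁ S h h'
  · obtain ⟨u, hu, hu'⟩ := Finset.not_subset.1 h'
    exact h₂ _ hR Finset.subset_union_right R Finset.subset_union_left u hu hu'

end Fans

section Lattices

open Classical

variable {E : Type} [AddCommGroup E] [Module ℝ E]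

/-- The coordinates of the points of `Λ` in the span of `S` are multiples of `1 / N`. -/
def Mult (Λ : AddSubgroup E) (N : ℕ) (S : Finset E) : Prop :=
  ∀ l : E →₀ ℝ, l.support ⊆ S → lc l ∈ Λ → ∀ v, ∃ z : ℤ, (N : ℝ) * l v = z

/-- The coordinates have a common denominator all of whose prime factors are less than `B`. -/
def Good (Λ : AddSubgroup E) (B : ℕ) (S : Finset E) : Prop :=
  ∃ N : ℕ, N ≠ 0 ∧ (∀ q, q.Prime → q ∣ N → q < B) ∧ Mult Λ N S

lemma Mult.mono {Λ Λ' : AddSubgroup E} {N : ℕ} {S S' : Finset E} (h : Mult Λ N S)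
    (hΛ : Λ' ≤ Λ) (hS : S' ⊆ S) : Mult Λ' N S' :=
  fun l hl hlc v => h l (hl.trans hS) (hΛ hlc) v

lemma Good.mono {Λ Λ' : AddSubgroup E} {B : ℕ} {S S' : Finset E} (h : Good Λ B S)
    (hΛ : Λ' ≤ Λ) (hS : S' ⊆ S) : Good Λ' B S' := by
  obtain ⟨N, h0, h1, h2⟩ := h
  exact ⟨N, h0, h1, h2.mono hΛ hS⟩

lemma Mult.good {Λ : AddSubgroup E} {N B : ℕ} {S : Finset E} (h : Mult Λ N S)
    (hN : N ≠ 0) (hNB : N < B) : Good Λ B S :=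
  ⟨N, hN, fun _ _ hq => (Nat.le_of_dvd (Nat.pos_of_ne_zero hN) hq).trans_lt hNB, h⟩

lemma Mult.good_one {Λ : AddSubgroup E} {B : ℕ} {S : Finset E} (h : Mult Λ 1 S) :
    Good Λ B S :=
  ⟨1, one_ne_zero, fun _ hq h1 => absurd (Nat.dvd_one.1 h1) hq.one_lt.ne', h⟩

lemma mult_one_iff {Λ : AddSubgroup E} {S : Finset E} :
    Mult Λ 1 S ↔ ∀ l : E →₀ ℝ, l.support ⊆ S → lc l ∈ Λ → ∀ v, ∃ z : ℤ, l v = z := by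
  simp [Mult]

/-- `Λ'` is a sublattice of `Λ` of index `p` or `1`. -/
structure PrimeIdx (p : ℕ) (Λ' Λ : AddSubgroup E) : Prop where
  prime : p.Prime
  le : Λ' ≤ Λ
  smul_mem : ∀ x ∈ Λ, p • x ∈ Λ'
  exists_zsmul : ∀ n ∈ Λ, n ∉ Λ' → ∀ x ∈ Λ, ∃ i : ℤ, x - i • n ∈ Λ'

omit [AddCommGroup E] [Module ℝ E] in
lemma support_unstar {l a : E →₀ ℝ} {n : E} {R T : Finset E} (hl : l.support ⊆ insert n R)
    (hR : R ⊆ T) (ha : a.support ⊆ T) : (l.erase n + l n • a).support ⊆ T := by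
  refine Finsupp.support_add.trans (Finset.union_subset ?_ (Finsupp.support_smul.trans ha))
  rw [Finsupp.support_erase]
  exact ((Finset.erase_subset_erase _ hl).trans (Finset.erase_insert_subset _ _)).trans hR

omit [AddCommGroup E] [Module ℝ E] in
lemma unstar_apply {l a : E →₀ ℝ} {n v : E} (hv : v ≠ n) :
    (l.erase n + l n • a) v = l v + l n * a v := by
  simp [hv]

omit [AddCommGroup E] [Module ℝ E] in
lemma unstar_apply_of_notMem {l a : E →₀ ℝ} {n u : E} {R : Finset E}
    (hl : l.support ⊆ insert n R) (hu : u ∉ R) (hun : u ≠ n) :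
    (l.erase n + l n • a) u = l n * a u := by
  have : l u = 0 := by
    by_contra h
    have := hl (Finsupp.mem_support_iff.2 h)
    simp [hun, hu] at this
  rw [unstar_apply hun, this, zero_add]

/-- Stellar subdivision at an integral point with coefficient one. -/
lemma Mult.star_integral {Λ : AddSubgroup E} {N : ℕ} {T R : Finset E} (h : Mult Λ N T)
    {a : E →₀ ℝ} (haT : a.support ⊆ T) (hn : lc a ∉ T) (haz : ∀ v, ∃ z : ℤ, a v = z)
    {u : E} (hu : u ∈ a.support) (hau : a u = 1) (hR : R ⊆ T) (huR : u ∉ R) :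
    Mult Λ N (insert (lc a) R) := by
  intro l hl hlc v
  have hs := support_unstar hl hR haT
  have hm := h _ hs (by rwa [lc_unstar])
  have hun : u ≠ lc a := fun h => hn (h ▸ haT hu)
  obtain ⟨z, hz⟩ := hm u
  rw [unstar_apply_of_notMem hl huR hun, hau, mul_one] at hz
  by_cases hv : v = lc a
  · exact ⟨z, hv ▸ hz⟩
  · obtain ⟨y, hy⟩ := hm v
    obtain ⟨w, hw⟩ := haz v
    rw [unstar_apply hv] at hy
    refine ⟨y - z * w, ?_⟩
    push_cast
    rw [← hz, ← hw, ← hy]; ring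

/-- The coordinates of a lattice point are integral up to a multiple of a given one. -/
lemma exists_sub_smul {Λ' Λ : AddSubgroup E} {p : ℕ} (hp : PrimeIdx p Λ' Λ) {T : Finset E}
    (hT : Mult Λ' 1 T) {a : E →₀ ℝ} (haT : a.support ⊆ T) (hn : lc a ∈ Λ) (hn' : lc a ∉ Λ')
    {l : E →₀ ℝ} (hl : l.support ⊆ T) (hlc : lc l ∈ Λ) :
    ∃ i : ℤ, ∀ v, ∃ z : ℤ, l v - i * a v = z := by
  obtain ⟨i, hi⟩ := hp.exists_zsmul _ hn hn' _ hlc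
  refine ⟨i, fun v => ?_⟩
  have := mult_one_iff.1 hT (l - (i : ℝ) • a)
    (Finsupp.support_sub.trans (Finset.union_subset hl (Finsupp.support_smul.trans haT)))
    (by simpa [Int.cast_smul_eq_zsmul] using hi) v
  simpa using this

/-- Stellar subdivision at a fractional point. -/
lemma Mult.star_fractional {Λ' Λ : AddSubgroup E} {p : ℕ} (hp : PrimeIdx p Λ' Λ)
    {T R : Finset E} (hT : Mult Λ' 1 T) {a : E →₀ ℝ} (haT : a.support ⊆ T) (hnT : lc a ∉ T)
    (hn : lc a ∈ Λ) (hn' : lc a ∉ Λ') (hpa : ∀ v, ∃ z : ℤ, (p : ℝ) * a v = z)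
    {u : E} (hu0 : 0 < a u) (hu1 : a u < 1) (hR : R ⊆ T) (huR : u ∉ R) :
    Good Λ p (insert (lc a) R) := by
  have hu : u ∈ a.support := Finsupp.mem_support_iff.2 hu0.ne'
  have hun : u ≠ lc a := fun h => hnT (h ▸ haT hu)
  have hp0 : (0 : ℝ) < p := by exact_mod_cast hp.prime.pos
  obtain ⟨j, hj⟩ := hpa u
  have hj0 : 0 < j := by
    have : (0 : ℝ) < j := hj ▸ mul_pos hp0 hu0
    exact_mod_cast this
  have hjp : j < p := by
    have : (j : ℝ) < p := by rw [← hj]; nlinarith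
    exact_mod_cast this
  lift j to ℕ using hj0.le
  refine Mult.good (N := j) ?_ (by exact_mod_cast hj0.ne') (by exact_mod_cast hjp)
  intro l hl hlc v
  have hs := support_unstar hl hR haT
  obtain ⟨i, hi⟩ := exists_sub_smul hp hT haT hn hn' hs (by rwa [lc_unstar])
  obtain ⟨z, hz⟩ := hi u
  rw [unstar_apply_of_notMem hl huR hun] at hz
  have hzj : (j : ℝ) * (l (lc a) - i) = p * z := by
    rw [← hz]
    have : (j : ℝ) = p * a u := by rw [hj]; simp
    rw [this]; ring
  by_cases hv : v = lc a
  · refine ⟨p * z + j * i, ?_⟩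
    push_cast
    rw [hv, ← hzj]; ring
  · obtain ⟨y, hy⟩ := hi v
    rw [unstar_apply hv] at hy
    obtain ⟨w, hw⟩ := hpa v
    refine ⟨j * y - z * w, ?_⟩
    push_cast
    rw [← hw, ← hy]
    linear_combination (-a v) * hzj

/-- If a face misses a fractional coordinate of the nontrivial class, it is unimodular. -/
lemma Mult.of_not_subset {Λ' Λ : AddSubgroup E} {p : ℕ} (hp : PrimeIdx p Λ' Λ)
    {T S : Finset E} (hT : Mult Λ' 1 T) {a : E →₀ ℝ} (haT : a.support ⊆ T)
    (hn : lc a ∈ Λ) (hn' : lc a ∉ Λ') (hpa : ∀ v, ∃ z : ℤ, (p : ℝ) * a v = z)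
    {u : E} (hu0 : 0 < a u) (hu1 : a u < 1) (hS : S ⊆ T) (huS : u ∉ S) :
    Mult Λ 1 S := by
  rw [mult_one_iff]
  intro l hl hlc
  have hp0 : (0 : ℝ) < p := by exact_mod_cast hp.prime.pos
  obtain ⟨j, hj⟩ := hpa u
  have hj0 : 0 < j := by
    have : (0 : ℝ) < j := hj ▸ mul_pos hp0 hu0
    exact_mod_cast this
  have hjp : j < p := by
    have : (j : ℝ) < p := by rw [← hj]; nlinarith
    exact_mod_cast this
  obtain ⟨i, hi⟩ := exists_sub_smul hp hT haT hn hn' (hl.trans hS) hlc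
  obtain ⟨z, hz⟩ := hi u
  have hlu : l u = 0 := Finsupp.notMem_support_iff.1 fun h => huS (hl h)
  have hdvd : (p : ℤ) ∣ i * j := by
    refine ⟨-z, ?_⟩
    have : (i * j : ℝ) = p * -z := by rw [← hj, ← hz, hlu]; ring
    exact_mod_cast this
  rcases (Nat.prime_iff_prime_int.1 hp.prime).dvd_or_dvd hdvd with ⟨k, rfl⟩ | h
  · intro v
    obtain ⟨y, hy⟩ := hi v
    obtain ⟨w, hw⟩ := hpa v
    refine ⟨y + k * w, ?_⟩
    push_cast at hy ⊢
    rw [← hy, ← hw]; ring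
  · exact absurd (Int.le_of_dvd hj0 h) (not_le.2 hjp)

/-- A good cell contains no fractional circuit of the bad prime. -/
lemma Good.not_subset {Λ : AddSubgroup E} {p : ℕ} (hp : p.Prime)
    {T : Finset E} (hT : Good Λ p T) {a : E →₀ ℝ}
    (hn : lc a ∈ Λ) (hpa : ∀ v, ∃ z : ℤ, (p : ℝ) * a v = z)
    {u : E} (hu0 : 0 < a u) (hu1 : a u < 1) : ¬ a.support ⊆ T := by
  intro haT
  obtain ⟨N, hN, hq, hM⟩ := hT
  have hp0 : (0 : ℝ) < p := by exact_mod_cast hp.pos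
  obtain ⟨j, hj⟩ := hpa u
  have hj0 : 0 < j := by
    have : (0 : ℝ) < j := hj ▸ mul_pos hp0 hu0
    exact_mod_cast this
  have hjp : j < p := by
    have : (j : ℝ) < p := by rw [← hj]; nlinarith
    exact_mod_cast this
  obtain ⟨z, hz⟩ := hM a haT hn u
  have hdvd : (p : ℤ) ∣ N * j := by
    refine ⟨z, ?_⟩
    have : (N * j : ℝ) = p * z := by rw [← hj, ← hz]; ring
    exact_mod_cast this
  rcases (Nat.prime_iff_prime_int.1 hp).dvd_or_dvd hdvd with h | h
  · exact lt_irrefl _ (hq p hp (by exact_mod_cast h))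
  · exact absurd (Int.le_of_dvd hj0 h) (not_le.2 hjp)

end Lattices

section Folding

open Classical

variable {E : Type} [AddCommGroup E] [Module ℝ E]

/-- The coefficients of the sum of two generators. -/
noncomputable def pairPt (b v : E) : E →₀ ℝ := Finsupp.single b 1 + Finsupp.single v 1

@[simp] lemma lc_pairPt (b v : E) : lc (pairPt b v) = b + v := by simp [pairPt]

omit [AddCommGroup E] [Module ℝ E] in
lemma pairPt_apply {b v : E} (h : b ≠ v) (w : E) :
    pairPt b v w = if w = b ∨ w = v then 1 else 0 := by
  by_cases h1 : w = b
  · subst h1; simp [pairPt, h.symm]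
  · by_cases h2 : w = v
    · subst h2; simp [pairPt, h]
    · simp [pairPt, h1, h2]

omit [AddCommGroup E] [Module ℝ E] in
lemma pairPt_support {b v : E} (h : b ≠ v) : (pairPt b v).support = {b, v} := by
  ext w
  simp only [Finsupp.mem_support_iff, pairPt_apply h, Finset.mem_insert, Finset.mem_singleton]
  split_ifs with h' <;> simp [h']

omit [AddCommGroup E] [Module ℝ E] in
lemma pairPt_nonneg {b v : E} (h : b ≠ v) (w : E) : 0 ≤ pairPt b v w := by
  rw [pairPt_apply h]; split_ifs <;> norm_num

lemma stellar_pair_subdivides {K : Set (Finset E)} (hK : IsFan K) {b v : E} (h : b ≠ v) :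
    Subdivides (stellar K (pairPt b v)) K :=
  star_subdivides hK (pairPt_nonneg h) (by rw [pairPt_support h, Finset.card_pair h]; norm_num)

lemma stellar_pair_forall {K : Set (Finset E)} (hK : IsFan K) {b v : E} (h : b ≠ v)
    {Q : Finset E → Prop} (hmono : ∀ S R, R ⊆ S → Q S → Q R)
    (h₁ : ∀ S ∈ K, ¬ (b ∈ S ∧ v ∈ S) → Q S)
    (h₂ : ∀ T ∈ K, b ∈ T → v ∈ T → b + v ∉ T →
      Q (insert (b + v) (T.erase b)) ∧ Q (insert (b + v) (T.erase v))) :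
    ∀ S ∈ stellar K (pairPt b v), Q S := by
  apply star_forall
  · intro S hS h'
    apply h₁ S hS
    rintro ⟨hb, hv⟩
    rw [pairPt_support h] at h'
    exact h' (Finset.insert_subset hb (by simpa using hv))
  · intro T hT hs R hR u hu huR
    have hn := hK.lc_notMem (pairPt_nonneg h)
      (by rw [pairPt_support h, Finset.card_pair h]; norm_num) (hK.mono T hT _ hs) hT
    rw [pairPt_support h] at hu hs
    rw [lc_pairPt] at hn ⊢
    obtain ⟨hb, hv⟩ := h₂ T hT (hs (by simp)) (hs (by simp)) hn
    rcases Finset.mem_insert.1 hu with rfl | hu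
    · exact hmono _ _ (Finset.insert_subset_insert _ (Finset.subset_erase.2 ⟨hR, huR⟩)) hb
    · rw [Finset.mem_singleton] at hu; subst hu
      exact hmono _ _ (Finset.insert_subset_insert _ (Finset.subset_erase.2 ⟨hR, huR⟩)) hv

lemma Mult.stellar_pair {Λ : AddSubgroup E} {N : ℕ} {T : Finset E} (h : Mult Λ N T)
    {b v : E} (hbv : b ≠ v) (hb : b ∈ T) (hv : v ∈ T) (hn : b + v ∉ T) :
    Mult Λ N (insert (b + v) (T.erase b)) ∧ Mult Λ N (insert (b + v) (T.erase v)) := by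
  have hs : (pairPt b v).support ⊆ T := by
    rw [pairPt_support hbv]; exact Finset.insert_subset hb (by simpa using hv)
  have hz : ∀ w, ∃ z : ℤ, pairPt b v w = z := by
    intro w; rw [pairPt_apply hbv]
    split_ifs <;> [exact ⟨1, by simp⟩; exact ⟨0, by simp⟩]
  rw [← lc_pairPt] at hn ⊢
  exact ⟨h.star_integral hs hn hz (u := b) (by simp [pairPt_support hbv])
      (by simp [pairPt_apply hbv]) (Finset.erase_subset _ _) (Finset.notMem_erase _ _),
    h.star_integral hs hn hz (u := v) (by simp [pairPt_support hbv])
      (by simp [pairPt_apply hbv]) (Finset.erase_subset _ _) (Finset.notMem_erase _ _)⟩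

lemma Good.stellar_pair {Λ : AddSubgroup E} {B : ℕ} {T : Finset E} (h : Good Λ B T)
    {b v : E} (hbv : b ≠ v) (hb : b ∈ T) (hv : v ∈ T) (hn : b + v ∉ T) :
    Good Λ B (insert (b + v) (T.erase b)) ∧ Good Λ B (insert (b + v) (T.erase v)) := by
  obtain ⟨N, h0, h1, h2⟩ := h
  obtain ⟨h3, h4⟩ := h2.stellar_pair hbv hb hv hn
  exact ⟨⟨N, h0, h1, h3⟩, ⟨N, h0, h1, h4⟩⟩

lemma stellar_pair_vertex {K : Set (Finset E)} {b v w : E} (hw : {w} ∈ stellar K (pairPt b v)) :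
    {w} ∈ K ∨ w = b + v := by
  rcases hw with ⟨h, -⟩ | ⟨R, h, -, -⟩
  · exact Or.inl h
  · right
    have : b + v ∈ ({w} : Finset E) := by rw [h]; simp
    exact (Finset.mem_singleton.1 this).symm

/-- A fan whose generators have `s`-values `1, 0, -1, -2, …` has a subdivision in which no cone
contains generators with `s`-values of both signs. -/
theorem exists_fold {K : Set (Finset E)} (hK : IsFan K) (s : E →ₗ[ℝ] ℝ)
    (hs : ∀ v, {v} ∈ K → s v = 1 ∨ ∃ z : ℕ, s v = -z)
    {Q : Finset E → Prop} (hmono : ∀ S R, R ⊆ S → Q S → Q R)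
    (hstep : ∀ T b v, Q T → b ∈ T → v ∈ T → s b < 0 → s v = 1 → b + v ∉ T →
      Q (insert (b + v) (T.erase b)) ∧ Q (insert (b + v) (T.erase v)))
    (hQ : ∀ S ∈ K, Q S) :
    ∃ K', Subdivides K' K ∧ (∀ v, {v} ∈ K' → s v = 1 ∨ ∃ z : ℕ, s v = -z) ∧
      (∀ S ∈ K', Q S) ∧ ∀ S ∈ K', (∀ w ∈ S, 0 ≤ s w) ∨ ∀ w ∈ S, s w ≤ 0 := by
  have main : ∀ C : ℕ, ∀ K : Set (Finset E), IsFan K →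
      (∀ v, {v} ∈ K → s v = 1 ∨ ∃ z : ℕ, s v = -z) → (∀ S ∈ K, Q S) →
      (∀ b v, {b, v} ∈ K → s b < 0 → s v = 1 → -(C : ℝ) ≤ s b) →
      ∃ K', Subdivides K' K ∧ (∀ v, {v} ∈ K' → s v = 1 ∨ ∃ z : ℕ, s v = -z) ∧
      (∀ S ∈ K', Q S) ∧ ∀ b v, {b, v} ∈ K' → s b < 0 → s v = 1 → False := by
    intro C
    induction C with
    | zero =>
      intro K hK hs hQ hC
      refine ⟨K, Subdivides.refl hK, hs, hQ, fun b v h hb hv => ?_⟩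
      have := hC b v h hb hv
      simp at this; linarith
    | succ C ih =>
      intro K hK hs hQ hC
      set Bad : Set (Finset E) → Set (E × E) := fun K =>
        {x | {x.1, x.2} ∈ K ∧ s x.1 = -((C : ℝ) + 1) ∧ s x.2 = 1} with hBad
      have hfin : ∀ K, IsFan K → (Bad K).Finite := by
        intro K hK
        have hV : {v | {v} ∈ K}.Finite :=
          hK.finite.preimage (fun a _ b _ h => Finset.singleton_injective h)
        refine (hV.prod hV).subset ?_
        rintro ⟨b, v⟩ ⟨h, -, -⟩
        exact ⟨hK.mono _ h _ (by simp), hK.mono _ h _ (by simp)⟩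
      induction hn : (Bad K).ncard using Nat.strong_induction_on generalizing K with
      | _ n ihn =>
        by_cases hne : (Bad K).Nonempty
        swap
        · refine ih K hK hs hQ fun b v h hb hv => ?_
          rcases hs b (hK.mono _ h _ (by simp)) with h1 | ⟨z, hz⟩
          · linarith
          · have h2 := hC b v h hb hv
            rw [hz] at h2 ⊢
            have h3 : z ≤ C + 1 := by
              have : (z : ℝ) ≤ ((C + 1 : ℕ) : ℝ) := by linarith
              exact_mod_cast this
            have h4 : z ≠ C + 1 := by
              rintro rfl
              exact hne ⟨(b, v), h, by rw [hz]; push_cast; ring, hv⟩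
            have h5 : z ≤ C := by omega
            have : (z : ℝ) ≤ C := by exact_mod_cast h5
            linarith
        obtain ⟨⟨b, v⟩, hbv, hb, hv⟩ := hne
        simp only at hbv hb hv
        have hb0 : s b < 0 := by rw [hb]; have : (0 : ℝ) ≤ C := C.cast_nonneg; linarith
        have hne : b ≠ v := by rintro rfl; linarith
        have hsub := stellar_pair_subdivides hK hne
        have hsn : s (b + v) = -(C : ℝ) := by rw [map_add, hb, hv]; ring
        have hC0 : (0 : ℝ) ≤ C := C.cast_nonneg
        have hold : ∀ S ∈ stellar K (pairPt b v), b + v ∉ S → S ∈ K := by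
          rintro S (h | ⟨R, rfl, -, -⟩) h'
          · exact h.1
          · simp at h'
        have hlt : (Bad (stellar K (pairPt b v))).ncard < n := by
          rw [← hn]
          refine Set.ncard_lt_ncard ?_ (hfin K hK)
          refine ⟨?_, fun h => ?_⟩
          · rintro ⟨b', v'⟩ ⟨h, hb', hv'⟩
            simp only at h hb' hv'
            refine ⟨hold _ h ?_, hb', hv'⟩
            simp only [Finset.mem_insert, Finset.mem_singleton, not_or]
            constructor
            · rintro rfl; linarith
            · rintro rfl; linarith
          · have h1 : {b, v} ∈ stellar K (pairPt b v) := (h ⟨hbv, hb, hv⟩ : (b, v) ∈ Bad _).1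
            rcases h1 with ⟨-, h⟩ | ⟨R, h, -, -⟩
            · rw [pairPt_support hne] at h; exact h le_rfl
            · have : b + v ∈ ({b, v} : Finset E) := by rw [h]; simp
              simp only [Finset.mem_insert, Finset.mem_singleton] at this
              rcases this with h | h
              · rw [h] at hsn; linarith
              · rw [h] at hsn; linarith
        have hs' : ∀ w, {w} ∈ stellar K (pairPt b v) → s w = 1 ∨ ∃ z : ℕ, s w = -z := by
          intro w hw
          rcases stellar_pair_vertex hw with hw | rfl
          · exact hs w hw
          · exact Or.inr ⟨C, hsn⟩
        have hQ' : ∀ S ∈ stellar K (pairPt b v), Q S :=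
          stellar_pair_forall hK hne hmono (fun S hS _ => hQ S hS)
            fun T hT hbT hvT hn => hstep T b v (hQ T hT) hbT hvT hb0 hv hn
        have hC' : ∀ b' v', {b', v'} ∈ stellar K (pairPt b v) → s b' < 0 → s v' = 1 →
            -((C + 1 : ℕ) : ℝ) ≤ s b' := by
          intro b' v' h hb' hv'
          by_cases h' : b + v ∈ ({b', v'} : Finset E)
          · simp only [Finset.mem_insert, Finset.mem_singleton] at h'
            rcases h' with h | h
            · rw [← h, hsn]; push_cast; linarith
            · rw [h] at hsn; linarith
          · exact hC b' v' (hold _ h h') hb' hv'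
        obtain ⟨K', h1, h2, h3, h4⟩ := ihn _ hlt _ hsub.fan hs' hQ' hC' rfl
        exact ⟨K', h1.trans hsub, h2, h3, h4⟩
  have hV : {v | {v} ∈ K}.Finite :=
    hK.finite.preimage (fun a _ b _ h => Finset.singleton_injective h)
  obtain ⟨M, hM⟩ := (hV.image s).bddBelow
  obtain ⟨C, hC⟩ := exists_nat_ge (-M)
  obtain ⟨K', h1, h2, h3, h4⟩ := main C K hK hs hQ fun b v h _ _ => by
    have : M ≤ s b := hM ⟨b, hK.mono _ h _ (by simp), rfl⟩
    linarith
  refine ⟨K', h1, h2, h3, fun S hS => ?_⟩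
  by_contra! h
  obtain ⟨⟨b, hb, hb'⟩, v, hv, hv'⟩ := h
  refine h4 b v (h1.fan.mono S hS _ ?_) hb' ?_
  · exact Finset.insert_subset hb (by simpa using hv)
  · rcases h2 v (h1.fan.mono S hS _ (by simpa using hv)) with h | ⟨z, hz⟩
    · exact h
    · have : (0 : ℝ) ≤ z := z.cast_nonneg
      linarith

/-- A subcomplex of a fan is a fan. -/
lemma IsFan.subcomplex {K : Set (Finset E)} (hK : IsFan K) (Z : Set E) :
    IsFan {S | S ∈ K ∧ ∀ w ∈ S, w ∈ Z} :=
  ⟨hK.finite.subset fun _ h => h.1,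
    fun _ h R hR => ⟨hK.mono _ h.1 R hR, fun w hw => h.2 w (hR hw)⟩,
    hK.inj.mono (by rintro l ⟨h, h'⟩; exact ⟨h, h'.1⟩)⟩

lemma spt_subcomplex {K : Set (Finset E)} (s : E →ₗ[ℝ] ℝ)
    (hK : ∀ S ∈ K, (∀ w ∈ S, 0 ≤ s w) ∨ ∀ w ∈ S, s w ≤ 0) :
    spt {S | S ∈ K ∧ ∀ w ∈ S, w ∈ {x | 0 ≤ s x}} = {x | x ∈ spt K ∧ 0 ≤ s x} ∧
    spt {S | S ∈ K ∧ ∀ w ∈ S, w ∈ {x | s x = 0}} = {x | x ∈ spt K ∧ s x = 0} := by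
  have hsum : ∀ l : E →₀ ℝ, s (lc l) = ∑ v ∈ l.support, l v * s v := fun l => by
    rw [map_lc_eq_sum s l le_rfl]; rfl
  have hpos : ∀ l ∈ realization K, ∀ w ∈ l.support, 0 < l w := fun l hl w hw =>
    lt_of_le_of_ne (hl.1 w) (Ne.symm (Finsupp.mem_support_iff.1 hw))
  have hz1 : ∀ l ∈ realization K, (∀ w ∈ l.support, s w ≤ 0) → 0 ≤ s (lc l) →
      ∀ w ∈ l.support, s w = 0 := by
    intro l hl h h0 w hw
    have h1 : ∀ v ∈ l.support, l v * s v ≤ 0 := fun v hv =>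
      mul_nonpos_of_nonneg_of_nonpos (hl.1 v) (h v hv)
    have h2 : ∑ v ∈ l.support, l v * s v = 0 :=
      le_antisymm (Finset.sum_nonpos h1) (hsum l ▸ h0)
    have := (Finset.sum_eq_zero_iff_of_nonpos h1).1 h2 w hw
    rcases mul_eq_zero.1 this with h | h
    · exact absurd h (hpos l hl w hw).ne'
    · exact h
  have hz2 : ∀ l ∈ realization K, (∀ w ∈ l.support, 0 ≤ s w) → s (lc l) = 0 →
      ∀ w ∈ l.support, s w = 0 := by
    intro l hl h h0 w hw
    have h1 : ∀ v ∈ l.support, 0 ≤ l v * s v := fun v hv => mul_nonneg (hl.1 v) (h v hv)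
    have := (Finset.sum_eq_zero_iff_of_nonneg h1).1 (hsum l ▸ h0) w hw
    rcases mul_eq_zero.1 this with h | h
    · exact absurd h (hpos l hl w hw).ne'
    · exact h
  constructor
  · ext x
    constructor
    · rintro ⟨l, ⟨h0, h1, h2⟩, rfl⟩
      refine ⟨⟨l, ⟨h0, h1⟩, rfl⟩, ?_⟩
      rw [hsum]
      exact Finset.sum_nonneg fun v hv => mul_nonneg (h0 v) (h2 v hv)
    · rintro ⟨⟨l, hl, rfl⟩, h⟩
      refine ⟨l, ⟨hl.1, hl.2, ?_⟩, rfl⟩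
      rcases hK _ hl.2 with h' | h'
      · exact h'
      · exact fun w hw => (hz1 l hl h' h w hw).ge
  · ext x
    constructor
    · rintro ⟨l, ⟨h0, h1, h2⟩, rfl⟩
      refine ⟨⟨l, ⟨h0, h1⟩, rfl⟩, ?_⟩
      rw [hsum]
      exact Finset.sum_eq_zero fun v hv => by rw [show s v = 0 from h2 v hv, mul_zero]
    · rintro ⟨⟨l, hl, rfl⟩, h⟩
      refine ⟨l, ⟨hl.1, hl.2, ?_⟩, rfl⟩
      rcases hK _ hl.2 with h' | h'
      · exact hz2 l hl h' h
      · exact hz1 l hl h' h.ge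

end Folding

section Constructions

open Classical

variable {E E' : Type} [AddCommGroup E] [Module ℝ E] [AddCommGroup E'] [Module ℝ E']

lemma lc_mapDomain (π : E' →ₗ[ℝ] E) (l : E' →₀ ℝ) : lc (l.mapDomain π) = π (lc l) := by
  rw [lc, Finsupp.linearCombination_mapDomain, lc, Finsupp.linearCombination_apply,
    Finsupp.linearCombination_apply, Finsupp.sum, Finsupp.sum, map_sum]
  simp

/-- The image of a complex. -/
def imageFan (π : E' →ₗ[ℝ] E) (K : Set (Finset E')) : Set (Finset E) :=
  (fun S => S.image π) '' K

lemma exists_mapDomain (π : E' →ₗ[ℝ] E) {S : Finset E'} (hS : Set.InjOn π S) {l : E →₀ ℝ}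
    (hl : l.support ⊆ S.image π) :
    ∃ l' : E' →₀ ℝ, l'.support ⊆ S ∧ l'.mapDomain π = l ∧ ∀ v ∈ S, l' v = l (π v) := by
  refine ⟨Finsupp.onFinset S (fun v => if v ∈ S then l (π v) else 0) ?_, ?_, ?_, ?_⟩
  · intro v hv
    by_contra h
    simp [h] at hv
  · exact Finsupp.support_onFinset_subset
  · rw [Finsupp.mapDomain, Finsupp.onFinset_sum _ (by simp)]
    have : ∑ v ∈ S, Finsupp.single (π v) (if v ∈ S then l (π v) else 0)
        = ∑ w ∈ S.image π, Finsupp.single w (l w) := by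
      rw [Finset.sum_image hS]
      exact Finset.sum_congr rfl fun v hv => by rw [if_pos hv]
    rw [this]
    conv_rhs => rw [← Finsupp.sum_single l]
    exact (Finsupp.sum_of_support_subset _ hl _ (by simp)).symm
  · intro v hv
    simp [hv]

lemma injOn_vertices {π : E' →ₗ[ℝ] E} {K : Set (Finset E')} (hπ : Set.InjOn π (spt K)) : Set.InjOn π {v | {v} ∈ K} := by
  intro v hv w hw h
  have hm : ∀ v : E', {v} ∈ K → v ∈ spt K := fun v hv =>
    ⟨Finsupp.single v 1, ⟨single_nonneg_apply v, by
      rwa [Finsupp.support_single _ one_ne_zero]⟩, by simp⟩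
  exact hπ (hm v hv) (hm w hw) h

lemma injOn_cell {π : E' →ₗ[ℝ] E} {K : Set (Finset E')} (hK : IsFan K)
    (hπ : Set.InjOn π (spt K)) {S : Finset E'} (hS : S ∈ K) : Set.InjOn π S :=
  (injOn_vertices hπ).mono fun v hv => hK.mono S hS _ (by simpa using hv)

lemma realization_imageFan {π : E' →ₗ[ℝ] E} {K : Set (Finset E')} (hK : IsFan K)
    (hπ : Set.InjOn π (spt K)) :
    realization (imageFan π K) = (Finsupp.mapDomain π) '' realization K := by
  ext l
  constructor
  · rintro ⟨h0, S, hS, hl⟩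
    obtain ⟨l', h1, h2, h3⟩ := exists_mapDomain π (injOn_cell hK hπ hS) (l := l) hl.ge
    refine ⟨l', ⟨fun v => ?_, hK.mono S hS _ h1⟩, h2⟩
    by_cases hv : v ∈ S
    · rw [h3 v hv]; exact h0 _
    · rw [Finsupp.notMem_support_iff.1 fun h => hv (h1 h)]
  · rintro ⟨l', ⟨h0, hS⟩, rfl⟩
    refine ⟨fun v => ?_, _, hS, (Finsupp.mapDomain_support_of_injOn _ (injOn_cell hK hπ hS)).symm⟩
    rw [Finsupp.mapDomain, Finsupp.sum_apply]
    refine Finset.sum_nonneg fun w _ => ?_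
    dsimp only
    rw [Finsupp.single_apply]; split_ifs <;> [exact h0 w; exact le_rfl]

theorem isFan_imageFan {π : E' →ₗ[ℝ] E} {K : Set (Finset E')} (hK : IsFan K)
    (hπ : Set.InjOn π (spt K)) : IsFan (imageFan π K) := by
  refine ⟨hK.finite.image _, ?_, ?_⟩
  · rintro _ ⟨S, hS, rfl⟩ R hR
    obtain ⟨R', hR', rfl⟩ := Finset.subset_image_iff.1 hR
    exact ⟨R', hK.mono S hS _ (by exact_mod_cast hR'), rfl⟩
  · rw [realization_imageFan hK hπ]
    rintro _ ⟨l₁, h₁, rfl⟩ _ ⟨l₂, h₂, rfl⟩ h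
    rw [lc_mapDomain, lc_mapDomain] at h
    rw [hK.inj h₁ h₂ (hπ ⟨l₁, h₁, rfl⟩ ⟨l₂, h₂, rfl⟩ h)]

theorem spt_imageFan {π : E' →ₗ[ℝ] E} {K : Set (Finset E')} (hK : IsFan K)
    (hπ : Set.InjOn π (spt K)) : spt (imageFan π K) = π '' spt K := by
  rw [spt, realization_imageFan hK hπ, Set.image_image, spt, Set.image_image]
  exact Set.image_congr fun l _ => lc_mapDomain π l

lemma mem_vertices_imageFan {π : E' →ₗ[ℝ] E} {K : Set (Finset E')} (hK : IsFan K)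
    {v : E} (hv : {v} ∈ imageFan π K) : ∃ w, {w} ∈ K ∧ π w = v := by
  obtain ⟨S, hS, h⟩ := hv
  have : v ∈ S.image π := by rw [show S.image π = {v} from h]; simp
  obtain ⟨w, hw, rfl⟩ := Finset.mem_image.1 this
  exact ⟨w, hK.mono S hS _ (by simpa using hw), rfl⟩

lemma Mult.image {π : E' →ₗ[ℝ] E} {Λ' : AddSubgroup E'} {Λ : AddSubgroup E} {N : ℕ}
    {S : Finset E'} (h : Mult Λ' N S) (hS : Set.InjOn π S)
    (hΛ : ∀ l : E' →₀ ℝ, l.support ⊆ S → π (lc l) ∈ Λ → lc l ∈ Λ') :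
    Mult Λ N (S.image π) := by
  intro l hl hlc v
  obtain ⟨l', h1, rfl, h3⟩ := exists_mapDomain π hS hl
  by_cases hv : v ∈ S.image π
  · obtain ⟨w, hw, rfl⟩ := Finset.mem_image.1 hv
    rw [← h3 w hw]
    rw [lc_mapDomain] at hlc
    exact h l' h1 (hΛ l' h1 hlc) w
  · exact ⟨0, by rw [Finsupp.notMem_support_iff.1 fun h => hv (hl h)]; simp⟩

/-- The cone over a complex with apex `o`. -/
def coneJoin (o : E) (K : Set (Finset E)) : Set (Finset E) := {S | S.erase o ∈ K}

lemma lc_erase_add (l : E →₀ ℝ) (o : E) : lc (l.erase o) + l o • o = lc l := by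
  rw [lc_erase]; abel

section ConeJoin

variable {K : Set (Finset E)} {o : E} {r : E →ₗ[ℝ] ℝ}

omit [AddCommGroup E] [Module ℝ E] in
lemma erase_mem_realization {l : E →₀ ℝ} (hl : l ∈ realization (coneJoin o K)) :
    l.erase o ∈ realization K := by
  refine ⟨fun v => ?_, by rw [Finsupp.support_erase]; exact hl.2⟩
  rw [Finsupp.erase_apply]
  split_ifs <;> [exact le_rfl; exact hl.1 v]

lemma coneJoin_coord (hr : ∀ S ∈ K, ∀ v ∈ S, r v = 0) (ho : r o = 1) {l : E →₀ ℝ}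
    (hl : l ∈ realization (coneJoin o K)) : r (lc l) = l o := by
  rw [← lc_erase_add l o, map_add, map_lc_eq_sum r _ le_rfl,
    Finset.sum_eq_zero fun v hv => by
      rw [hr _ (erase_mem_realization hl).2 v hv, smul_zero]]
  simp [ho]

theorem isFan_coneJoin (hK : IsFan K) (hr : ∀ S ∈ K, ∀ v ∈ S, r v = 0) (ho : r o = 1) :
    IsFan (coneJoin o K) := by
  refine ⟨?_, fun S hS R hR => hK.mono _ hS _ (Finset.erase_subset_erase _ hR), ?_⟩
  · refine (hK.finite.union (hK.finite.image (insert o))).subset fun S hS => ?_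
    by_cases h : o ∈ S
    · exact Or.inr ⟨_, hS, Finset.insert_erase h⟩
    · left
      have : S.erase o ∈ K := hS
      rwa [Finset.erase_eq_of_notMem h] at this
  · intro l₁ h₁ l₂ h₂ h
    have ho' : l₁ o = l₂ o := by
      rw [← coneJoin_coord hr ho h₁, ← coneJoin_coord hr ho h₂, h]
    have := hK.inj (erase_mem_realization h₁) (erase_mem_realization h₂)
      (by rw [lc_erase, lc_erase, h, ho'])
    rw [← Finsupp.single_add_erase o l₁, ← Finsupp.single_add_erase o l₂, this, ho']

theorem spt_coneJoin (hK : IsFan K) (hr : ∀ S ∈ K, ∀ v ∈ S, r v = 0) (ho : r o = 1) :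
    spt (coneJoin o K) = {x | ∃ y ∈ spt K, ∃ t : ℝ, 0 ≤ t ∧ x = y + t • o} := by
  ext x
  constructor
  · rintro ⟨l, hl, rfl⟩
    exact ⟨_, ⟨_, erase_mem_realization hl, rfl⟩, l o, hl.1 o, (lc_erase_add l o).symm⟩
  · rintro ⟨_, ⟨l, hl, rfl⟩, t, ht, rfl⟩
    have hlo : o ∉ l.support := fun h => by
      have := hr _ hl.2 o h
      rw [ho] at this; exact one_ne_zero this
    refine ⟨l + Finsupp.single o t, ⟨fun v => ?_, ?_⟩, by simp⟩
    · have : 0 ≤ (Finsupp.single o t) v := by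
        rw [Finsupp.single_apply]; split_ifs <;> [exact ht; exact le_rfl]
      simpa using add_nonneg (hl.1 v) this
    · refine hK.mono _ hl.2 _ ?_
      intro v hv
      obtain ⟨h1, h2⟩ := Finset.mem_erase.1 hv
      have := Finsupp.support_add h2
      rcases Finset.mem_union.1 this with h | h
      · exact h
      · exact absurd (Finset.mem_singleton.1 (Finsupp.support_single_subset h)) h1

end ConeJoin

end Constructions

section Resolution

open Classical

variable {E : Type} [AddCommGroup E] [Module ℝ E]

lemma star_vertex {K : Set (Finset E)} {a : E →₀ ℝ} {w : E} (hw : {w} ∈ stellar K a) :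
    {w} ∈ K ∨ w = lc a := by
  rcases hw with ⟨h, -⟩ | ⟨R, h, -, -⟩
  · exact Or.inl h
  · right
    have : lc a ∈ ({w} : Finset E) := by rw [h]; simp
    exact (Finset.mem_singleton.1 this).symm

omit [AddCommGroup E] [Module ℝ E] in
lemma single_add_support {b : E} {t : ℝ} {a : E →₀ ℝ} (hb : b ∉ a.support) (ht : t ≠ 0) :
    (Finsupp.single b t + a).support = insert b a.support := by
  ext v
  by_cases hv : v = b
  · subst hv
    simp [ht, Finsupp.notMem_support_iff.1 hb]
  · simp [hv]

/-- Resolving the cells through the generator `b` that contain a given fractional circuit `a`. -/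
theorem exists_resolution {p : ℕ} {Λ' Λ : AddSubgroup E} (hp : PrimeIdx p Λ' Λ)
    (s : E →ₗ[ℝ] ℝ) {a : E →₀ ℝ} (ha0 : ∀ v, 0 ≤ a v) (ha1 : ∀ v, a v < 1)
    (hpa : ∀ v, ∃ z : ℤ, (p : ℝ) * a v = z) (hm : lc a ∈ Λ) (hm' : lc a ∉ Λ')
    {v₀ : E} (hv₀ : v₀ ∈ a.support) (hsv₀ : s v₀ = 1) (hv₀Λ : v₀ ∈ Λ')
    (hsF : ∀ v ∈ a.support, 0 ≤ s v) {k : ℕ} (hk : 1 ≤ k) (hsm : s (lc a) = k)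
    {W : E → Prop} (hW₁ : ∀ w, W w → s w < 0 → W (w + v₀))
    (hW₂ : ∀ w, W w → s w ≤ -(k : ℝ) → W (w + lc a)) {c : ℕ} (hkc : k ≤ c) :
    ∀ (K : Set (Finset E)) (b : E), IsFan K → W b → b ∈ Λ' → s b = -(c : ℝ) →
      (∀ S ∈ K, b ∈ S → ¬ Good Λ p S →
        Mult Λ' 1 S ∧ a.support ⊆ S ∧ ∀ w ∈ S, w ≠ b → 0 ≤ s w) →
      ∃ K', Subdivides K' K ∧ (∀ v, {v} ∈ K' → {v} ∈ K ∨ W v) ∧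
        ∀ S ∈ K', ¬ Good Λ p S →
          (S ∈ K ∧ b ∉ S) ∨ ((∀ w ∈ S, 0 ≤ s w) ∧ ∃ w ∈ S, 0 < s w) := by
  have hpos : ∀ u ∈ a.support, 0 < a u := fun u hu =>
    lt_of_le_of_ne (ha0 u) (Ne.symm (Finsupp.mem_support_iff.1 hu))
  induction c, hkc using Nat.le_induction with
  | base =>
    intro K b hK hWb hbΛ hsb hbad
    by_cases hex : ∃ S ∈ K, b ∈ S ∧ ¬ Good Λ p S
    swap
    · push Not at hex
      exact ⟨K, Subdivides.refl hK, fun v hv => Or.inl hv,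
        fun S hS hg => Or.inl ⟨hS, fun hb => hg (hex S hS hb)⟩⟩
    have hk0 : (0 : ℝ) < k := by exact_mod_cast hk
    have hbF : b ∉ a.support := fun h => by have := hsF b h; linarith
    set a' := Finsupp.single b 1 + a with ha'
    have hsupp : a'.support = insert b a.support := single_add_support hbF one_ne_zero
    have hlc : lc a' = b + lc a := by simp [ha']
    have ha'nn : ∀ v, 0 ≤ a' v := fun v => by
      simpa [ha'] using add_nonneg (single_nonneg_apply b v) (ha0 v)
    have hcard : 1 < a'.support.card := by
      rw [hsupp, Finset.card_insert_of_notMem hbF]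
      have := Finset.card_pos.2 ⟨v₀, hv₀⟩
      omega
    have hpa' : ∀ v, ∃ z : ℤ, (p : ℝ) * a' v = z := by
      intro v
      obtain ⟨z, hz⟩ := hpa v
      rw [ha', Finsupp.add_apply, mul_add, hz, Finsupp.single_apply]
      split_ifs
      · exact ⟨p + z, by push_cast; ring⟩
      · exact ⟨z, by ring⟩
    have hval : ∀ u ∈ a.support, a' u = a u := by
      intro u hu
      have : b ≠ u := fun h => hbF (h ▸ hu)
      simp [ha', this]
    refine ⟨stellar K a', star_subdivides hK ha'nn hcard, fun v hv => ?_, ?_⟩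
    · rcases star_vertex hv with h | rfl
      · exact Or.inl h
      · rw [hlc]; exact Or.inr (hW₂ b hWb hsb.le)
    apply star_forall
    · intro S hS hns hg
      left
      refine ⟨hS, fun hbS => hns ?_⟩
      rw [hsupp]
      exact Finset.insert_subset hbS (hbad S hS hbS hg).2.1
    · intro T hT hsT R hR u hu huR hg
      right
      have hnT := hK.lc_notMem ha'nn hcard (hK.mono T hT _ hsT) hT
      rw [hsupp] at hsT hu
      have hFT : a.support ⊆ T := (Finset.subset_insert _ _).trans hsT
      have hTbad : ¬ Good Λ p T := fun h =>
        h.not_subset hp.prime hm hpa (hpos v₀ hv₀) (ha1 v₀) hFT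
      obtain ⟨hTm, -, hTs⟩ := hbad T hT (hsT (Finset.mem_insert_self _ _)) hTbad
      have hFR : a.support ⊆ R := by
        intro u' hu'
        by_contra hu'R
        refine hg (Mult.star_fractional hp hTm (hsupp ▸ hsT) hnT ?_ ?_ hpa'
          (u := u') ?_ ?_ hR hu'R)
        · rw [hlc]; exact Λ.add_mem (hp.le hbΛ) hm
        · rw [hlc]; exact fun h => hm' ((Λ'.add_mem_cancel_left hbΛ).1 h)
        · rw [hval u' hu']; exact hpos u' hu'
        · rw [hval u' hu']; exact ha1 u'
      have hbR : b ∉ R := by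
        rcases Finset.mem_insert.1 hu with rfl | hu
        · exact huR
        · exact absurd (hFR hu) huR
      refine ⟨fun w hw => ?_, v₀, Finset.mem_insert_of_mem (hFR hv₀), by rw [hsv₀]; norm_num⟩
      rcases Finset.mem_insert.1 hw with rfl | hw
      · rw [hlc, map_add, hsb, hsm]; simp
      · exact hTs w (hR hw) fun h => hbR (h ▸ hw)
  | succ c hkc ih =>
    intro K b hK hWb hbΛ hsb hbad
    by_cases hex : ∃ S ∈ K, b ∈ S ∧ ¬ Good Λ p S
    swap
    · push Not at hex
      exact ⟨K, Subdivides.refl hK, fun v hv => Or.inl hv,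
        fun S hS hg => Or.inl ⟨hS, fun hb => hg (hex S hS hb)⟩⟩
    obtain ⟨S₀, hS₀, hbS₀, hgS₀⟩ := hex
    have hFS₀ := (hbad S₀ hS₀ hbS₀ hgS₀).2.1
    have hc0 : (0 : ℝ) ≤ c := c.cast_nonneg
    push_cast at hsb
    have hsb0 : s b < 0 := by linarith
    have hbF : b ∉ a.support := fun h => by have := hsF b h; linarith
    have hbv : b ≠ v₀ := fun h => hbF (h ▸ hv₀)
    set b' := b + v₀ with hb'
    have hsb' : s b' = -(c : ℝ) := by rw [hb', map_add, hsb, hsv₀]; ring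
    have hb'K : ∀ S ∈ K, b' ∉ S := by
      intro S hS
      have := hK.lc_notMem (pairPt_nonneg hbv)
        (by rw [pairPt_support hbv, Finset.card_pair hbv]; norm_num)
        (hK.mono S₀ hS₀ _ (by
          rw [pairPt_support hbv]
          exact Finset.insert_subset hbS₀ (by simpa using hFS₀ hv₀))) hS
      rwa [lc_pairPt] at this
    have hb'b : b' ≠ b := fun h => hb'K S₀ hS₀ (h ▸ hbS₀)
    have hb'F : b' ∉ a.support := fun h => hb'K S₀ hS₀ (hFS₀ h)
    set K₁ := stellar K (pairPt b v₀) with hK₁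
    have hsub₁ : Subdivides K₁ K := stellar_pair_subdivides hK hbv
    set B₁ : Finset E → Prop := fun S => ∃ T, S ⊆ T ∧ Mult Λ' 1 T ∧ a.support ⊆ T ∧
      ∀ w ∈ T, w ≠ b' → 0 ≤ s w with hB₁
    set B₂ : Finset E → Prop := fun S => ∃ T, S ⊆ T ∧ Mult Λ' 1 T ∧
      insert b (insert b' (a.support.erase v₀)) ⊆ T with hB₂
    have hQ₁ : ∀ S ∈ K₁, Good Λ p S ∨ (S ∈ K ∧ b ∉ S) ∨ B₁ S ∨ B₂ S := by
      refine stellar_pair_forall hK hbv ?_ ?_ ?_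
      · rintro S R hR (h | ⟨h, h'⟩ | ⟨T, hT, h⟩ | ⟨T, hT, h⟩)
        · exact Or.inl (h.mono le_rfl hR)
        · exact Or.inr (Or.inl ⟨hK.mono S h R hR, fun hb => h' (hR hb)⟩)
        · exact Or.inr (Or.inr (Or.inl ⟨T, hR.trans hT, h⟩))
        · exact Or.inr (Or.inr (Or.inr ⟨T, hR.trans hT, h⟩))
      · intro S hS hns
        by_cases hg : Good Λ p S
        · exact Or.inl hg
        · refine Or.inr (Or.inl ⟨hS, fun hbS => hns ⟨hbS, (hbad S hS hbS hg).2.1 hv₀⟩⟩)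
      · intro T hT hbT hvT hnT
        by_cases hg : Good Λ p T
        · exact (hg.stellar_pair hbv hbT hvT hnT).imp Or.inl Or.inl
        · obtain ⟨h1, h2, h3⟩ := hbad T hT hbT hg
          obtain ⟨h4, h5⟩ := h1.stellar_pair hbv hbT hvT hnT
          constructor
          · refine Or.inr (Or.inr (Or.inl ⟨_, le_rfl, h4, ?_, ?_⟩))
            · exact (Finset.subset_erase.2 ⟨h2, hbF⟩).trans (Finset.subset_insert _ _)
            · intro w hw hwb'
              have hw := (Finset.mem_insert.1 hw).resolve_left hwb'
              exact h3 w (Finset.mem_of_mem_erase hw) (Finset.ne_of_mem_erase hw)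
          · refine Or.inr (Or.inr (Or.inr ⟨_, le_rfl, h5, ?_⟩))
            refine Finset.insert_subset ?_ (Finset.insert_subset_insert _ ?_)
            · exact Finset.mem_insert_of_mem (Finset.mem_erase.2 ⟨hbv, hbT⟩)
            · exact Finset.erase_subset_erase _ h2
    have h1a : 0 < 1 - a v₀ := by linarith [ha1 v₀]
    set a₂ := Finsupp.single b (1 - a v₀) + (Finsupp.single b' (a v₀) + a.erase v₀) with ha₂
    have he : b' ∉ (a.erase v₀).support := by
      rw [Finsupp.support_erase]; exact fun h => hb'F (Finset.mem_of_mem_erase h)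
    have hs1 : (Finsupp.single b' (a v₀) + a.erase v₀).support
        = insert b' (a.support.erase v₀) := by
      rw [single_add_support he (hpos v₀ hv₀).ne', Finsupp.support_erase]
    have hbs : b ∉ (Finsupp.single b' (a v₀) + a.erase v₀).support := by
      rw [hs1, Finset.mem_insert, not_or]
      exact ⟨hb'b.symm, fun h => hbF (Finset.mem_of_mem_erase h)⟩
    have hs2 : a₂.support = insert b (insert b' (a.support.erase v₀)) := by
      rw [ha₂, single_add_support hbs h1a.ne', hs1]
    have hval : ∀ v, a₂ v = (if v = b then 1 - a v₀ else 0) + ((if v = b' then a v₀ else 0)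
        + if v = v₀ then 0 else a v) := by
      intro v
      simp only [ha₂, Finsupp.add_apply, Finsupp.single_apply, Finsupp.erase_apply,
        eq_comm (a := v)]
    have hab : a b = 0 := Finsupp.notMem_support_iff.1 hbF
    have hab' : a b' = 0 := Finsupp.notMem_support_iff.1 hb'F
    have hb'v₀ : b' ≠ v₀ := fun h => hb'F (h ▸ hv₀)
    have hvalb : a₂ b = 1 - a v₀ := by simp [hval, hb'b.symm, hbv, hab]
    have hvalb' : a₂ b' = a v₀ := by simp [hval, hb'b, hb'v₀, hab']
    have hvalo : ∀ v ∈ a.support.erase v₀, a₂ v = a v := by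
      intro v hv
      obtain ⟨h1, h2⟩ := Finset.mem_erase.1 hv
      have h3 : v ≠ b := fun h => hbF (h ▸ h2)
      have h4 : v ≠ b' := fun h => hb'F (h ▸ h2)
      simp [hval, h1, h3, h4]
    have hrange : ∀ v ∈ a₂.support, 0 < a₂ v ∧ a₂ v < 1 := by
      intro v hv
      rw [hs2] at hv
      rcases Finset.mem_insert.1 hv with rfl | hv
      · rw [hvalb]; exact ⟨h1a, by linarith [hpos v₀ hv₀]⟩
      rcases Finset.mem_insert.1 hv with rfl | hv
      · rw [hvalb']; exact ⟨hpos v₀ hv₀, ha1 v₀⟩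
      · rw [hvalo v hv]; exact ⟨hpos v (Finset.mem_of_mem_erase hv), ha1 v⟩
    have ha₂nn : ∀ v, 0 ≤ a₂ v := by
      intro v
      by_cases hv : v ∈ a₂.support
      · exact (hrange v hv).1.le
      · rw [Finsupp.notMem_support_iff.1 hv]
    have hlc : lc a₂ = b + lc a := by
      simp only [ha₂, map_add, lc_single, lc_erase, hb', smul_add, sub_smul, one_smul]
      abel
    have hpa₂ : ∀ v, ∃ z : ℤ, (p : ℝ) * a₂ v = z := by
      intro v
      by_cases hv : v ∈ a₂.support
      swap
      · exact ⟨0, by rw [Finsupp.notMem_support_iff.1 hv]; simp⟩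
      rw [hs2] at hv
      obtain ⟨z₀, hz₀⟩ := hpa v₀
      rcases Finset.mem_insert.1 hv with rfl | hv
      · refine ⟨p - z₀, ?_⟩
        rw [hvalb]; push_cast; rw [← hz₀]; ring
      rcases Finset.mem_insert.1 hv with rfl | hv
      · exact ⟨z₀, by rw [hvalb', hz₀]⟩
      · rw [hvalo v hv]; exact hpa v
    have hcard : 1 < a₂.support.card := by
      rw [hs2]
      exact Finset.one_lt_card.2 ⟨b, by simp, b', by simp, hb'b.symm⟩
    have hnΛ : lc a₂ ∈ Λ := by rw [hlc]; exact Λ.add_mem (hp.le hbΛ) hm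
    have hnΛ' : lc a₂ ∉ Λ' := by
      rw [hlc]; exact fun h => hm' ((Λ'.add_mem_cancel_left hbΛ).1 h)
    have hsub₂ := star_subdivides hsub₁.fan ha₂nn hcard
    have hba₂ : b ∈ a₂.support := by rw [hs2]; simp
    have hQ₂ : ∀ S ∈ stellar K₁ a₂, Good Λ p S ∨ (S ∈ K ∧ b ∉ S) ∨ B₁ S := by
      apply star_forall
      · intro S hS hns
        rcases hQ₁ S hS with h | h | h | ⟨T, hST, hTm, hT⟩
        · exact Or.inl h
        · exact Or.inr (Or.inl h)
        · exact Or.inr (Or.inr h)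
        · obtain ⟨u, hu, huS⟩ := Finset.not_subset.1 hns
          exact Or.inl (Mult.of_not_subset hp hTm (hs2 ▸ hT) hnΛ hnΛ' hpa₂ (hrange u hu).1
            (hrange u hu).2 hST huS).good_one
      · intro T hT hsT R hR u hu huR
        left
        have hnT := hsub₁.fan.lc_notMem ha₂nn hcard (hsub₁.fan.mono T hT _ hsT) hT
        rcases hQ₁ T hT with h | ⟨-, h⟩ | ⟨T', hT', -, -, h⟩ | ⟨T', hT', hTm, -⟩
        · exact absurd hsT (h.not_subset hp.prime hnΛ hpa₂ (hrange b hba₂).1 (hrange b hba₂).2)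
        · exact absurd (hsT hba₂) h
        · have := h b (hT' (hsT hba₂)) hb'b.symm
          linarith
        · exact Mult.star_fractional hp (hTm.mono le_rfl hT') hsT hnT hnΛ hnΛ' hpa₂
            (hrange u hu).1 (hrange u hu).2 hR huR
    have hmiss : ∀ S, B₁ S → ¬ Good Λ p S → a.support ⊆ S := by
      rintro S ⟨T, hST, hTm, hFT, -⟩ hg u hu
      by_contra huS
      exact hg (Mult.of_not_subset hp hTm hFT hm hm' hpa (hpos u hu) (ha1 u) hST huS).good_one
    obtain ⟨K', hK', hV, hfin⟩ := ih _ b' hsub₂.fan (hW₁ b hWb hsb0) (Λ'.add_mem hbΛ hv₀Λ) hsb' (by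
      intro S hS hb'S hg
      rcases hQ₂ S hS with h | ⟨h, -⟩ | h
      · exact absurd h hg
      · exact absurd hb'S (hb'K S h)
      · obtain ⟨T, hST, hTm, hFT, hTs⟩ := id h
        exact ⟨hTm.mono le_rfl hST, hmiss S h hg, fun w hw hwb => hTs w (hST hw) hwb⟩)
    refine ⟨K', hK'.trans (hsub₂.trans hsub₁), fun v hv => ?_, fun S hS hg => ?_⟩
    · rcases hV v hv with h | h
      · rcases star_vertex h with h | rfl
        · rcases stellar_pair_vertex h with h | rfl
          · exact Or.inl h
          · exact Or.inr (hW₁ b hWb hsb0)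
        · rw [hlc]
          refine Or.inr (hW₂ b hWb ?_)
          have : (k : ℝ) ≤ c := by exact_mod_cast hkc
          linarith
      · exact Or.inr h
    · rcases hfin S hS hg with ⟨h, hb'S⟩ | h
      · rcases hQ₂ S h with h | h | h
        · exact absurd h hg
        · exact Or.inl h
        · right
          have hF := hmiss S h hg
          obtain ⟨T, hST, hTm, hFT, hTs⟩ := h
          refine ⟨fun w hw => hTs w (hST hw) fun h => hb'S (h ▸ hw), v₀, hF hv₀, ?_⟩
          rw [hsv₀]; norm_num
      · exact Or.inr h

end Resolution

section Slices

open Classical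

variable {E : Type} [AddCommGroup E] [Module ℝ E]

noncomputable local instance decidableEqProd {F : Type} : DecidableEq (F × ℝ) :=
  fun a b => Classical.propDecidable (a = b)

/-- The lattice generated by `Λ` and an apex at height one over `m`. -/
def liftLat (Λ : AddSubgroup E) (m : E) : AddSubgroup (E × ℝ) where
  carrier := {x | (∃ z : ℤ, x.2 = z) ∧ x.1 - x.2 • m ∈ Λ}
  zero_mem' := ⟨⟨0, by simp⟩, by simp⟩
  add_mem' := by
    rintro x y ⟨⟨z, hz⟩, hx⟩ ⟨⟨w, hw⟩, hy⟩
    refine ⟨⟨z + w, by simp [hz, hw]⟩, ?_⟩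
    have : (x + y).1 - (x + y).2 • m = (x.1 - x.2 • m) + (y.1 - y.2 • m) := by
      rw [Prod.fst_add, Prod.snd_add, add_smul]; abel
    rw [this]; exact Λ.add_mem hx hy
  neg_mem' := by
    rintro x ⟨⟨z, hz⟩, hx⟩
    refine ⟨⟨-z, by simp [hz]⟩, ?_⟩
    have : (-x).1 - (-x).2 • m = -(x.1 - x.2 • m) := by
      rw [Prod.fst_neg, Prod.snd_neg, neg_smul]; abel
    rw [this]; exact Λ.neg_mem hx

lemma mem_liftLat {Λ : AddSubgroup E} {m : E} {x : E × ℝ} :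
    x ∈ liftLat Λ m ↔ (∃ z : ℤ, x.2 = z) ∧ x.1 - x.2 • m ∈ Λ := Iff.rfl

lemma mem_liftLat_zero {Λ : AddSubgroup E} {x : E × ℝ} :
    x ∈ liftLat Λ 0 ↔ (∃ z : ℤ, x.2 = z) ∧ x.1 ∈ Λ := by simp [mem_liftLat]

lemma PrimeIdx.lift {p : ℕ} {Λ' Λ : AddSubgroup E} (hp : PrimeIdx p Λ' Λ) {m : E} (hm : m ∈ Λ) :
    PrimeIdx p (liftLat Λ' m) (liftLat Λ 0) := by
  have hz : ∀ x : E × ℝ, (∃ z : ℤ, x.2 = z) → x.2 • m ∈ Λ := by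
    rintro x ⟨z, hz⟩
    rw [hz, Int.cast_smul_eq_zsmul]; exact Λ.zsmul_mem hm z
  have hx' : ∀ x ∈ liftLat Λ 0, x.1 - x.2 • m ∈ Λ := fun x hx => by
    rw [mem_liftLat_zero] at hx; exact Λ.sub_mem hx.2 (hz x hx.1)
  refine ⟨hp.prime, fun x hx => ?_, fun x hx => ?_, fun n hn hn' x hx => ?_⟩
  · rw [mem_liftLat_zero]
    refine ⟨hx.1, ?_⟩
    have := Λ.add_mem (hp.le hx.2) (hz x hx.1)
    simpa using this
  · have h1 := hp.smul_mem _ (hx' x hx)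
    obtain ⟨⟨z, hz⟩, -⟩ := hx
    refine ⟨⟨p * z, by simp [hz]⟩, ?_⟩
    simpa [smul_sub, mul_smul, Nat.cast_smul_eq_nsmul] using h1
  · have hn'' : n.1 - n.2 • m ∉ Λ' := fun h => hn' ⟨hn.1, h⟩
    obtain ⟨i, hi⟩ := hp.exists_zsmul _ (hx' n hn) hn'' _ (hx' x hx)
    refine ⟨i, ?_, ?_⟩
    · obtain ⟨⟨z, hz⟩, -⟩ := hx
      obtain ⟨⟨w, hw⟩, -⟩ := hn
      exact ⟨z - i * w, by simp [hz, hw]⟩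
    · have : (x - i • n).1 - (x - i • n).2 • m = x.1 - x.2 • m - i • (n.1 - n.2 • m) := by
        simp only [Prod.fst_sub, Prod.snd_sub, Prod.smul_fst, Prod.smul_snd, smul_sub, sub_smul,
          smul_assoc]
        abel
      rw [this]; exact hi

/-- The fan in `E × ℝ` spanned by `K` at height zero. -/
abbrev baseFan (K : Set (Finset E)) : Set (Finset (E × ℝ)) :=
  imageFan (LinearMap.inl ℝ E ℝ) K

/-- The fan in `E × ℝ` spanned by `K` at height zero and the unit vector. -/
abbrev liftFan (K : Set (Finset E)) : Set (Finset (E × ℝ)) := coneJoin (0, 1) (baseFan K)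

section

variable {K : Set (Finset E)}

lemma isFan_baseFan (hK : IsFan K) : IsFan (baseFan K) :=
  isFan_imageFan hK LinearMap.inl_injective.injOn

lemma baseFan_snd : ∀ S ∈ baseFan K, ∀ v ∈ S, LinearMap.snd ℝ E ℝ v = 0 := by
  rintro _ ⟨S, hS, rfl⟩ v hv
  obtain ⟨w, -, rfl⟩ := Finset.mem_image.1 hv
  simp

lemma isFan_liftFan (hK : IsFan K) : IsFan (liftFan K) :=
  isFan_coneJoin (isFan_baseFan hK) baseFan_snd (by simp)

lemma mem_spt_liftFan (hK : IsFan K) {x : E × ℝ} :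
    x ∈ spt (liftFan K) ↔ x.1 ∈ spt K ∧ 0 ≤ x.2 := by
  rw [liftFan, spt_coneJoin (isFan_baseFan hK) baseFan_snd (by simp), baseFan,
    spt_imageFan hK LinearMap.inl_injective.injOn]
  constructor
  · rintro ⟨_, ⟨y, hy, rfl⟩, t, ht, rfl⟩
    simpa using ⟨hy, ht⟩
  · rintro ⟨h1, h2⟩
    exact ⟨_, ⟨x.1, h1, rfl⟩, x.2, h2, by ext <;> simp⟩

lemma liftFan_cell {S : Finset (E × ℝ)} (hS : S ∈ liftFan K) :
    ∃ S₁ ∈ K, S₁.image (LinearMap.inl ℝ E ℝ) = S.erase (0, 1) := hS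

lemma liftFan_vertex (hK : IsFan K) {S : Finset (E × ℝ)} (hS : S ∈ liftFan K) {w : E × ℝ}
    (hw : w ∈ S) : w = (0, 1) ∨ ∃ x, {x} ∈ K ∧ w = (x, 0) := by
  by_cases h : w = (0, 1)
  · exact Or.inl h
  · right
    obtain ⟨S₁, hS₁, h'⟩ := liftFan_cell hS
    have : w ∈ S₁.image (LinearMap.inl ℝ E ℝ) := h' ▸ Finset.mem_erase.2 ⟨h, hw⟩
    obtain ⟨x, hx, rfl⟩ := Finset.mem_image.1 this
    exact ⟨x, hK.mono _ hS₁ _ (by simpa using hx), rfl⟩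

lemma Mult.base {Λ : AddSubgroup E} {N : ℕ} {S : Finset E} (h : Mult Λ N S) :
    Mult (liftLat Λ 0) N (S.image (LinearMap.inl ℝ E ℝ)) :=
  h.image LinearMap.inl_injective.injOn fun _ _ hl => (mem_liftLat_zero.1 hl).2

lemma Mult.apex {Λ : AddSubgroup E} {N : ℕ} {S : Finset E} (h : Mult Λ N S) {m : E}
    {R : Finset (E × ℝ)} (hR : R ⊆ S.image (LinearMap.inl ℝ E ℝ)) :
    Mult (liftLat Λ m) N (insert (m, 1) R) := by
  intro l hl hlc v
  have hs : (l.erase (m, 1)).support ⊆ S.image (LinearMap.inl ℝ E ℝ) := by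
    rw [Finsupp.support_erase]
    exact ((Finset.erase_subset_erase _ hl).trans (Finset.erase_insert_subset _ _)).trans hR
  have h2 : (lc l).2 = l (m, 1) := by
    have : (lc (l.erase (m, 1))).2 = 0 := by
      have := map_lc_eq_sum (LinearMap.snd ℝ E ℝ) _ hs
      rw [Finset.sum_eq_zero] at this
      · exact this
      · intro v hv
        obtain ⟨w, -, rfl⟩ := Finset.mem_image.1 hv
        simp
    rw [lc_erase] at this
    simp only [Prod.snd_sub, Prod.smul_snd, smul_eq_mul, mul_one] at this
    linarith
  obtain ⟨⟨z, hz⟩, hx⟩ := hlc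
  by_cases hv : v = (m, 1)
  · exact ⟨N * z, by rw [hv, ← h2, hz]; push_cast; ring⟩
  · have := h.base _ hs (by
      rw [mem_liftLat_zero, lc_erase]
      refine ⟨⟨0, by simp [h2]⟩, ?_⟩
      simpa [h2] using hx) v
    simpa [hv] using this

lemma exists_slice {K : Set (Finset (E × ℝ))} (hK : IsFan K) (s : E × ℝ →ₗ[ℝ] ℝ)
    (hs : ∀ S ∈ K, (∀ w ∈ S, 0 ≤ s w) ∨ ∀ w ∈ S, s w ≤ 0) (φ : E →ₗ[ℝ] ℝ)
    (hφ : ∀ x, s x = 0 ↔ x.2 = φ x.1) :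
    IsFan (imageFan (LinearMap.fst ℝ E ℝ) {S | S ∈ K ∧ ∀ w ∈ S, w ∈ {x | s x = 0}}) ∧
    spt (imageFan (LinearMap.fst ℝ E ℝ) {S | S ∈ K ∧ ∀ w ∈ S, w ∈ {x | s x = 0}}) =
      {x | (x, φ x) ∈ spt K} ∧
    ∀ S, (∀ w ∈ S, s w = 0) → ∀ (Λ : AddSubgroup E) (Λ' : AddSubgroup (E × ℝ)),
      (∀ x ∈ Λ, (x, φ x) ∈ Λ') → ∀ N, Mult Λ' N S → Mult Λ N (S.image (LinearMap.fst ℝ E ℝ)) := by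
  have hinj : Set.InjOn (LinearMap.fst ℝ E ℝ) {x | s x = 0} := by
    intro x hx y hy h
    have hx' := (hφ x).1 hx
    have hy' := (hφ y).1 hy
    have h : x.1 = y.1 := h
    exact Prod.ext h (by rw [hx', hy', h])
  have hF := hK.subcomplex {x | s x = 0}
  have hspt := (spt_subcomplex s hs).2
  have hinj' : Set.InjOn (LinearMap.fst ℝ E ℝ)
      (spt {S | S ∈ K ∧ ∀ w ∈ S, w ∈ {x | s x = 0}}) := by
    rw [hspt]; exact hinj.mono fun x hx => hx.2
  refine ⟨isFan_imageFan hF hinj', ?_, ?_⟩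
  · rw [spt_imageFan hF hinj', hspt]
    ext x
    constructor
    · rintro ⟨y, ⟨hy, hy'⟩, rfl⟩
      rw [hφ] at hy'
      have : y = (y.1, φ y.1) := Prod.ext rfl hy'
      rw [this] at hy
      exact hy
    · intro hx
      exact ⟨_, ⟨hx, (hφ _).2 rfl⟩, rfl⟩
  · intro S hS Λ Λ' hΛ N hM
    refine hM.image (hinj.mono hS) fun l hl hlc => ?_
    have h0 : s (lc l) = 0 := by
      rw [map_lc_eq_sum s l hl]
      exact Finset.sum_eq_zero fun v hv => by rw [hS v hv, smul_zero]
    have : lc l = ((lc l).1, φ (lc l).1) := Prod.ext rfl ((hφ _).1 h0)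
    rw [this]; exact hΛ _ hlc

lemma refines_fst {K' : Set (Finset (E × ℝ))} (h : Refines K' (liftFan K)) :
    Refines (imageFan (LinearMap.fst ℝ E ℝ) K') K := by
  rintro _ ⟨S, hS, rfl⟩
  obtain ⟨T, hT, h⟩ := h S hS
  obtain ⟨S₁, hS₁, hS₁T⟩ := liftFan_cell hT
  refine ⟨S₁, hS₁, fun w hw => ?_⟩
  obtain ⟨w', hw', rfl⟩ := Finset.mem_image.1 hw
  obtain ⟨l, h0, hl, rfl⟩ := h w' hw'
  refine ⟨(l.mapDomain (LinearMap.fst ℝ E ℝ)).erase 0, fun v => ?_, ?_, ?_⟩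
  · rw [Finsupp.erase_apply]
    split_ifs
    · exact le_rfl
    · rw [Finsupp.mapDomain, Finsupp.sum_apply]
      refine Finset.sum_nonneg fun w _ => ?_
      dsimp only
      rw [Finsupp.single_apply]; split_ifs <;> [exact h0 w; exact le_rfl]
  · intro v hv
    rw [Finsupp.support_erase] at hv
    obtain ⟨hv0, hv⟩ := Finset.mem_erase.1 hv
    obtain ⟨x, hx, rfl⟩ := Finset.mem_image.1 (Finsupp.mapDomain_support hv)
    have : x ∈ S₁.image (LinearMap.inl ℝ E ℝ) := by
      rw [hS₁T]
      refine Finset.mem_erase.2 ⟨?_, hl hx⟩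
      rintro rfl
      exact hv0 rfl
    obtain ⟨y, hy, rfl⟩ := Finset.mem_image.1 this
    simpa using hy
  · rw [lc_erase, lc_mapDomain]
    simp

end

end Slices

section Reduction

open Classical

variable {E : Type} [AddCommGroup E] [Module ℝ E]

noncomputable local instance decidableEqProd' {F : Type} : DecidableEq (F × ℝ) :=
  fun a b => Classical.propDecidable (a = b)

/-- The points of `Λ` at which `h` is an integral multiple of `D`. -/
def divLat (Λ : AddSubgroup E) (h : E →ₗ[ℝ] ℝ) (D : ℝ) : AddSubgroup E where
  carrier := {x | x ∈ Λ ∧ ∃ z : ℤ, h x = D * z}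
  zero_mem' := ⟨Λ.zero_mem, 0, by simp⟩
  add_mem' := by
    rintro x y ⟨hx, z, hz⟩ ⟨hy, w, hw⟩
    exact ⟨Λ.add_mem hx hy, z + w, by rw [map_add, hz, hw]; push_cast; ring⟩
  neg_mem' := by
    rintro x ⟨hx, z, hz⟩
    exact ⟨Λ.neg_mem hx, -z, by rw [map_neg, hz]; push_cast; ring⟩

/-- A nonzero class of `Λ / Λ'` with coordinates in `[0, 1)` supported on `S`. -/
structure IsCircuit (p : ℕ) (Λ' Λ : AddSubgroup E) (a : E →₀ ℝ) : Prop where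
  nonneg : ∀ v, 0 ≤ a v
  lt_one : ∀ v, a v < 1
  int : ∀ v, ∃ z : ℤ, (p : ℝ) * a v = z
  mem : lc a ∈ Λ
  notMem : lc a ∉ Λ'

lemma IsCircuit.pos {p : ℕ} {Λ' Λ : AddSubgroup E} {a : E →₀ ℝ} (ha : IsCircuit p Λ' Λ a) {v : E}
    (hv : v ∈ a.support) : 0 < a v :=
  lt_of_le_of_ne (ha.nonneg v) (Ne.symm (Finsupp.mem_support_iff.1 hv))

lemma exists_isCircuit {p : ℕ} {Λ' Λ : AddSubgroup E} (hp : PrimeIdx p Λ' Λ) {S : Finset E}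
    (hS : Mult Λ' 1 S) (hSΛ : ∀ v ∈ S, v ∈ Λ') (hbad : ¬ Mult Λ 1 S) :
    ∃ a : E →₀ ℝ, a.support ⊆ S ∧ IsCircuit p Λ' Λ a := by
  rw [mult_one_iff] at hS hbad
  push Not at hbad
  obtain ⟨l, hl, hlΛ, v, hv⟩ := hbad
  set a : E →₀ ℝ := l.mapRange Int.fract Int.fract_zero with ha
  have haS : a.support ⊆ S := Finsupp.support_mapRange.trans hl
  have hal : lc l - lc a ∈ Λ' := by
    rw [lc_support_eq_sum l hl, lc_support_eq_sum a haS, ← Finset.sum_sub_distrib]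
    refine Λ'.sum_mem fun w hw => ?_
    have : l w • w - a w • w = ⌊l w⌋ • w := by
      rw [← sub_smul, ← Int.cast_smul_eq_zsmul ℝ, ha, Finsupp.mapRange_apply, Int.self_sub_fract]
    rw [this]; exact Λ'.zsmul_mem (hSΛ w hw) _
  refine ⟨a, haS, fun w => Int.fract_nonneg _, fun w => Int.fract_lt_one _, fun w => ?_, ?_, ?_⟩
  · obtain ⟨z, hz⟩ := hS ((p : ℝ) • l) (Finsupp.support_smul.trans hl)
      (by rw [map_smul, Nat.cast_smul_eq_nsmul]; exact hp.smul_mem _ hlΛ) w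
    refine ⟨z - p * ⌊l w⌋, ?_⟩
    rw [ha, Finsupp.mapRange_apply, Int.fract, mul_sub]
    push_cast
    rw [← hz]; simp
  · have := Λ.sub_mem hlΛ (hp.le hal)
    simpa using this
  · intro h
    obtain ⟨z, hz⟩ := hS a haS h v
    rw [ha, Finsupp.mapRange_apply] at hz
    refine hv (⌊l v⌋ + z) ?_
    push_cast
    rw [← hz, Int.floor_add_fract]

/-- The form `(x, r) ↦ h x - D r`. -/
noncomputable def tilt (h : E →ₗ[ℝ] ℝ) (D : ℝ) : E × ℝ →ₗ[ℝ] ℝ :=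
  h.comp (LinearMap.fst ℝ E ℝ) - D • LinearMap.snd ℝ E ℝ

@[simp] lemma tilt_apply (h : E →ₗ[ℝ] ℝ) (D : ℝ) (x : E × ℝ) : tilt h D x = h x.1 - D * x.2 := by
  simp [tilt]

/-- Cells on the nonnegative side of `s` that are not contained in its kernel. -/
def Upper {F : Type} [AddCommGroup F] [Module ℝ F] (s : F →ₗ[ℝ] ℝ) (S : Finset F) : Prop :=
  (∀ w ∈ S, 0 ≤ s w) ∧ ∃ w ∈ S, 0 < s w

/-- The new generators allowed in the reduction. -/
def Allowed (Λ : AddSubgroup E) (s : E × ℝ →ₗ[ℝ] ℝ) (w : E × ℝ) : Prop :=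
  w.2 = 1 ∧ w.1 ∈ Λ ∧ ∃ z : ℕ, s w = -z

lemma exists_reduction_step {p : ℕ} {Λ' Λ : AddSubgroup E} (hp : PrimeIdx p Λ' Λ)
    {K : Set (Finset E)} {h : E →ₗ[ℝ] ℝ}
    (hM : ∀ S ∈ K, Mult Λ' 1 S) (hv : ∀ S ∈ K, ∀ v ∈ S, v ∈ Λ')
    (hh : ∀ S ∈ K, ∀ v ∈ S, 0 ≤ h v) {D k : ℕ} (hk : 1 ≤ k) (hkD : 2 * k ≤ D)
    {a : E →₀ ℝ} (ha : IsCircuit p Λ' Λ a) (haK : a.support ∈ K) {x₀ : E} (hx₀ : x₀ ∈ a.support)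
    (hx₀1 : h x₀ = 1) (hak : h (lc a) = k) {L : Set (Finset (E × ℝ))}
    {K₁ : Set (Finset (E × ℝ))} (hK₁ : IsFan K₁)
    (hbad : ∀ S ∈ K₁, ¬ Good (liftLat Λ 0) p S → Upper (tilt h D) S ∨
      ((0, 1) ∈ S ∧ S ∈ liftFan K ∧ ∀ R ∈ L, ¬ R ⊆ S)) :
    ∃ K₂, Subdivides K₂ K₁ ∧ (∀ v, {v} ∈ K₂ → {v} ∈ K₁ ∨ Allowed Λ (tilt h D) v) ∧
      ∀ S ∈ K₂, ¬ Good (liftLat Λ 0) p S → Upper (tilt h D) S ∨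
      ((0, 1) ∈ S ∧ S ∈ liftFan K ∧
        ∀ R ∈ insert (a.support.image (LinearMap.inl ℝ E ℝ)) L, ¬ R ⊆ S) := by
  set s := tilt h D with hs
  set o : E × ℝ := (0, 1) with ho
  set F := a.support.image (LinearMap.inl ℝ E ℝ) with hF
  set α : E × ℝ →₀ ℝ := a.mapDomain (LinearMap.inl ℝ E ℝ) with hα
  have hinj : Function.Injective (LinearMap.inl ℝ E ℝ) := LinearMap.inl_injective
  have hαs : α.support = F := Finsupp.mapDomain_support_of_injective hinj a
  have hαv : ∀ (P : ℝ → Prop), P 0 → (∀ v, P (a v)) → ∀ w, P (α w) := by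
    intro P h0 hP w
    by_cases hw : w ∈ Set.range (LinearMap.inl ℝ E ℝ)
    · obtain ⟨v, rfl⟩ := hw
      rw [hα, Finsupp.mapDomain_apply hinj]; exact hP v
    · rw [hα, Finsupp.mapDomain_of_notMem_range _ _ hw]; exact h0
  have hlα : lc α = (lc a, 0) := by rw [hα, lc_mapDomain]; simp
  have hαint : ∀ v, ∃ z : ℤ, (p : ℝ) * α v = z :=
    hαv (fun t => ∃ z : ℤ, (p : ℝ) * t = z) ⟨0, by simp⟩ ha.int
  have hαnn : ∀ v, 0 ≤ α v := hαv (fun t => 0 ≤ t) le_rfl ha.nonneg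
  have hαlt : ∀ v, α v < 1 := hαv (fun t => t < 1) one_pos ha.lt_one
  have hF2 : ∀ w ∈ F, w.2 = 0 := by
    intro w hw
    obtain ⟨v, -, rfl⟩ := Finset.mem_image.1 hw
    simp
  have hoF : o ∉ F := fun h => by simpa [ho] using hF2 o h
  have hv₀ : ((x₀, 0) : E × ℝ) ∈ F := Finset.mem_image.2 ⟨x₀, hx₀, rfl⟩
  set α' := Finsupp.single o 1 + α with hα'
  have hα's : α'.support = insert o F := by
    rw [hα', single_add_support (by rwa [hαs]) one_ne_zero, hαs]
  set b := lc α' with hb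
  have hb' : b = (lc a, 1) := by rw [hb, hα', map_add, lc_single, hlα, ho]; simp
  by_cases hK : insert o F ∈ K₁
  swap
  · refine ⟨K₁, Subdivides.refl hK₁, fun v hv => Or.inl hv, fun S hS hg => ?_⟩
    rcases hbad S hS hg with h1 | ⟨h1, h2, h3⟩
    · exact Or.inl h1
    · refine Or.inr ⟨h1, h2, ?_⟩
      rintro R (rfl | hR)
      · exact fun hRS => hK (hK₁.mono S hS _ (Finset.insert_subset h1 hRS))
      · exact h3 R hR
  have hα'nn : ∀ v, 0 ≤ α' v := fun v => add_nonneg (single_nonneg_apply o v) (hαnn v)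
  have hcard : 1 < α'.support.card := by
    rw [hα's, Finset.card_insert_of_notMem hoF]
    have := Finset.card_pos.2 ⟨_, hv₀⟩
    omega
  have hα'int : ∀ v, ∃ z : ℤ, (p : ℝ) * α' v = z := by
    intro v
    obtain ⟨z, hz⟩ := hαint v
    by_cases hvo : v = o
    · exact ⟨p + z, by simp [hα', hvo ▸ hz, hvo, mul_add]⟩
    · exact ⟨z, by simp [hα', hz, hvo]⟩
  have hstar := star_subdivides hK₁ hα'nn hcard
  have hbK₁ : ∀ S ∈ K₁, b ∉ S := fun S hS => hK₁.lc_notMem hα'nn hcard (by rwa [hα's]) hS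
  have hp0 := hp.lift (m := 0) Λ.zero_mem
  have hsb : s b = -((D - k : ℕ) : ℝ) := by
    rw [hb', hs, tilt_apply, Nat.cast_sub (by omega)]
    simp only [hak]; ring
  have hWb : Allowed Λ s b := ⟨by rw [hb'], by rw [hb']; exact ha.mem, _, hsb⟩
  have hαpos : ∀ v ∈ F, 0 < α v := fun v hv =>
    lt_of_le_of_ne (hαnn v) (Ne.symm (Finsupp.mem_support_iff.1 (hαs ▸ hv)))
  obtain ⟨K₂, h1, h2, h3⟩ := exists_resolution (hp.lift ha.mem) s hαnn hαlt hαint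
    (by rw [hlα, mem_liftLat_zero]; exact ⟨⟨0, by simp⟩, ha.mem⟩)
    (by rw [hlα, mem_liftLat]; rintro ⟨-, h⟩; exact ha.notMem (by simpa using h))
    (v₀ := (x₀, 0)) (hαs ▸ hv₀) (by simp [hs, hx₀1])
    (by rw [mem_liftLat]; exact ⟨⟨0, by simp⟩, by simpa using hv _ haK _ hx₀⟩)
    (by
      intro v hv
      rw [hαs] at hv
      obtain ⟨x, hx, rfl⟩ := Finset.mem_image.1 hv
      simpa [hs] using hh _ haK x hx) hk (by rw [hlα, hs]; simp [hak])
    (W := Allowed Λ s)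
    (by
      rintro w ⟨hw1, hw2, z, hz⟩ hneg
      refine ⟨by simp [hw1], Λ.add_mem hw2 (hp.le (hv _ haK _ hx₀)), z - 1, ?_⟩
      have hz1 : 1 ≤ z := by
        rcases Nat.eq_zero_or_pos z with rfl | h
        · rw [hz] at hneg; simp at hneg
        · exact h
      rw [map_add, hz, Nat.cast_sub hz1]
      simp only [hs, tilt_apply, hx₀1, mul_zero, sub_zero, Nat.cast_one]
      ring)
    (by
      rintro w ⟨hw1, hw2, z, hz⟩ hneg
      have hz1 : k ≤ z := by
        rw [hz] at hneg
        have : (k : ℝ) ≤ z := by linarith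
        exact_mod_cast this
      refine ⟨by simp [hw1, hlα], by rw [hlα]; exact Λ.add_mem hw2 ha.mem, z - k, ?_⟩
      rw [map_add, hz, Nat.cast_sub hz1, hlα, hs]
      simp only [tilt_apply, hak, mul_zero, sub_zero]
      ring)
    (show k ≤ D - k by omega) (stellar K₁ α') b hstar.fan hWb
    (by rw [mem_liftLat, hb']; exact ⟨⟨1, by simp⟩, by simp⟩) hsb
    (by
      rintro S (⟨hS, -⟩ | ⟨R, rfl, hR', hT⟩) hbS hg
      · exact absurd hbS (hbK₁ S hS)
      set T := R ∪ α'.support with hTd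
      have hFT : insert o F ⊆ T := by rw [hTd, hα's]; exact Finset.subset_union_right
      have hRT : R ⊆ T := Finset.subset_union_left
      have hoT : o ∈ T := hFT (Finset.mem_insert_self _ _)
      have hTg : ¬ Good (liftLat Λ 0) p T := fun hg' =>
        hg'.not_subset hp.prime (a := α)
          (by rw [hlα, mem_liftLat_zero]; exact ⟨⟨0, by simp⟩, ha.mem⟩) hαint
          (hαpos _ hv₀) (hαlt _) (by rw [hαs]; exact (Finset.subset_insert _ _).trans hFT)
      have hDpos : (0 : ℝ) < D := by exact_mod_cast (show 0 < D by omega)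
      rcases hbad T hT hTg with hU | ⟨-, hTK, -⟩
      · have := hU.1 o hoT
        rw [hs, ho] at this
        simp at this
        linarith
      obtain ⟨S₁, hS₁, hS₁T⟩ := liftFan_cell hTK
      have hTm : Mult (liftLat Λ' 0) 1 T := by
        have := (hM S₁ hS₁).apex (m := 0) (R := T.erase o) (by rw [hS₁T])
        rwa [← ho, Finset.insert_erase hoT] at this
      have hFR : F ⊆ R := by
        by_contra hFR
        obtain ⟨u, hu, huR⟩ := Finset.not_subset.1 hFR
        have huo : u ≠ o := fun h => hoF (h ▸ hu)
        have hαu : α' u = α u := by simp [hα', huo]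
        exact hg (Mult.star_fractional hp0 hTm (a := α') (by rwa [hα's])
          (hbK₁ T hT) (by rw [← hb, hb', mem_liftLat_zero]; exact ⟨⟨1, by simp⟩, ha.mem⟩)
          (by rw [← hb, hb', mem_liftLat_zero]; exact fun h => ha.notMem h.2) hα'int
          (by rw [hαu]; exact hαpos u hu) (by rw [hαu]; exact hαlt u) hRT huR)
      have hoR : o ∉ R := fun h => hR' (by rw [hα's]; exact Finset.insert_subset h hFR)
      have hRS₁ : R ⊆ S₁.image (LinearMap.inl ℝ E ℝ) := by
        rw [hS₁T]
        exact fun w hw => Finset.mem_erase.2 ⟨fun h => hoR (by rw [ho, ← h]; exact hw), hRT hw⟩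
      refine ⟨?_, ?_, ?_⟩
      · rw [← hb, hb']; exact (hM S₁ hS₁).apex hRS₁
      · rw [hαs]; exact hFR.trans (Finset.subset_insert _ _)
      · intro w hw hwb
        have hwR : w ∈ R := (Finset.mem_insert.1 hw).resolve_left hwb
        obtain ⟨x, hx, rfl⟩ := Finset.mem_image.1 (hRS₁ hwR)
        simpa [hs] using hh _ hS₁ x hx)
  refine ⟨K₂, h1.trans hstar, fun v hv => ?_, fun S hS hg => ?_⟩
  · rcases h2 v hv with h | h
    · rcases star_vertex h with h | h
      · exact Or.inl h
      · exact Or.inr (h ▸ hWb)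
    · exact Or.inr h
  · rcases h3 S hS hg with ⟨hS', hbS⟩ | hU
    · rcases hS' with ⟨hS₁, hns⟩ | ⟨R, rfl, -, -⟩
      · rcases hbad S hS₁ hg with h | ⟨q1, q2, q3⟩
        · exact Or.inl h
        · refine Or.inr ⟨q1, q2, ?_⟩
          rintro R (rfl | hR)
          · exact fun hRS => hns (by rw [hα's]; exact Finset.insert_subset q1 hRS)
          · exact q3 R hR
      · exact absurd (Finset.mem_insert_self _ _) hbS
    · exact Or.inl hU

lemma exists_reduction_loop {p : ℕ} {Λ' Λ : AddSubgroup E} (hp : PrimeIdx p Λ' Λ)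
    {K : Set (Finset E)} (hK : IsFan K) {h : E →ₗ[ℝ] ℝ}
    (hM : ∀ S ∈ K, Mult Λ' 1 S) (hv : ∀ S ∈ K, ∀ v ∈ S, v ∈ Λ')
    (hh : ∀ S ∈ K, ∀ v ∈ S, 0 ≤ h v) {D : ℕ}
    (h0 : ∀ S ∈ liftFan K, ¬ Good (liftLat Λ 0) p S →
      Upper (tilt h D) S ∨ (0, 1) ∈ S) (L : Finset (E →₀ ℝ))
    (hL : ∀ a ∈ L, IsCircuit p Λ' Λ a ∧ a.support ∈ K ∧ (∃ x₀ ∈ a.support, h x₀ = 1) ∧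
      ∃ k : ℕ, 1 ≤ k ∧ 2 * k ≤ D ∧ h (lc a) = k) :
    ∃ K₁, Subdivides K₁ (liftFan K) ∧
      (∀ v, {v} ∈ K₁ → {v} ∈ liftFan K ∨ Allowed Λ (tilt h D) v) ∧
      ∀ S ∈ K₁, ¬ Good (liftLat Λ 0) p S → Upper (tilt h D) S ∨
      ((0, 1) ∈ S ∧ S ∈ liftFan K ∧
        ∀ a ∈ L, ¬ a.support.image (LinearMap.inl ℝ E ℝ) ⊆ S) := by
  induction L using Finset.induction_on with
  | empty =>
    refine ⟨_, Subdivides.refl (isFan_liftFan hK), fun v hv => Or.inl hv, fun S hS hg => ?_⟩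
    rcases h0 S hS hg with h | h
    · exact Or.inl h
    · exact Or.inr ⟨h, hS, by simp⟩
  | insert a L _ ih =>
    obtain ⟨K₁, h1, h2, h3⟩ := ih fun b hb => hL b (Finset.mem_insert_of_mem hb)
    obtain ⟨ha, haK, ⟨x₀, hx₀, hx₀1⟩, k, hk, hkD, hak⟩ := hL a (Finset.mem_insert_self _ _)
    obtain ⟨K₂, g1, g2, g3⟩ := exists_reduction_step hp hM hv hh hk hkD ha haK hx₀ hx₀1 hak
      (L := {R | ∃ b ∈ L, R = b.support.image (LinearMap.inl ℝ E ℝ)}) h1.fan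
      (fun S hS hg => (h3 S hS hg).imp id fun ⟨q1, q2, q3⟩ =>
        ⟨q1, q2, by rintro R ⟨b, hb, rfl⟩; exact q3 b hb⟩)
    refine ⟨K₂, g1.trans h1, fun v hv => (g2 v hv).elim (h2 v) Or.inr, fun S hS hg => ?_⟩
    refine (g3 S hS hg).imp id fun ⟨q1, q2, q3⟩ => ⟨q1, q2, fun b hb => ?_⟩
    rcases Finset.mem_insert.1 hb with rfl | hb
    · exact q3 _ (Or.inl rfl)
    · exact q3 _ (Or.inr ⟨b, hb, rfl⟩)

/-- Reduction of the multiplicities at the prime `p`. -/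
theorem exists_reduction {p : ℕ} {Λ' Λ : AddSubgroup E} (hp : PrimeIdx p Λ' Λ)
    {K : Set (Finset E)} (hK : IsFan K) {h : E →ₗ[ℝ] ℝ}
    (hM : ∀ S ∈ K, Mult Λ' 1 S) (hvK : ∀ v, {v} ∈ K → v ∈ Λ')
    (hhK : ∀ v, {v} ∈ K → h v = 0 ∨ h v = 1) (hInt : ∀ x ∈ Λ, ∃ z : ℤ, h x = z)
    (hin : ∀ S ∈ K, (∀ v ∈ S, h v = 0) → Mult Λ 1 S) {A : ℕ} (hA : 1 ≤ A) :
    ∃ D : ℕ, 1 ≤ D ∧ D ≡ 1 [MOD A] ∧ ∃ K', Subdivides K' K ∧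
      (∀ v, {v} ∈ K' → v ∈ Λ ∧ ((h v = 0 ∧ {v} ∈ K) ∨ h v = D)) ∧
      ∀ S ∈ K', Good (divLat Λ h D) p S := by
  have hv1 : ∀ S ∈ K, ∀ v ∈ S, {v} ∈ K := fun S hS v hv => hK.mono S hS _ (by simpa using hv)
  have hv : ∀ S ∈ K, ∀ v ∈ S, v ∈ Λ' := fun S hS v hv => hvK v (hv1 S hS v hv)
  have hh : ∀ S ∈ K, ∀ v ∈ S, 0 ≤ h v := fun S hS v hv => by
    rcases hhK v (hv1 S hS v hv) with h | h <;> simp [h]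
  have hcirc : ∀ S ∈ K, ¬ Mult Λ 1 S → ∃ a : E →₀ ℝ, ∃ k : ℕ, a.support ⊆ S ∧
      IsCircuit p Λ' Λ a ∧ a.support ∈ K ∧ (∃ x₀ ∈ a.support, h x₀ = 1) ∧ 1 ≤ k ∧
      h (lc a) = k := by
    intro S hS hbad
    obtain ⟨a, haS, ha⟩ := exists_isCircuit hp (hM S hS) (hv S hS) hbad
    have haK := hK.mono S hS _ haS
    have hx : ∃ x₀ ∈ a.support, h x₀ = 1 := by
      by_contra hne
      push Not at hne
      have hz : ∀ v ∈ a.support, h v = 0 := fun v hv =>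
        (hhK v (hv1 _ haK v hv)).resolve_right (hne v hv)
      refine ha.notMem ?_
      have : a = 0 := by
        ext v
        obtain ⟨z, hz⟩ := mult_one_iff.1 (hin _ haK hz) a le_rfl ha.mem v
        have h1 := ha.nonneg v
        have h2 := ha.lt_one v
        rw [hz] at h1 h2 ⊢
        have h1' : 0 ≤ z := by exact_mod_cast h1
        have h2' : z < 1 := by exact_mod_cast h2
        have : z = 0 := by omega
        simp [this]
      rw [this, map_zero]; exact Λ'.zero_mem
    obtain ⟨x₀, hx₀, hx₀1⟩ := hx
    obtain ⟨z, hz⟩ := hInt _ ha.mem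
    have hpos : 0 < h (lc a) := by
      rw [map_lc_eq_sum h a le_rfl]
      refine Finset.sum_pos' (fun v hv => mul_nonneg (ha.nonneg v) (hh _ haK v hv)) ⟨x₀, hx₀, ?_⟩
      rw [hx₀1]; simpa using ha.pos hx₀
    have hz0 : 0 < z := by rw [hz] at hpos; exact_mod_cast hpos
    refine ⟨a, z.toNat, haS, ha, haK, ⟨x₀, hx₀, hx₀1⟩, by omega, ?_⟩
    rw [hz]
    exact_mod_cast (Int.toNat_of_nonneg hz0.le).symm
  choose! a k hak using hcirc
  set L₀ : Finset (Finset E) := (hK.finite.subset (Set.sep_subset K fun S => ¬ Mult Λ 1 S)).toFinset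
    with hL₀
  have hmem : ∀ S, S ∈ L₀ ↔ S ∈ K ∧ ¬ Mult Λ 1 S := fun S => by simp [hL₀]
  set D : ℕ := 1 + A * ∑ S ∈ L₀, 2 * k S with hD
  have hD1 : 1 ≤ D := by omega
  have hD0 : (0 : ℝ) < D := by exact_mod_cast hD1
  have hDk : ∀ S ∈ L₀, 2 * k S ≤ D := fun S hS => by
    have h1 : 2 * k S ≤ ∑ S ∈ L₀, 2 * k S := Finset.single_le_sum (f := fun S => 2 * k S) (fun _ _ => Nat.zero_le _) hS
    have h2 : ∑ S ∈ L₀, 2 * k S ≤ A * ∑ S ∈ L₀, 2 * k S := Nat.le_mul_of_pos_left _ hA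
    omega
  have hgood : ∀ S₁ ∈ K, Mult Λ 1 S₁ → ∀ S : Finset (E × ℝ),
      S₁.image (LinearMap.inl ℝ E ℝ) = S.erase (0, 1) → Good (liftLat Λ 0) p S := by
    intro S₁ hS₁ hM₁ S hS
    have := hM₁.apex (m := 0) (R := S.erase (0, 1)) (by rw [hS])
    exact (this.mono le_rfl (Finset.insert_erase_subset _ _)).good_one
  obtain ⟨K₁, h1, h2, h3⟩ := exists_reduction_loop hp hK hM hv hh (D := D) (by
    intro S hS hg
    by_cases ho : ((0, 1) : E × ℝ) ∈ S
    · exact Or.inr ho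
    · left
      obtain ⟨S₁, hS₁, hS₁S⟩ := liftFan_cell hS
      have hSe := hS₁S
      rw [Finset.erase_eq_of_notMem ho] at hS₁S
      have hMS : ¬ Mult Λ 1 S₁ := fun hM₁ => hg (hgood S₁ hS₁ hM₁ S hSe)
      have hu : ∃ v ∈ S₁, h v = 1 := by
        by_contra hne
        push Not at hne
        exact hMS (hin _ hS₁ fun v hv => (hhK v (hv1 _ hS₁ v hv)).resolve_right (hne v hv))
      obtain ⟨u, hu, hu1⟩ := hu
      constructor
      · intro w hw
        rw [← hS₁S] at hw
        obtain ⟨x, hx, rfl⟩ := Finset.mem_image.1 hw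
        simpa using hh _ hS₁ x hx
      · refine ⟨(u, 0), ?_, by simp [hu1]⟩
        rw [← hS₁S]; exact Finset.mem_image.2 ⟨u, hu, rfl⟩) (L₀.image a) (by
    intro b hb
    obtain ⟨S, hS, rfl⟩ := Finset.mem_image.1 hb
    obtain ⟨-, q1, q2, q3, q4, q5⟩ := hak S ((hmem S).1 hS).1 ((hmem S).1 hS).2
    exact ⟨q1, q2, q3, k S, q4, hDk S hS, q5⟩)
  have hUp : ∀ S ∈ K₁, ¬ Good (liftLat Λ 0) p S → Upper (tilt h D) S := by
    intro S hS hg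
    rcases h3 S hS hg with h | ⟨-, hSK, hS3⟩
    · exact h
    · exfalso
      obtain ⟨S₁, hS₁, hS₁S⟩ := liftFan_cell hSK
      have hMS : ¬ Mult Λ 1 S₁ := fun hM₁ => hg (hgood S₁ hS₁ hM₁ S hS₁S)
      refine hS3 (a S₁) (Finset.mem_image_of_mem _ ((hmem _).2 ⟨hS₁, hMS⟩)) ?_
      refine (Finset.image_subset_image (hak S₁ hS₁ hMS).1).trans ?_
      rw [hS₁S]; exact Finset.erase_subset _ _
  have hvert : ∀ v, {v} ∈ K₁ → (v.2 = 0 ∧ {v.1} ∈ K) ∨ Allowed Λ (tilt h D) v := by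
    intro v hv
    rcases h2 v hv with h | h
    · rcases liftFan_vertex hK h (Finset.mem_singleton_self v) with rfl | ⟨x, hx, rfl⟩
      · exact Or.inr ⟨rfl, Λ.zero_mem, D, by simp⟩
      · exact Or.inl ⟨rfl, hx⟩
    · exact Or.inr h
  obtain ⟨K₂, f1, -, f3, f4⟩ := exists_fold h1.fan (tilt h D)
    (by
      intro v hv
      rcases hvert v hv with ⟨q1, q2⟩ | ⟨-, -, q⟩
      · rcases hhK _ q2 with q | q
        · exact Or.inr ⟨0, by simp [q1, q]⟩
        · exact Or.inl (by simp [q1, q])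
      · exact Or.inr q)
    (Q := fun S => (∀ v ∈ S, (v.2 = 0 ∧ {v.1} ∈ K) ∨ Allowed Λ (tilt h D) v) ∧
      (Good (liftLat Λ 0) p S ∨ (S ∈ K₁ ∧ ∀ w ∈ S, 0 ≤ tilt h D w)))
    (by
      rintro S R hRS ⟨q1, q2⟩
      refine ⟨fun v hv => q1 v (hRS hv), q2.imp (fun q => q.mono le_rfl hRS) fun q => ?_⟩
      exact ⟨h1.fan.mono S q.1 R hRS, fun w hw => q.2 w (hRS hw)⟩)
    (by
      rintro T b v ⟨q1, q2⟩ hb hv hsb hsv hbv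
      have hg : Good (liftLat Λ 0) p T := by
        rcases q2 with q | q
        · exact q
        · exact absurd (q.2 b hb) (not_le.2 hsb)
      have hbA : Allowed Λ (tilt h D) b := by
        rcases q1 b hb with ⟨q1, q2⟩ | q
        · have : (0 : ℝ) ≤ tilt h D b := by
            rw [tilt_apply, q1]; rcases hhK _ q2 with q | q <;> simp [q]
          exact absurd this (not_le.2 hsb)
        · exact q
      have hvU : v.2 = 0 ∧ {v.1} ∈ K := by
        rcases q1 v hv with q | ⟨-, -, z, hz⟩
        · exact q
        · rw [hsv] at hz
          have : (0 : ℝ) ≤ z := z.cast_nonneg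
          linarith
      have hA' : Allowed Λ (tilt h D) (b + v) := by
        obtain ⟨r1, r2, z, hz⟩ := hbA
        refine ⟨by simp [r1, hvU.1], Λ.add_mem r2 (hp.le (hvK _ hvU.2)), z - 1, ?_⟩
        have hz1 : 1 ≤ z := by
          rcases Nat.eq_zero_or_pos z with rfl | h
          · rw [hz] at hsb; simp at hsb
          · exact h
        rw [map_add, hz, hsv, Nat.cast_sub hz1, Nat.cast_one]
        ring
      have hall : ∀ R ⊆ T, ∀ w ∈ insert (b + v) R,
          (w.2 = 0 ∧ {w.1} ∈ K) ∨ Allowed Λ (tilt h D) w := by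
        intro R hR w hw
        rcases Finset.mem_insert.1 hw with rfl | hw
        · exact Or.inr hA'
        · exact q1 w (hR hw)
      have hbv' : b ≠ v := fun e => by rw [e, hsv] at hsb; linarith
      exact ⟨⟨hall _ (Finset.erase_subset _ _), Or.inl (hg.stellar_pair hbv' hb hv hbv).1⟩,
        ⟨hall _ (Finset.erase_subset _ _), Or.inl (hg.stellar_pair hbv' hb hv hbv).2⟩⟩)
    (by
      intro S hS
      refine ⟨fun v hv => hvert v (h1.fan.mono S hS _ (by simpa using hv)), ?_⟩
      by_cases hg : Good (liftLat Λ 0) p S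
      · exact Or.inl hg
      · exact Or.inr ⟨hS, (hUp S hS hg).1⟩)
  have hsub := f1.trans h1
  have hφ : ∀ x, tilt h D x = 0 ↔ x.2 = ((D : ℝ)⁻¹ • h) x.1 := by
    intro x
    rw [tilt_apply, LinearMap.smul_apply, smul_eq_mul, eq_inv_mul_iff_mul_eq₀ hD0.ne', sub_eq_zero,
      eq_comm]
  obtain ⟨s1, s2, s3⟩ := exists_slice f1.fan (tilt h D) f4 ((D : ℝ)⁻¹ • h) hφ
  have hnn : ∀ x ∈ spt K, 0 ≤ h x := by
    rintro _ ⟨l, hl, rfl⟩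
    rw [map_lc_eq_sum h l le_rfl]
    exact Finset.sum_nonneg fun v hv => mul_nonneg (hl.1 v) (hh _ hl.2 v hv)
  refine ⟨D, hD1, ?_, _, ⟨s1, ?_, ?_⟩, ?_, ?_⟩
  · rw [hD, Nat.ModEq, Nat.add_mul_mod_self_left]
  · rw [s2, hsub.spt_eq]
    ext x
    rw [Set.mem_ofPred_eq, mem_spt_liftFan hK]
    exact ⟨fun q => q.1, fun q => ⟨q, mul_nonneg (by positivity) (hnn x q)⟩⟩
  · exact refines_fst fun S hS => hsub.refines S hS.1
  · intro v hv
    obtain ⟨w, hw, rfl⟩ := mem_vertices_imageFan (f1.fan.subcomplex _) hv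
    have hw0 : tilt h D w = 0 := hw.2 w (Finset.mem_singleton_self w)
    rw [tilt_apply] at hw0
    rcases (f3 _ hw.1).1 w (Finset.mem_singleton_self w) with ⟨q1, q2⟩ | ⟨q1, q2, -⟩
    · exact ⟨hp.le (hvK _ q2), Or.inl ⟨by simpa [q1] using hw0, q2⟩⟩
    · refine ⟨q2, Or.inr ?_⟩
      rw [q1] at hw0
      change h w.1 = D
      linarith
  · rintro _ ⟨S, ⟨hS, hS0⟩, rfl⟩
    have hg : Good (liftLat Λ 0) p S := by
      rcases (f3 S hS).2 with q | ⟨q, -⟩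
      · exact q
      · by_contra hg
        obtain ⟨-, w, hw, hw0⟩ := hUp S q hg
        exact hw0.ne' (hS0 w hw)
    obtain ⟨N, n1, n2, n3⟩ := hg
    refine ⟨N, n1, n2, s3 S hS0 _ (liftLat Λ 0) ?_ N n3⟩
    rintro x ⟨hx, z, hz⟩
    rw [mem_liftLat_zero]
    refine ⟨⟨z, ?_⟩, hx⟩
    rw [LinearMap.smul_apply, hz, smul_eq_mul]
    field_simp

end Reduction

section Chains

open Classical

variable {E : Type} [AddCommGroup E] [Module ℝ E]

/-- `Λ` is obtained from `Λ'` by a chain of extensions of prime index less than `B`. -/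
def Reach (B : ℕ) : AddSubgroup E → AddSubgroup E → Prop :=
  Relation.ReflTransGen fun Λ' Λ => ∃ q < B, PrimeIdx q Λ' Λ

omit [Module ℝ E] in
lemma mem_sup_zmultiples {Λ : AddSubgroup E} {m x : E} :
    x ∈ Λ ⊔ AddSubgroup.zmultiples m ↔ ∃ y ∈ Λ, ∃ i : ℤ, y + i • m = x := by
  rw [AddSubgroup.mem_sup]
  constructor
  · rintro ⟨y, hy, _, ⟨i, rfl⟩, rfl⟩; exact ⟨y, hy, i, rfl⟩
  · rintro ⟨y, hy, i, rfl⟩; exact ⟨y, hy, _, ⟨i, rfl⟩, rfl⟩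

omit [Module ℝ E] in
lemma primeIdx_sup {q : ℕ} (hq : q.Prime) {Λ : AddSubgroup E} {m : E} (hm : q • m ∈ Λ) :
    PrimeIdx q Λ (Λ ⊔ AddSubgroup.zmultiples m) := by
  refine ⟨hq, le_sup_left, fun x hx => ?_, fun n hn hn' x hx => ?_⟩
  · obtain ⟨y, hy, i, rfl⟩ := mem_sup_zmultiples.1 hx
    rw [smul_add, smul_comm]
    exact Λ.add_mem (Λ.nsmul_mem hy q) (Λ.zsmul_mem hm i)
  · obtain ⟨y, hy, i, rfl⟩ := mem_sup_zmultiples.1 hx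
    obtain ⟨y', hy', j, rfl⟩ := mem_sup_zmultiples.1 hn
    have hqm : ∀ t : ℤ, (q : ℤ) ∣ t → t • m ∈ Λ := by
      rintro _ ⟨t, rfl⟩
      rw [mul_comm, mul_smul, natCast_zsmul]; exact Λ.zsmul_mem hm t
    have hj : ¬ (q : ℤ) ∣ j := fun h => hn' (Λ.add_mem hy' (hqm j h))
    have hco : IsCoprime (q : ℤ) j :=
      ((Nat.prime_iff_prime_int.1 hq).coprime_iff_not_dvd).2 hj
    obtain ⟨u, w, huw⟩ := hco
    refine ⟨i * w, ?_⟩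
    have : y + i • m - (i * w) • (y' + j • m) = y - (i * w) • y' + (i - i * w * j) • m := by
      rw [smul_add, sub_smul, mul_smul (i * w) j m]; abel
    rw [this]
    refine Λ.add_mem (Λ.sub_mem hy (Λ.zsmul_mem hy' _)) (hqm _ ⟨i * u, ?_⟩)
    linear_combination (-i) * huw

omit [Module ℝ E] in
lemma reach_sup {B : ℕ} {Λ : AddSubgroup E} (N : ℕ) (hN : N ≠ 0)
    (hB : ∀ q, q.Prime → q ∣ N → q < B) :
    ∀ m : E, N • m ∈ Λ → Reach B Λ (Λ ⊔ AddSubgroup.zmultiples m) := by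
  induction N using Nat.strong_induction_on with
  | _ N ih =>
    intro m hm
    by_cases h1 : N = 1
    · subst h1
      rw [one_smul] at hm
      have : Λ ⊔ AddSubgroup.zmultiples m = Λ := by
        rw [sup_eq_left, AddSubgroup.zmultiples_le]; exact hm
      rw [this]; exact Relation.ReflTransGen.refl
    · have hq := Nat.minFac_prime h1
      obtain ⟨N', hN'⟩ := Nat.minFac_dvd N
      set q := N.minFac with hqd
      have hN'0 : N' ≠ 0 := by rintro rfl; simp at hN'; exact hN hN'
      have hlt : N' < N := by
        have := hq.two_le
        have : 0 < N' := Nat.pos_of_ne_zero hN'0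
        rw [hN']; nlinarith
      have hr := ih N' hlt hN'0
        (fun r hr hrN => hB r hr (hN' ▸ hrN.mul_left q)) (q • m)
        (by rw [← mul_smul, mul_comm, ← hN']; exact hm)
      refine Relation.ReflTransGen.tail hr ⟨q, hB q hq ⟨N', hN'⟩, ?_⟩
      have hqm : q • m ∈ Λ ⊔ AddSubgroup.zmultiples (q • m) :=
        AddSubgroup.mem_sup_right (AddSubgroup.mem_zmultiples _)
      have heq : Λ ⊔ AddSubgroup.zmultiples m =
          Λ ⊔ AddSubgroup.zmultiples (q • m) ⊔ AddSubgroup.zmultiples m := by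
        rw [sup_assoc]
        congr 1
        refine (sup_eq_right.2 ?_).symm
        rw [AddSubgroup.zmultiples_le]
        exact AddSubgroup.nsmul_mem _ (AddSubgroup.mem_zmultiples m) q
      rw [heq]
      exact primeIdx_sup hq hqm

omit [Module ℝ E] in
lemma exists_reach {B N : ℕ} (hN : N ≠ 0) (hB : ∀ q, q.Prime → q ∣ N → q < B)
    {Λ Λt : AddSubgroup E} (hΛ : Λ ≤ Λt) (W : Finset E) (hW : ∀ w ∈ W, w ∈ Λt ∧ N • w ∈ Λ) :
    ∃ Λ₁, Reach B Λ Λ₁ ∧ Λ ≤ Λ₁ ∧ Λ₁ ≤ Λt ∧ ∀ w ∈ W, w ∈ Λ₁ := by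
  induction W using Finset.induction_on with
  | empty => exact ⟨Λ, Relation.ReflTransGen.refl, le_rfl, hΛ, by simp⟩
  | insert w W _ ih =>
    obtain ⟨Λ₁, h1, h2, h3, h4⟩ := ih fun v hv => hW v (Finset.mem_insert_of_mem hv)
    obtain ⟨q1, q2⟩ := hW w (Finset.mem_insert_self _ _)
    refine ⟨Λ₁ ⊔ AddSubgroup.zmultiples w, h1.trans (reach_sup N hN hB w (h2 q2)),
      h2.trans le_sup_left, sup_le h3 (by rwa [AddSubgroup.zmultiples_le]), fun v hv => ?_⟩
    rcases Finset.mem_insert.1 hv with rfl | hv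
    · exact AddSubgroup.mem_sup_right (AddSubgroup.mem_zmultiples _)
    · exact AddSubgroup.mem_sup_left (h4 v hv)

lemma PrimeIdx.divLat {p : ℕ} {Λ' Λ : AddSubgroup E} (hp : PrimeIdx p Λ' Λ) (h : E →ₗ[ℝ] ℝ)
    (D : ℝ) : PrimeIdx p (divLat Λ' h D) (divLat Λ h D) := by
  refine ⟨hp.prime, fun x hx => ⟨hp.le hx.1, hx.2⟩, fun x hx => ?_, fun n hn hn' x hx => ?_⟩
  · refine ⟨hp.smul_mem x hx.1, ?_⟩
    obtain ⟨-, z, hz⟩ := hx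
    exact ⟨p * z, by rw [map_nsmul, hz]; push_cast; simp; ring⟩
  · obtain ⟨i, hi⟩ := hp.exists_zsmul n hn.1 (fun h => hn' ⟨h, hn.2⟩) x hx.1
    obtain ⟨-, z, hz⟩ := hx
    obtain ⟨-, w, hw⟩ := hn
    exact ⟨i, hi, z - i * w, by rw [map_sub, map_zsmul, hz, hw]; push_cast; simp; ring⟩

/-- The reduction theorem for all cells having multiplicities with prime factors below `B`. -/
def ReductionBelow (B : ℕ) : Prop :=
  ∀ (E : Type) [AddCommGroup E] [Module ℝ E] (Λ : AddSubgroup E) (K : Set (Finset E)),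
    IsFan K → ∀ h : E →ₗ[ℝ] ℝ, (∀ v, {v} ∈ K → v ∈ Λ) → (∀ v, {v} ∈ K → h v = 0 ∨ h v = 1) →
    (∀ x ∈ Λ, ∃ z : ℤ, h x = z) → (∀ S ∈ K, (∀ v ∈ S, h v = 0) → Mult Λ 1 S) →
    (∀ S ∈ K, Good Λ B S) → ∀ A : ℕ, 1 ≤ A →
    ∃ D : ℕ, 1 ≤ D ∧ D ≡ 1 [MOD A] ∧ ∃ K', Subdivides K' K ∧
      (∀ v, {v} ∈ K' → v ∈ Λ ∧ ((h v = 0 ∧ {v} ∈ K) ∨ h v = D)) ∧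
      ∀ S ∈ K', Mult (divLat Λ h D) 1 S

lemma reductionBelow_chain {B : ℕ} (hB : ∀ q < B, ReductionBelow q) {Λ₀ Λ : AddSubgroup E}
    (hr : Reach B Λ₀ Λ) {K : Set (Finset E)} (hK : IsFan K) (h : E →ₗ[ℝ] ℝ)
    (hM : ∀ S ∈ K, Mult Λ₀ 1 S) (hvK : ∀ v, {v} ∈ K → v ∈ Λ₀)
    (hhK : ∀ v, {v} ∈ K → h v = 0 ∨ h v = 1) {A : ℕ} (hA : 1 ≤ A) :
    (∀ x ∈ Λ, ∃ z : ℤ, h x = z) → (∀ S ∈ K, (∀ v ∈ S, h v = 0) → Mult Λ 1 S) →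
    ∃ D : ℕ, 1 ≤ D ∧ D ≡ 1 [MOD A] ∧ ∃ K', Subdivides K' K ∧
      (∀ v, {v} ∈ K' → v ∈ Λ ∧ ((h v = 0 ∧ {v} ∈ K) ∨ h v = D)) ∧
      ∀ S ∈ K', Mult (divLat Λ h D) 1 S := by
  unfold Reach at hr
  induction hr with
  | refl =>
    intro _ _
    refine ⟨1, le_rfl, rfl, K, Subdivides.refl hK, fun v hv => ⟨hvK v hv, ?_⟩, fun S hS =>
      (hM S hS).mono (fun x hx => hx.1) le_rfl⟩
    rcases hhK v hv with q | q
    · exact Or.inl ⟨q, hv⟩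
    · exact Or.inr (by simpa using q)
  | @tail Λ' Λ _ hstep ih =>
    intro hInt hin
    obtain ⟨q, hqB, hq⟩ := hstep
    obtain ⟨D₁, a1, a2, K₁, a3, a4, a5⟩ := ih (fun x hx => hInt x (hq.le hx))
      (fun S hS h0 => (hin S hS h0).mono hq.le le_rfl)
    have hD₁ : (0 : ℝ) < D₁ := by exact_mod_cast a1
    have hcell₁ : ∀ S ∈ K₁, (∀ v ∈ S, h v = 0) → S ∈ K := fun S hS h0 =>
      a3.mem_of_vertices hK hS fun v hv => by
        rcases (a4 v (a3.fan.mono S hS _ (by simpa using hv))).2 with q | q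
        · exact q.2
        · rw [h0 v hv] at q; exact absurd q hD₁.ne
    have hz₁ : ∀ x, ((D₁ : ℝ)⁻¹ • h) x = 0 ↔ h x = 0 := fun x => by
      simp [hD₁.ne']
    obtain ⟨D₂, b1, b2, K₂, b3, b4, b5⟩ := exists_reduction (hq.divLat h D₁) a3.fan
      (h := (D₁ : ℝ)⁻¹ • h) a5
      (fun v hv => ⟨(a4 v hv).1, by
        rcases (a4 v hv).2 with q | q
        · exact ⟨0, by simp [q.1]⟩
        · exact ⟨1, by simp [q]⟩⟩)
      (fun v hv => by
        rcases (a4 v hv).2 with q | q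
        · left; simp [q.1]
        · right; simp [q, hD₁.ne'])
      (by rintro x ⟨-, z, hz⟩; exact ⟨z, by simp [hz, hD₁.ne']⟩)
      (fun S hS h0 => by
        have h0' : ∀ v ∈ S, h v = 0 := fun v hv => (hz₁ v).1 (h0 v hv)
        exact (hin S (hcell₁ S hS h0') h0').mono (fun x hx => hx.1) le_rfl) hA
    have hD₂ : (0 : ℝ) < D₂ := by exact_mod_cast b1
    have hz₂ : ∀ x, ((D₂ : ℝ)⁻¹ • (D₁ : ℝ)⁻¹ • h) x = 0 ↔ h x = 0 := fun x => by
      simp [hD₁.ne', hD₂.ne']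
    have hv₂ : ∀ v, {v} ∈ K₂ → h v = 0 → {v} ∈ K₁ := fun v hv h0 => by
      rcases (b4 v hv).2 with q | q
      · exact q.2
      · rw [(hz₁ v).2 h0] at q; exact absurd q hD₂.ne
    have hcell₂ : ∀ S ∈ K₂, (∀ v ∈ S, h v = 0) → S ∈ K := fun S hS h0 =>
      hcell₁ S (b3.mem_of_vertices a3.fan hS fun v hv =>
        hv₂ v (b3.fan.mono S hS _ (by simpa using hv)) (h0 v hv)) h0
    obtain ⟨D₃, c1, c2, K₃, c3, c4, c5⟩ := hB q hqB E
      (divLat (divLat Λ h D₁) ((D₁ : ℝ)⁻¹ • h) D₂) K₂ b3.fan ((D₂ : ℝ)⁻¹ • (D₁ : ℝ)⁻¹ • h)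
      (fun v hv => ⟨(b4 v hv).1, by
        rcases (b4 v hv).2 with q | q
        · exact ⟨0, by simp only [q.1]; simp⟩
        · exact ⟨1, by simp only [q]; simp⟩⟩)
      (fun v hv => by
        rw [LinearMap.smul_apply]
        rcases (b4 v hv).2 with q | q
        · left; simp only [q.1]; simp
        · right; simp only [q]; simp [hD₂.ne'])
      (by
        rintro x ⟨-, z, hz⟩
        refine ⟨z, ?_⟩
        rw [LinearMap.smul_apply, hz, smul_eq_mul, inv_mul_cancel_left₀ hD₂.ne'])
      (fun S hS h0 => by
        have h0' : ∀ v ∈ S, h v = 0 := fun v hv => (hz₂ v).1 (h0 v hv)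
        exact (hin S (hcell₂ S hS h0') h0').mono (fun x hx => hx.1.1) le_rfl) b5 A hA
    refine ⟨D₁ * D₂ * D₃, Nat.mul_pos (Nat.mul_pos a1 b1) c1, ?_, K₃,
      c3.trans (b3.trans a3), fun v hv => ⟨(c4 v hv).1.1.1, ?_⟩, fun S hS => ?_⟩
    · simpa using (a2.mul b2).mul c2
    · rcases (c4 v hv).2 with ⟨q1, q2⟩ | q
      · have h0 := (hz₂ v).1 q1
        refine Or.inl ⟨h0, ?_⟩
        rcases (a4 v (hv₂ v q2 h0)).2 with q | q
        · exact q.2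
        · rw [h0] at q; exact absurd q hD₁.ne
      · right
        simp only [LinearMap.smul_apply, smul_eq_mul] at q
        push_cast
        rw [← q]; field_simp
    · refine (c5 S hS).mono ?_ le_rfl
      rintro x ⟨hx, z, hz⟩
      push_cast at hz
      refine ⟨⟨⟨hx, D₂ * D₃ * z, ?_⟩, D₃ * z, ?_⟩, z, ?_⟩
      · rw [hz]; push_cast; ring
      · simp only [LinearMap.smul_apply, smul_eq_mul]
        rw [hz]; push_cast; field_simp
      · simp only [LinearMap.smul_apply, smul_eq_mul]
        rw [hz]; field_simp

end Chains

section Words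

open Classical

variable {E : Type} [AddCommGroup E] [Module ℝ E]

noncomputable local instance decidableEqFinsupp {F : Type} : DecidableEq (F →₀ ℝ) :=
  fun a b => Classical.propDecidable (a = b)

/-- The unit vector at `v`. -/
noncomputable def unit (v : E) : E →₀ ℝ := Finsupp.single v 1

omit [AddCommGroup E] [Module ℝ E] in
lemma unit_injective : Function.Injective (unit : E → E →₀ ℝ) :=
  Finsupp.single_left_injective one_ne_zero

@[simp] lemma lc_unit (v : E) : lc (unit v) = v := by simp [unit]

omit [AddCommGroup E] [Module ℝ E] in
/-- Combinations of unit vectors. -/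
lemma lc_units {S : Finset E} {L : (E →₀ ℝ) →₀ ℝ} (hL : L.support ⊆ S.image unit) :
    (∀ v ∈ S, lc L v = L (unit v)) ∧ (lc L).support ⊆ S := by
  have h : ∀ v, lc L v = if v ∈ S then L (unit v) else 0 := by
    intro v
    rw [lc_support_eq_sum L hL, Finset.sum_image unit_injective.injOn, Finsupp.finsetSum_apply]
    simp only [unit, Finsupp.smul_apply, Finsupp.single_apply, smul_eq_mul, mul_ite, mul_one,
      mul_zero]
    rw [Finset.sum_ite_eq']
  refine ⟨fun v hv => by rw [h, if_pos hv], fun v hv => ?_⟩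
  by_contra hvS
  rw [Finsupp.mem_support_iff, h, if_neg hvS] at hv
  exact hv rfl

omit [AddCommGroup E] [Module ℝ E] in
lemma exists_lc_units (w : E →₀ ℝ) :
    ∃ L : (E →₀ ℝ) →₀ ℝ, L.support = w.support.image unit ∧ lc L = w ∧
      ((∀ v, 0 ≤ w v) → ∀ u, 0 ≤ L u) := by
  refine ⟨w.mapDomain unit, Finsupp.mapDomain_support_of_injective unit_injective w, ?_, ?_⟩
  · rw [lc, Finsupp.linearCombination_mapDomain, Finsupp.linearCombination_apply]
    simp only [Function.comp, id, unit, Finsupp.smul_single, smul_eq_mul, mul_one]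
    exact Finsupp.sum_single w
  · intro h u
    by_cases hu : u ∈ Set.range unit
    · obtain ⟨v, rfl⟩ := hu
      rw [Finsupp.mapDomain_apply unit_injective]; exact h v
    · rw [Finsupp.mapDomain_of_notMem_range _ _ hu]

/-- The fan of orthants corresponding to the cells of `K`. -/
def orthants (K : Set (Finset E)) : Set (Finset (E →₀ ℝ)) := (fun S => S.image unit) '' K

variable {K : Set (Finset E)}

omit [AddCommGroup E] [Module ℝ E] in
lemma orthants_singleton (hK : ∀ S ∈ K, ∀ R ⊆ S, R ∈ K) {w : E →₀ ℝ} (hw : {w} ∈ orthants K) :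
    ∃ v, {v} ∈ K ∧ w = unit v := by
  obtain ⟨S, hS, h⟩ := hw
  have : w ∈ S.image unit := by rw [show S.image unit = {w} from h]; simp
  obtain ⟨v, hv, rfl⟩ := Finset.mem_image.1 this
  exact ⟨v, hK S hS _ (by simpa using hv), rfl⟩

lemma isFan_orthants (hK : IsFan K) : IsFan (orthants K) := by
  refine ⟨hK.finite.image _, ?_, ?_⟩
  · rintro _ ⟨S, hS, rfl⟩ R hR
    obtain ⟨R', hR', rfl⟩ := Finset.subset_image_iff.1 hR
    exact ⟨R', hK.mono S hS _ (by exact_mod_cast hR'), rfl⟩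
  · have key : ∀ L ∈ realization (orthants K), ∀ L' ∈ realization (orthants K), lc L = lc L' →
        ∀ u ∈ L.support, L u = L' u := by
      rintro L ⟨-, S, -, hL⟩ L' ⟨-, S', -, hL'⟩ h u hu
      rw [← show S.image unit = L.support from hL] at hu
      obtain ⟨v, hv, rfl⟩ := Finset.mem_image.1 hu
      rw [← (lc_units (S := S) (le_of_eq hL.symm)).1 v hv, h]
      by_cases hvS : v ∈ S'
      · exact (lc_units (S := S') (le_of_eq hL'.symm)).1 v hvS
      · rw [Finsupp.notMem_support_iff.1 fun h' =>
          hvS ((lc_units (S := S') (le_of_eq hL'.symm)).2 h')]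
        symm
        rw [← Finsupp.notMem_support_iff, ← show S'.image unit = L'.support from hL']
        intro h'
        obtain ⟨v', hv', hvv⟩ := Finset.mem_image.1 h'
        exact hvS (unit_injective hvv ▸ hv')
    intro L hL L' hL' h
    ext u
    by_cases hu : u ∈ L.support
    · exact key L hL L' hL' h u hu
    · by_cases hu' : u ∈ L'.support
      · exact (key L' hL' L hL h.symm u hu').symm
      · rw [Finsupp.notMem_support_iff.1 hu, Finsupp.notMem_support_iff.1 hu']

lemma spt_orthants (hK : IsFan K) : spt (orthants K) = realization K := by
  ext w
  constructor
  · rintro ⟨L, ⟨h0, S, hS, hL⟩, rfl⟩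
    obtain ⟨h1, h2⟩ := lc_units (S := S) (le_of_eq hL.symm)
    refine ⟨fun v => ?_, hK.mono S hS _ h2⟩
    by_cases hv : v ∈ S
    · rw [h1 v hv]; exact h0 _
    · rw [Finsupp.notMem_support_iff.1 fun h => hv (h2 h)]
  · rintro ⟨h0, hS⟩
    obtain ⟨L, h1, h2, h3⟩ := exists_lc_units w
    exact ⟨L, ⟨h3 h0, by rw [h1]; exact ⟨_, hS, rfl⟩⟩, h2⟩

omit [AddCommGroup E] [Module ℝ E] in
lemma mult_orthant {Λ : AddSubgroup (E →₀ ℝ)} {N : ℕ} {S : Finset E}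
    (h : ∀ w ∈ Λ, w.support ⊆ S → ∀ v, ∃ z : ℤ, (N : ℝ) * w v = z) :
    Mult Λ N (S.image unit) := by
  intro L hL hLΛ u
  by_cases hu : u ∈ S.image unit
  · obtain ⟨v, hv, rfl⟩ := Finset.mem_image.1 hu
    rw [← (lc_units hL).1 v hv]
    exact h _ hLΛ (lc_units hL).2 v
  · rw [Finsupp.notMem_support_iff.1 fun h => hu (hL h)]
    exact ⟨0, by simp⟩

/-- The integral words with value in `Λ`. -/
def intWords (Λ : AddSubgroup E) : AddSubgroup (E →₀ ℝ) where
  carrier := {w | lc w ∈ Λ ∧ ∀ v, ∃ z : ℤ, w v = z}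
  zero_mem' := ⟨by simp [Λ.zero_mem], fun v => ⟨0, by simp⟩⟩
  add_mem' := by
    rintro w w' ⟨h, hz⟩ ⟨h', hz'⟩
    refine ⟨by rw [map_add]; exact Λ.add_mem h h', fun v => ?_⟩
    obtain ⟨z, hz⟩ := hz v
    obtain ⟨z', hz'⟩ := hz' v
    exact ⟨z + z', by simp [hz, hz']⟩
  neg_mem' := by
    rintro w ⟨h, hz⟩
    refine ⟨by rw [map_neg]; exact Λ.neg_mem h, fun v => ?_⟩
    obtain ⟨z, hz⟩ := hz v
    exact ⟨-z, by simp [hz]⟩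

/-- The words with value in `Λ`. -/
noncomputable def words (Λ : AddSubgroup E) : AddSubgroup (E →₀ ℝ) := Λ.comap lc.toAddMonoidHom

lemma exists_reach_words {B : ℕ} {Λ : AddSubgroup E} (hK : IsFan K)
    (hvK : ∀ v, {v} ∈ K → v ∈ Λ) (hg : ∀ S ∈ K, Good Λ B S) :
    ∃ Λ₁, Reach B (intWords Λ) Λ₁ ∧ intWords Λ ≤ Λ₁ ∧ Λ₁ ≤ words Λ ∧
      ∀ w : E →₀ ℝ, w.support ∈ K → lc w ∈ Λ → w ∈ Λ₁ := by
  choose! n hn0 hnB hnM using hg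
  set F := hK.finite.toFinset with hF
  have hFm : ∀ S, S ∈ F ↔ S ∈ K := fun S => by simp [hF]
  set N := ∏ S ∈ F, n S with hN
  have hN0 : N ≠ 0 := Finset.prod_ne_zero_iff.2 fun S hS => hn0 S ((hFm S).1 hS)
  have hNB : ∀ q, q.Prime → q ∣ N → q < B := fun q hq hqN => by
    obtain ⟨S, hS, h⟩ := (Prime.dvd_finsetProd_iff hq.prime _).1 hqN
    exact hnB S ((hFm S).1 hS) q hq h
  have hNw : ∀ w : E →₀ ℝ, w.support ∈ K → lc w ∈ Λ → ∀ v, ∃ z : ℤ, (N : ℝ) * w v = z := by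
    intro w hw hwΛ v
    obtain ⟨z, hz⟩ := hnM _ hw w le_rfl hwΛ v
    obtain ⟨t, ht⟩ := Finset.dvd_prod_of_mem n ((hFm _).2 hw)
    refine ⟨t * z, ?_⟩
    rw [hN, ht]; push_cast; rw [← hz]; ring
  set V := F.sup id with hV
  have hsV : ∀ S ∈ K, S ⊆ V := fun S hS => Finset.le_sup (f := id) ((hFm S).2 hS)
  set W₀ : Set (E →₀ ℝ) := {w | w.support ∈ K ∧ lc w ∈ Λ ∧ ∀ v, 0 ≤ w v ∧ w v < 1} with hW₀
  have hfin : W₀.Finite := by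
    refine (Set.finite_range fun f : V → Fin N =>
      ∑ v : V, Finsupp.single (v : E) ((f v : ℕ) / (N : ℝ))).subset ?_
    rintro w ⟨h1, h2, h3⟩
    have hNpos : (0 : ℝ) < N := by exact_mod_cast Nat.pos_of_ne_zero hN0
    have : ∀ v : E, ∃ k : ℕ, k < N ∧ w v = k / (N : ℝ) := by
      intro v
      obtain ⟨z, hz⟩ := hNw w h1 h2 v
      have hz0 : 0 ≤ z := by
        have : (0 : ℝ) ≤ z := hz ▸ mul_nonneg hNpos.le (h3 v).1
        exact_mod_cast this
      obtain ⟨k, rfl⟩ := Int.eq_ofNat_of_zero_le hz0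
      refine ⟨k, ?_, ?_⟩
      · have : ((k : ℤ) : ℝ) < N := by
          rw [← hz]; nlinarith [(h3 v).2]
        exact_mod_cast this
      · rw [eq_div_iff hNpos.ne', mul_comm, hz]; simp
    choose k hk1 hk2 using this
    refine ⟨fun v => ⟨k v, hk1 v⟩, ?_⟩
    ext u
    rw [Finsupp.finsetSum_apply]
    simp only [Finsupp.single_apply]
    by_cases hu : u ∈ V
    · rw [Finset.sum_eq_single ⟨u, hu⟩]
      · simp [hk2]
      · intro v _ hv
        rw [if_neg fun h => hv (Subtype.ext h)]
      · simp
    · rw [Finset.sum_eq_zero fun (v : V) _ => if_neg fun h : (v : E) = u => hu (h ▸ v.2)]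
      exact (Finsupp.notMem_support_iff.1 fun h => hu (hsV _ h1 h)).symm
  obtain ⟨Λ₁, h1, h2, h3, h4⟩ := exists_reach (Λ := intWords Λ) (Λt := words Λ) hN0 hNB
    (fun w hw => hw.1) hfin.toFinset (by
      intro w hw
      rw [Set.Finite.mem_toFinset] at hw
      refine ⟨hw.2.1, ?_, fun v => ?_⟩
      · rw [map_nsmul]; exact Λ.nsmul_mem hw.2.1 N
      · obtain ⟨z, hz⟩ := hNw w hw.1 hw.2.1 v
        exact ⟨z, by simpa using hz⟩)
  refine ⟨Λ₁, h1, h2, h3, fun w hw hwΛ => ?_⟩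
  set a : E →₀ ℝ := w.mapRange Int.fract Int.fract_zero with ha
  have haS : a.support ⊆ w.support := Finsupp.support_mapRange
  have hvΛ : ∀ v ∈ w.support, v ∈ Λ := fun v hv =>
    hvK v (hK.mono _ hw _ (by rwa [Finset.singleton_subset_iff]))
  have hsub : w - a ∈ intWords Λ := by
    refine ⟨?_, fun v => ⟨⌊w v⌋, by simp [ha, Int.self_sub_fract]⟩⟩
    rw [map_sub, lc_support_eq_sum w le_rfl, lc_support_eq_sum a haS, ← Finset.sum_sub_distrib]
    refine Λ.sum_mem fun v hv => ?_
    have : w v • v - a v • v = ⌊w v⌋ • v := by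
      rw [← sub_smul, ← Int.cast_smul_eq_zsmul ℝ, ha, Finsupp.mapRange_apply, Int.self_sub_fract]
    rw [this]; exact Λ.zsmul_mem (hvΛ v hv) _
  have haΛ : lc a ∈ Λ := by
    have := Λ.sub_mem hwΛ hsub.1
    rwa [map_sub, sub_sub_cancel] at this
  have haW : a ∈ Λ₁ := h4 a (by
    rw [Set.Finite.mem_toFinset]
    exact ⟨hK.mono _ hw _ haS, haΛ, fun v => ⟨Int.fract_nonneg _, Int.fract_lt_one _⟩⟩)
  have := Λ₁.add_mem (h2 hsub) haW
  rwa [sub_add_cancel] at this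

theorem reductionBelow (B : ℕ) : ReductionBelow B := by
  induction B using Nat.strong_induction_on with
  | _ B ih =>
  intro E _ _ Λ K hK h hvK hhK hInt hin hg A hA
  obtain ⟨Λ₁, h1, h2, h3, h4⟩ := exists_reach_words hK hvK hg
  have hKo := isFan_orthants hK
  obtain ⟨D, d1, d2, K', d3, d4, d5⟩ := reductionBelow_chain ih h1 hKo (h.comp lc)
    (by
      rintro _ ⟨S, hS, rfl⟩
      exact mult_orthant fun w hw _ v => by simpa using hw.2 v)
    (fun w hw => by
      obtain ⟨v, hv, rfl⟩ := orthants_singleton hK.mono hw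
      refine ⟨by simpa using hvK v hv, fun u => ?_⟩
      rw [unit, Finsupp.single_apply]
      split_ifs <;> [exact ⟨1, by simp⟩; exact ⟨0, by simp⟩])
    (fun w hw => by
      obtain ⟨v, hv, rfl⟩ := orthants_singleton hK.mono hw
      simpa using hhK v hv) hA
    (fun w hw => hInt _ (h3 hw))
    (by
      rintro _ ⟨S, hS, rfl⟩ h0
      have hSM := hin S hS fun v hv => by
        simpa using h0 (unit v) (Finset.mem_image_of_mem _ hv)
      exact mult_orthant fun w hw hwS v => hSM w hwS (h3 hw) v)
  have hspt : spt K' = realization K := by rw [d3.spt_eq, spt_orthants hK]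
  have hinj : Set.InjOn (lc : (E →₀ ℝ) → E) (spt K') := by rw [hspt]; exact hK.inj
  refine ⟨D, d1, d2, imageFan lc K', ⟨isFan_imageFan d3.fan hinj, ?_, ?_⟩, ?_, ?_⟩
  · rw [spt_imageFan d3.fan hinj, hspt]; rfl
  · rintro _ ⟨S, hS, rfl⟩
    obtain ⟨_, ⟨T, hT, rfl⟩, hST⟩ := d3.refines S hS
    refine ⟨T, hT, fun x hx => ?_⟩
    obtain ⟨w, hw, rfl⟩ := Finset.mem_image.1 hx
    obtain ⟨L, L1, L2, rfl⟩ := hST w hw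
    obtain ⟨q1, q2⟩ := lc_units L2
    refine ⟨lc L, fun v => ?_, q2, rfl⟩
    by_cases hv : v ∈ T
    · rw [q1 v hv]; exact L1 _
    · rw [Finsupp.notMem_support_iff.1 fun h => hv (q2 h)]
  · intro v hv
    obtain ⟨w, hw, rfl⟩ := mem_vertices_imageFan d3.fan hv
    refine ⟨h3 (d4 w hw).1, (d4 w hw).2.imp (fun ⟨q1, q2⟩ => ⟨q1, ?_⟩) id⟩
    obtain ⟨v', hv', rfl⟩ := orthants_singleton hK.mono q2
    simpa using hv'
  · rintro _ ⟨S, hS, rfl⟩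
    refine (d5 S hS).image (injOn_cell d3.fan hinj hS) fun L hL hLΛ => ?_
    obtain ⟨_, ⟨T, hT, rfl⟩, hST⟩ := d3.refines S hS
    refine ⟨h4 _ (hK.mono T hT _ ?_) hLΛ.1, hLΛ.2⟩
    intro v hv
    by_contra hvT
    refine Finsupp.mem_support_iff.1 hv ?_
    rw [lc_support_eq_sum L hL, Finsupp.finsetSum_apply]
    refine Finset.sum_eq_zero fun w hw => ?_
    obtain ⟨L', -, L2, rfl⟩ := hST w hw
    have := (lc_units L2).2
    rw [Finsupp.smul_apply, Finsupp.notMem_support_iff.1 fun h => hvT (this h), smul_zero]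

end Words

section Placing

open Classical

variable {E : Type} [AddCommGroup E] [Module ℝ E]

/-- The convex cone generated by `V`. -/
def coneHull (V : Finset E) : Set E := {x | ∃ l : E →₀ ℝ, (∀ v, 0 ≤ l v) ∧ l.support ⊆ V ∧ lc l = x}

lemma coneHull_add {V : Finset E} {x y : E} (hx : x ∈ coneHull V) (hy : y ∈ coneHull V) :
    x + y ∈ coneHull V := by
  obtain ⟨l, h0, hs, rfl⟩ := hx
  obtain ⟨l', h0', hs', rfl⟩ := hy
  exact ⟨l + l', fun v => add_nonneg (h0 v) (h0' v),
    Finsupp.support_add.trans (Finset.union_subset hs hs'), map_add _ _ _⟩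

lemma coneHull_smul {V : Finset E} {x : E} {t : ℝ} (ht : 0 ≤ t) (hx : x ∈ coneHull V) :
    t • x ∈ coneHull V := by
  obtain ⟨l, h0, hs, rfl⟩ := hx
  exact ⟨t • l, fun v => mul_nonneg ht (h0 v), Finsupp.support_smul.trans hs, map_smul _ _ _⟩

lemma mem_coneHull_insert {V : Finset E} {n x : E} :
    x ∈ coneHull (insert n V) ↔ ∃ y ∈ coneHull V, ∃ t : ℝ, 0 ≤ t ∧ x = y + t • n := by
  constructor
  · rintro ⟨l, h0, hs, rfl⟩
    refine ⟨lc (l.erase n), ⟨l.erase n, fun v => ?_, ?_, rfl⟩, l n, h0 n, (lc_erase_add l n).symm⟩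
    · rw [Finsupp.erase_apply]; split_ifs <;> [exact le_rfl; exact h0 v]
    · rw [Finsupp.support_erase]
      exact (Finset.erase_subset_erase _ hs).trans (Finset.erase_insert_subset _ _)
  · rintro ⟨_, ⟨l, h0, hs, rfl⟩, t, ht, rfl⟩
    refine coneHull_add ⟨l, h0, hs.trans (Finset.subset_insert _ _), rfl⟩
      (coneHull_smul ht ⟨Finsupp.single n 1, single_nonneg_apply n, ?_, by simp⟩)
    exact Finsupp.support_single_subset.trans (by simp)

/-- There is a first point of a pointed cone on a half line. -/
lemma exists_first {V : Finset E} {n p : E} (g : E →ₗ[ℝ] ℝ) (hV : ∀ v ∈ V, 0 < g v) (hn : 0 < g n)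
    (hp : p ∈ coneHull (insert n V)) :
    ∃ t : ℝ, 0 ≤ t ∧ p - t • n ∈ coneHull V ∧ ∀ ε : ℝ, 0 < ε → ε ≤ t → p - t • n + ε • n ∉ coneHull V := by
  set M : (V → ℝ) × ℝ →ₗ[ℝ] E :=
    (Fintype.linearCombination ℝ (fun v : V => (v : E))).coprod (LinearMap.toSpanSingleton ℝ E n)
    with hM
  have hMa : ∀ z : (V → ℝ) × ℝ, M z = (∑ v : V, z.1 v • (v : E)) + z.2 • n := fun z => by
    simp [hM, Fintype.linearCombination_apply]
  set A : Set ((V → ℝ) × ℝ) := {z | M z = p ∧ 0 ≤ z} with hA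
  have hcone : ∀ t, 0 ≤ t → p - t • n ∈ coneHull V → ∃ z ∈ A, z.2 = t := by
    rintro t ht ⟨l, h0, hs, hl⟩
    refine ⟨(fun v => l v, t), ⟨?_, fun v => h0 v, ht⟩, rfl⟩
    rw [hMa]
    simp only
    rw [Finset.sum_coe_sort V (fun v => l v • v), ← lc_support_eq_sum l hs, hl, sub_add_cancel]
  have hcone' : ∀ z ∈ A, p - z.2 • n ∈ coneHull V := by
    rintro z ⟨hz, h1, h2⟩
    refine ⟨Finsupp.onFinset V (fun v => if h : v ∈ V then z.1 ⟨v, h⟩ else 0) ?_, fun v => ?_,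
      Finsupp.support_onFinset_subset, ?_⟩
    · intro v hv
      by_contra h
      simp [h] at hv
    · rw [Finsupp.onFinset_apply]
      split_ifs <;> [exact h1 _; exact le_rfl]
    · rw [lc_support_eq_sum _ Finsupp.support_onFinset_subset, ← hz, hMa, add_sub_cancel_right,
        ← Finset.sum_coe_sort]
      exact Finset.sum_congr rfl fun v _ => by simp
  obtain ⟨y, hy, t₀, ht₀, hpy⟩ := mem_coneHull_insert.1 hp
  obtain ⟨z₀, hz₀, -⟩ := hcone t₀ ht₀ (by rwa [hpy, add_sub_cancel_right])
  have hgp : ∀ z ∈ A, (∀ v : V, z.1 v ≤ g p / g v) ∧ z.2 ≤ g p / g n := by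
    rintro z ⟨hz, h1, h2⟩
    have h3 : g p = (∑ v : V, z.1 v * g v) + z.2 * g n := by
      rw [← hz, hMa]; simp
    have h4 : ∀ v ∈ Finset.univ, 0 ≤ z.1 v * g v := fun v _ =>
      mul_nonneg (h1 v) (hV v v.2).le
    have h5 : 0 ≤ z.2 * g n := mul_nonneg h2 hn.le
    refine ⟨fun v => ?_, ?_⟩
    · rw [le_div_iff₀ (hV v v.2)]
      have := Finset.single_le_sum h4 (Finset.mem_univ v)
      linarith
    · rw [le_div_iff₀ hn]
      have := Finset.sum_nonneg h4
      linarith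
  have hAcl : IsClosed A := by
    refine IsClosed.inter ?_ isClosed_Ici
    have h1 : IsClosed ((LinearMap.ker M : Submodule ℝ ((V → ℝ) × ℝ)) : Set ((V → ℝ) × ℝ)) :=
      Submodule.closed_of_finiteDimensional _
    have : {z | M z = p} = (fun z => z - z₀) ⁻¹' (LinearMap.ker M : Set ((V → ℝ) × ℝ)) := by
      ext z
      simp [sub_eq_zero, hz₀.1]
    show IsClosed {z | M z = p}
    rw [this]
    exact h1.preimage (by fun_prop)
  have hAc : IsCompact A := by
    refine (isCompact_Icc (a := (0 : (V → ℝ) × ℝ)) (b := (fun v => g p / g v, g p / g n))).of_isClosed_subset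
      hAcl fun z hz => ⟨hz.2, ?_, ?_⟩
    · exact fun v => (hgp z hz).1 v
    · exact (hgp z hz).2
  obtain ⟨z, hz, hmin⟩ := hAc.exists_isMinOn ⟨z₀, hz₀⟩ continuous_snd.continuousOn
  refine ⟨z.2, hz.2.2, hcone' z hz, fun ε hε hεt h => ?_⟩
  obtain ⟨z', hz', h'⟩ := hcone (z.2 - ε) (sub_nonneg.2 hεt) (by
    rwa [sub_smul, ← sub_add])
  have : z.2 ≤ z'.2 := hmin hz'
  linarith

/-- Placing a new generator. -/
theorem exists_placing {K : Set (Finset E)} (hK : IsFan K) (g : E →ₗ[ℝ] ℝ) {V : Finset E}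
    (hKV : spt K = coneHull V) (hV : ∀ v ∈ V, 0 < g v) {n : E} (hn : 0 < g n) :
    ∃ K', IsFan K' ∧ spt K' = coneHull (insert n V) ∧ K ⊆ K' ∧ ∀ S ∈ K', n ∉ S → S ∈ K := by
  by_cases hnC : n ∈ coneHull V
  · refine ⟨K, hK, ?_, le_rfl, fun S hS _ => hS⟩
    rw [hKV]
    ext x
    rw [mem_coneHull_insert]
    constructor
    · exact fun h => ⟨x, h, 0, le_rfl, by simp⟩
    · rintro ⟨y, hy, t, ht, rfl⟩
      exact coneHull_add hy (coneHull_smul ht hnC)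
  have hmem : ∀ l ∈ realization K, lc l ∈ coneHull V := fun l hl => hKV ▸ ⟨l, hl, rfl⟩
  have hnK : ∀ S ∈ K, n ∉ S := fun S hS h => hnC (by
    have := hmem (Finsupp.single n 1) ⟨single_nonneg_apply n, by
      rw [Finsupp.support_single _ one_ne_zero]; exact hK.mono S hS _ (by simpa using h)⟩
    simpa using this)
  set Vis : Finset E → Prop := fun S => ∀ l : E →₀ ℝ, (∀ v, 0 ≤ l v) → l.support = S →
    ∀ ε : ℝ, 0 < ε → lc l + ε • n ∉ coneHull V with hVis
  have hVmono : ∀ S ∈ K, Vis S → ∀ R ⊆ S, Vis R := by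
    intro S hS hv R hR l h0 hl ε hε h
    set a : E →₀ ℝ := ∑ v ∈ S, Finsupp.single v 1 with ha
    have hav : ∀ v, a v = if v ∈ S then 1 else 0 := fun v => by
      rw [ha, Finsupp.finsetSum_apply]
      simp [Finsupp.single_apply]
    have has : a.support = S := by
      ext v; rw [Finsupp.mem_support_iff, hav]; simp
    have ha0 : ∀ v, 0 ≤ a v := fun v => by rw [hav]; split_ifs <;> norm_num
    refine hv (l + a) (fun v => add_nonneg (h0 v) (ha0 v)) ?_ ε hε ?_
    · ext v
      rw [Finsupp.mem_support_iff, Finsupp.add_apply, hav]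
      by_cases hvS : v ∈ S
      · simp only [hvS, if_true, iff_true]
        have := h0 v
        positivity
      · have : l v = 0 := by
          rw [← Finsupp.notMem_support_iff, hl]; exact fun h => hvS (hR h)
        simp [hvS, this]
    · rw [map_add, add_right_comm]
      exact coneHull_add h (hmem a ⟨ha0, has ▸ hS⟩)
  set K' : Set (Finset E) := K ∪ {T | n ∈ T ∧ T.erase n ∈ K ∧ Vis (T.erase n)} with hK'
  have hdec : ∀ l ∈ realization K', l.erase n ∈ realization K ∧ 0 ≤ l n ∧
      (l n ≠ 0 → Vis (l.erase n).support) := by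
    rintro l ⟨h0, hl⟩
    refine ⟨⟨fun v => ?_, ?_⟩, h0 n, fun hln => ?_⟩
    · rw [Finsupp.erase_apply]; split_ifs <;> [exact le_rfl; exact h0 v]
    · rw [Finsupp.support_erase]
      rcases hl with hl | hl
      · exact hK.mono _ hl _ (Finset.erase_subset _ _)
      · exact hl.2.1
    · rw [Finsupp.support_erase]
      rcases hl with hl | hl
      · exact absurd (Finsupp.mem_support_iff.2 hln) (hnK _ hl)
      · exact hl.2.2
  refine ⟨K', ⟨?_, ?_, ?_⟩, ?_, Set.subset_union_left, ?_⟩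
  · refine (hK.finite.union (hK.finite.image (insert n))).subset ?_
    rintro T (hT | ⟨h1, h2, -⟩)
    · exact Or.inl hT
    · exact Or.inr ⟨_, h2, Finset.insert_erase h1⟩
  · rintro S (hS | ⟨h1, h2, h3⟩) R hR
    · exact Or.inl (hK.mono S hS R hR)
    · have hR' := Finset.erase_subset_erase n hR
      by_cases hnR : n ∈ R
      · exact Or.inr ⟨hnR, hK.mono _ h2 _ hR', hVmono _ h2 h3 _ hR'⟩
      · rw [Finset.erase_eq_of_notMem hnR] at hR'
        exact Or.inl (hK.mono _ h2 _ hR')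
  · have key : ∀ l ∈ realization K', ∀ l' ∈ realization K', lc l = lc l' → l n ≤ l' n := by
      intro l hl l' hl' h
      by_contra hlt
      push Not at hlt
      obtain ⟨h1, h2, h3⟩ := hdec l hl
      obtain ⟨h1', h2', -⟩ := hdec l' hl'
      refine h3 (by linarith) _ h1.1 rfl (l n - l' n) (by linarith) ?_
      have : lc (l.erase n) + (l n - l' n) • n = lc (l'.erase n) := by
        rw [lc_erase, lc_erase, h, sub_smul]; abel
      rw [this]; exact hmem _ h1'
    intro l hl l' hl' h
    have hn' : l n = l' n := le_antisymm (key l hl l' hl' h) (key l' hl' l hl h.symm)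
    have := hK.inj (hdec l hl).1 (hdec l' hl').1 (by rw [lc_erase, lc_erase, h, hn'])
    rw [← Finsupp.single_add_erase n l, ← Finsupp.single_add_erase n l', hn', this]
  · ext p
    constructor
    · rintro ⟨l, hl, rfl⟩
      obtain ⟨h1, h2, -⟩ := hdec l hl
      exact mem_coneHull_insert.2 ⟨_, hmem _ h1, l n, h2, (lc_erase_add l n).symm⟩
    · intro hp
      obtain ⟨t, ht, h1, h2⟩ := exists_first g hV hn hp
      have h1' := h1
      rw [← hKV] at h1'
      obtain ⟨l, hl, hlp⟩ := h1'
      rcases ht.eq_or_lt with rfl | ht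
      · exact ⟨l, ⟨hl.1, Or.inl hl.2⟩, by simpa using hlp⟩
      have hvis : ∀ ε : ℝ, 0 < ε → lc l + ε • n ∉ coneHull V := by
        intro ε hε h
        have hq : 0 < min 1 (t / ε) := lt_min one_pos (div_pos ht hε)
        have hq1 : min 1 (t / ε) ≤ 1 := min_le_left _ _
        refine h2 (min 1 (t / ε) * ε) (mul_pos hq hε) ?_ ?_
        · rw [← le_div_iff₀ hε]; exact min_le_right _ _
        · have := coneHull_add (coneHull_smul (sub_nonneg.2 hq1) h1) (coneHull_smul hq.le h)
          rw [hlp] at this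
          convert this using 1
          module
      have hVl : Vis l.support := by
        intro l' h0' hl' ε hε h
        obtain ⟨δ, hδ, hδl⟩ : ∃ δ : ℝ, 0 < δ ∧ ∀ v, δ * l' v ≤ l v := by
          have hp : ∀ v ∈ l.support, 0 < l v := fun v hv =>
            (hl.1 v).lt_of_ne (Finsupp.mem_support_iff.1 hv).symm
          have hq : ∀ v ∈ l.support, 0 ≤ l' v / l v := fun v hv => div_nonneg (h0' v) (hp v hv).le
          have hsum := Finset.sum_nonneg hq
          refine ⟨(1 + ∑ v ∈ l.support, l' v / l v)⁻¹, by positivity, fun v => ?_⟩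
          by_cases hv : v ∈ l.support
          · rw [inv_mul_le_iff₀ (by positivity)]
            have h5 := Finset.single_le_sum hq hv
            rw [div_le_iff₀ (hp v hv)] at h5
            linarith [hp v hv]
          · have : l' v = 0 := by rw [← Finsupp.notMem_support_iff, hl']; exact hv
            rw [this, mul_zero]; exact hl.1 v
        refine hvis (δ * ε) (mul_pos hδ hε) ?_
        have := coneHull_add (coneHull_smul hδ.le h) (hmem (l - δ • l') ⟨fun v => by
          simpa using hδl v, hK.mono _ hl.2 _ (Finsupp.support_sub.trans
            (Finset.union_subset le_rfl (Finsupp.support_smul.trans hl'.le)))⟩)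
        rw [map_sub, map_smul] at this
        convert this using 1
        module
      have hnl : n ∉ l.support := hnK _ hl.2
      have hs : (l + Finsupp.single n t).support = insert n l.support := by
        ext v
        by_cases hv : v = n
        · subst hv
          simp [Finsupp.notMem_support_iff.1 hnl, ht.ne']
        · simp [hv]
      refine ⟨l + Finsupp.single n t, ⟨fun v => ?_, Or.inr ?_⟩, ?_⟩
      · have : 0 ≤ (Finsupp.single n t) v := by
          rw [Finsupp.single_apply]; split_ifs <;> [exact ht.le; exact le_rfl]
        simpa using add_nonneg (hl.1 v) this
      · rw [hs, Set.mem_ofPred_eq, Finset.erase_insert hnl]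
        exact ⟨by simp, hl.2, hVl⟩
      · rw [map_add, hlp, lc_single, sub_add_cancel]
  · rintro S (hS | hS) h
    · exact hS
    · exact absurd hS.1 h

/-- Placing several generators. -/
theorem exists_placing_finset {K : Set (Finset E)} (hK : IsFan K) (g : E →ₗ[ℝ] ℝ) {V : Finset E}
    (hKV : spt K = coneHull V) (hV : ∀ v ∈ V, 0 < g v) (W : Finset E) (hW : ∀ v ∈ W, 0 < g v) :
    ∃ K', IsFan K' ∧ spt K' = coneHull (W ∪ V) ∧ K ⊆ K' ∧
      ∀ S ∈ K', (∀ w ∈ S, w ∉ W) → S ∈ K := by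
  induction W using Finset.induction_on with
  | empty => exact ⟨K, hK, by simpa using hKV, le_rfl, fun S hS _ => hS⟩
  | insert n W _ ih =>
    obtain ⟨K₁, h1, h2, h3, h4⟩ := ih fun v hv => hW v (Finset.mem_insert_of_mem hv)
    obtain ⟨K₂, h1', h2', h3', h4'⟩ := exists_placing h1 g h2 (fun v hv => by
      rcases Finset.mem_union.1 hv with hv | hv
      · exact hW v (Finset.mem_insert_of_mem hv)
      · exact hV v hv) (hW n (Finset.mem_insert_self _ _))
    refine ⟨K₂, h1', by rw [h2', Finset.insert_union], h3.trans h3', fun S hS hSW => ?_⟩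
    exact h4 S (h4' S hS fun h => hSW n h (Finset.mem_insert_self _ _)) fun w hw hwW =>
      hSW w hw (Finset.mem_insert_of_mem hwW)

end Placing

section Denominators

open Classical

variable {E : Type} [AddCommGroup E] [Module ℝ E]

/-- `Λ` has integral coordinates with respect to some injection into a coordinate space. -/
def HasIntCoords (Λ : AddSubgroup E) : Prop :=
  ∃ (ι : Type) (_ : Fintype ι) (e : E →ₗ[ℝ] ι → ℝ), Function.Injective e ∧
    ∀ x ∈ Λ, ∀ i, ∃ z : ℤ, e x i = z

lemma HasIntCoords.exists_mult {Λ : AddSubgroup E} (hΛ : HasIntCoords Λ) {K : Set (Finset E)}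
    (hK : IsFan K) {S : Finset E} (hS : S ∈ K) (hSΛ : ∀ v ∈ S, v ∈ Λ) :
    ∃ N : ℕ, N ≠ 0 ∧ Mult Λ N S := by
  obtain ⟨ι, _, e, he, hInt⟩ := hΛ
  set A : Set (E →₀ ℝ) := {a | a.support ⊆ S ∧ lc a ∈ Λ ∧ ∀ v, 0 ≤ a v ∧ a v < 1} with hA
  have hAinj : Set.InjOn (fun a : E →₀ ℝ => e (lc a)) A := by
    intro a ha b hb h
    exact hK.inj ⟨fun v => (ha.2.2 v).1, hK.mono S hS _ ha.1⟩
      ⟨fun v => (hb.2.2 v).1, hK.mono S hS _ hb.1⟩ (he h)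
  have hAfin : A.Finite := by
    refine Set.Finite.of_finite_image (f := fun a : E →₀ ℝ => e (lc a)) ?_ hAinj
    set M : ι → ℕ := fun i => ⌈∑ v ∈ S, |e v i|⌉₊ with hM
    refine (Set.Finite.pi' (t := fun i => (Int.cast : ℤ → ℝ) '' Set.Icc (-(M i : ℤ)) (M i))
      fun i => (Set.finite_Icc _ _).image _).subset ?_
    rintro _ ⟨a, ⟨h1, h2, h3⟩, rfl⟩ i
    obtain ⟨z, hz⟩ := hInt _ h2 i
    have hb : |e (lc a) i| ≤ M i := by
      refine le_trans ?_ (Nat.le_ceil _)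
      rw [lc_support_eq_sum a h1, map_sum, Finset.sum_apply]
      refine (Finset.abs_sum_le_sum_abs _ _).trans (Finset.sum_le_sum fun v _ => ?_)
      rw [map_smul, Pi.smul_apply, smul_eq_mul, abs_mul, abs_of_nonneg (h3 v).1]
      exact mul_le_of_le_one_left (abs_nonneg _) (h3 v).2.le
    refine ⟨z, ?_, hz.symm⟩
    rw [hz] at hb
    rw [Set.mem_Icc, ← abs_le]
    exact_mod_cast hb
  set C := hAfin.toFinset.card with hC
  refine ⟨C.factorial, Nat.factorial_ne_zero C, fun l hl hlΛ v => ?_⟩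
  set a : ℕ → E →₀ ℝ := fun j => ((j : ℝ) • l).mapRange Int.fract Int.fract_zero with ha
  have haS : ∀ j, (a j).support ⊆ S := fun j =>
    Finsupp.support_mapRange.trans (Finsupp.support_smul.trans hl)
  have haA : ∀ j, a j ∈ A := by
    intro j
    refine ⟨haS j, ?_, fun v => ⟨Int.fract_nonneg _, Int.fract_lt_one _⟩⟩
    have h1 : lc ((j : ℝ) • l) - lc (a j) ∈ Λ := by
      rw [lc_support_eq_sum _ (Finsupp.support_smul.trans hl), lc_support_eq_sum _ (haS j),
        ← Finset.sum_sub_distrib]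
      refine Λ.sum_mem fun v hv => ?_
      rw [← sub_smul, ha, Finsupp.mapRange_apply, Int.self_sub_fract, Int.cast_smul_eq_zsmul]
      exact Λ.zsmul_mem (hSΛ v hv) _
    have h2 : lc ((j : ℝ) • l) ∈ Λ := by
      rw [map_smul, Nat.cast_smul_eq_nsmul]; exact Λ.nsmul_mem hlΛ j
    have := Λ.sub_mem h2 h1
    rwa [sub_sub_cancel] at this
  obtain ⟨i, hi, j, hj, hij, h⟩ := Finset.exists_ne_map_eq_of_card_lt_of_maps_to
    (s := Finset.range (C + 1)) (t := hAfin.toFinset) (f := a) (by simp [hC])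
    (fun j _ => by simpa using haA j)
  wlog hlt : i < j generalizing i j
  · exact this j hj i hi hij.symm h.symm (by omega)
  have hd : j - i ∣ C.factorial := Nat.dvd_factorial (by omega) (by
    have := Finset.mem_range.1 hj; omega)
  obtain ⟨q, hq⟩ := hd
  have hfr : Int.fract ((i : ℝ) * l v) = Int.fract ((j : ℝ) * l v) := by
    simpa [ha] using DFunLike.congr_fun h v
  obtain ⟨z, hz⟩ := Int.fract_eq_fract.1 hfr.symm
  refine ⟨q * z, ?_⟩
  rw [hq]
  push_cast [Nat.cast_sub hlt.le]
  rw [← hz]; ring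

lemma HasIntCoords.exists_good {Λ : AddSubgroup E} (hΛ : HasIntCoords Λ) {K : Set (Finset E)}
    (hK : IsFan K) (hKΛ : ∀ v, {v} ∈ K → v ∈ Λ) : ∃ B, ∀ S ∈ K, Good Λ B S := by
  have : ∀ S ∈ K, ∃ N : ℕ, N ≠ 0 ∧ Mult Λ N S := fun S hS => hΛ.exists_mult hK hS fun v hv =>
    hKΛ v (hK.mono S hS _ (by simpa using hv))
  choose! N hN0 hN using this
  refine ⟨hK.finite.toFinset.sup N + 1, fun S hS => (hN S hS).good (hN0 S hS) ?_⟩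
  exact Nat.lt_succ_of_le (Finset.le_sup (f := N) (by simpa using hS))

end Denominators

section Dilates

open Classical

variable {E : Type} [AddCommGroup E] [Module ℝ E]

noncomputable local instance decidableEqProd'' {F : Type} : DecidableEq (F × ℝ) :=
  fun a b => Classical.propDecidable (a = b)

lemma mem_coneHull_self {V : Finset E} {v : E} (hv : v ∈ V) : v ∈ coneHull V :=
  ⟨Finsupp.single v 1, single_nonneg_apply v,
    Finsupp.support_single_subset.trans (by simpa using hv), by simp⟩

lemma map_mem_coneHull {F : Type} [AddCommGroup F] [Module ℝ F] (f : F →ₗ[ℝ] E) {W : Finset F}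
    {V : Finset E} (hf : ∀ w ∈ W, f w ∈ coneHull V) {x : F} (hx : x ∈ coneHull W) :
    f x ∈ coneHull V := by
  obtain ⟨l, h0, hs, rfl⟩ := hx
  rw [map_lc_eq_sum f l hs]
  refine Finset.sum_induction _ (· ∈ coneHull V) (fun _ _ => coneHull_add)
    ⟨0, by simp, by simp, by simp⟩ fun w hw => coneHull_smul (h0 w) (hf w hw)

lemma isFan_singleton_empty : IsFan ({∅} : Set (Finset E)) := by
  refine ⟨Set.finite_singleton _, ?_, ?_⟩
  · rintro _ rfl R hR
    exact Finset.subset_empty.1 hR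
  · rintro l ⟨-, hl⟩ l' ⟨-, hl'⟩ -
    rw [Finsupp.support_eq_empty.1 hl, Finsupp.support_eq_empty.1 hl']

lemma spt_singleton_empty : spt ({∅} : Set (Finset E)) = coneHull ∅ := by
  ext x
  constructor
  · rintro ⟨l, ⟨h0, hl⟩, rfl⟩
    exact ⟨l, h0, Eq.le hl, rfl⟩
  · rintro ⟨l, h0, hl, rfl⟩
    exact ⟨l, ⟨h0, Finset.subset_empty.1 hl⟩, rfl⟩

/-- A fan supported on the cone over a polytope that triangulates its `n`-th dilate
unimodularly. -/
structure IsDilateFan (Λ : AddSubgroup E) (h : E →ₗ[ℝ] ℝ) (V : Finset E) (n : ℕ)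
    (K : Set (Finset E)) : Prop where
  fan : IsFan K
  spt_eq : spt K = coneHull V
  mem : ∀ v, {v} ∈ K → v ∈ Λ
  height : ∀ v, {v} ∈ K → h v = n
  mult : ∀ S ∈ K, Mult (divLat Λ h n) 1 S

variable {Λ : AddSubgroup E} {h : E →ₗ[ℝ] ℝ} {V : Finset E}

lemma exists_isDilateFan (hΛ : HasIntCoords Λ) (hInt : ∀ x ∈ Λ, ∃ z : ℤ, h x = z)
    (hVΛ : ∀ v ∈ V, v ∈ Λ) (hV : ∀ v ∈ V, h v = 1) :
    ∃ A : ℕ, 1 ≤ A ∧ ∃ K, IsDilateFan Λ h V A K := by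
  obtain ⟨K, h1, h2, -, h4⟩ := exists_placing_finset isFan_singleton_empty h spt_singleton_empty
    (by simp) V fun v hv => by rw [hV v hv]; exact one_pos
  rw [Finset.union_empty] at h2
  have hvV : ∀ v, {v} ∈ K → v ∈ V := by
    intro v hv
    by_contra hvV
    have : ({v} : Finset E) ∈ ({∅} : Set (Finset E)) := h4 _ hv (by simpa using hvV)
    simp at this
  obtain ⟨B, hB⟩ := hΛ.exists_good h1 fun v hv => hVΛ v (hvV v hv)
  obtain ⟨A, hA, -, K', hs, hv, hM⟩ := reductionBelow B E Λ K h1 h (fun v hv => hVΛ v (hvV v hv))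
    (fun v hv => Or.inr (hV v (hvV v hv))) hInt (by
      intro S hS h0
      have : S = ∅ := by
        refine Finset.eq_empty_of_forall_notMem fun v hv => ?_
        have := h0 v hv
        rw [hV v (hvV v (h1.mono S hS _ (by simpa using hv)))] at this
        exact one_ne_zero this
      rw [this]
      intro l hl _ v
      rw [Finsupp.support_eq_empty.1 (Finset.subset_empty.1 hl)]
      exact ⟨0, by simp⟩) hB 1 le_rfl
  refine ⟨A, hA, K', hs.fan, by rw [hs.spt_eq, h2], fun v h' => (hv v h').1, fun v h' => ?_, hM⟩
  refine (hv v h').2.resolve_left fun hlast => ?_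
  rw [hV v (hvV v hlast.2)] at hlast
  exact one_ne_zero hlast.1

/-- The pairs `(x, r)` with `h x` congruent to `ρ * r` modulo `A`. -/
def congLat (Λ : AddSubgroup E) (h : E →ₗ[ℝ] ℝ) (A ρ : ℕ) : AddSubgroup (E × ℝ) where
  carrier := {x | x.1 ∈ Λ ∧ (∃ z : ℤ, x.2 = z) ∧ ∃ z : ℤ, h x.1 = ρ * x.2 + A * z}
  zero_mem' := ⟨Λ.zero_mem, ⟨0, by simp⟩, ⟨0, by simp⟩⟩
  add_mem' := by
    rintro x y ⟨hx, ⟨a, ha⟩, ⟨z, hz⟩⟩ ⟨hy, ⟨b, hb⟩, ⟨w, hw⟩⟩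
    refine ⟨Λ.add_mem hx hy, ⟨a + b, by simp [ha, hb]⟩, ⟨z + w, ?_⟩⟩
    rw [Prod.fst_add, map_add, hz, hw, Prod.snd_add]; push_cast; ring
  neg_mem' := by
    rintro x ⟨hx, ⟨a, ha⟩, ⟨z, hz⟩⟩
    refine ⟨Λ.neg_mem hx, ⟨-a, by simp [ha]⟩, ⟨-z, ?_⟩⟩
    rw [Prod.fst_neg, map_neg, hz, Prod.snd_neg]; push_cast; ring

lemma HasIntCoords.congLat (hΛ : HasIntCoords Λ) (h : E →ₗ[ℝ] ℝ) (A ρ : ℕ) :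
    HasIntCoords (congLat Λ h A ρ) := by
  obtain ⟨ι, _, e, he, hInt⟩ := hΛ
  refine ⟨ι ⊕ Unit, inferInstance, LinearMap.pi (Sum.elim
    (fun i => (LinearMap.proj i).comp (e.comp (LinearMap.fst ℝ E ℝ)))
    fun _ => LinearMap.snd ℝ E ℝ), ?_, ?_⟩
  · intro x y hxy
    have h1 : x.1 = y.1 := he (by
      ext i; simpa using congrFun hxy (Sum.inl i))
    have h2 : x.2 = y.2 := by simpa using congrFun hxy (Sum.inr ())
    exact Prod.ext h1 h2
  · rintro x ⟨h1, h2, -⟩ (i | i)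
    · simpa using hInt _ h1 i
    · simpa using h2

lemma IsDilateFan.exists_of_modEq (hΛ : HasIntCoords Λ)
    (hVΛ : ∀ v ∈ V, v ∈ Λ) (hV : ∀ v ∈ V, h v = 1) {A : ℕ} (hA : 1 ≤ A) {K : Set (Finset E)}
    (hK : IsDilateFan Λ h V A K) {ρ : ℕ} (hρ : 1 ≤ ρ) :
    ∃ n₁ : ℕ, ∀ n ≥ n₁, n ≡ ρ [MOD A] → ∃ K', IsDilateFan Λ h V n K' := by
  have hA0 : (0 : ℝ) < A := by exact_mod_cast hA
  have hρ0 : (0 : ℝ) < ρ := by exact_mod_cast hρ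
  have hinj : Function.Injective (LinearMap.inl ℝ E ℝ) := LinearMap.inl_injective
  have hbase := isFan_imageFan (π := LinearMap.inl ℝ E ℝ) hK.fan hinj.injOn
  set W : Finset (E × ℝ) := V.image fun v => ((ρ : ℝ) • v, (1 : ℝ)) with hW
  have hWm : ∀ w ∈ W, w.2 = 1 ∧ w.1 ∈ Λ ∧ h w.1 = ρ := by
    intro w hw
    obtain ⟨v, hv, rfl⟩ := Finset.mem_image.1 hw
    refine ⟨rfl, ?_, by simp [hV v hv]⟩
    simp only [Nat.cast_smul_eq_nsmul]
    exact Λ.nsmul_mem (hVΛ v hv) ρ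
  set V' : Finset (E × ℝ) := V.image (LinearMap.inl ℝ E ℝ) with hV'
  have hspt : spt (imageFan (LinearMap.inl ℝ E ℝ) K) = coneHull V' := by
    rw [spt_imageFan hK.fan hinj.injOn, hK.spt_eq]
    ext x
    constructor
    · rintro ⟨x, hx, rfl⟩
      exact map_mem_coneHull _ (fun v hv => mem_coneHull_self (Finset.mem_image_of_mem _ hv)) hx
    · rintro ⟨l, h0, hl, rfl⟩
      obtain ⟨l', h1, h2, h3⟩ := exists_mapDomain _ hinj.injOn hl
      refine ⟨lc l', ⟨l', fun v => ?_, h1, rfl⟩, by rw [← lc_mapDomain, h2]⟩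
      by_cases hv : v ∈ V
      · rw [h3 v hv]; exact h0 _
      · rw [Finsupp.notMem_support_iff.1 fun h => hv (h1 h)]
  obtain ⟨K₁, k1, k2, -, k4⟩ := exists_placing_finset hbase (h.comp (LinearMap.fst ℝ E ℝ)) hspt
    (by
      intro w hw
      obtain ⟨v, hv, rfl⟩ := Finset.mem_image.1 hw
      simp [hV v hv]) W (by
      intro w hw
      simpa [(hWm w hw).2.2] using hρ0)
  have hv₁ : ∀ w, {w} ∈ K₁ → w ∈ W ∨ (w.2 = 0 ∧ w.1 ∈ Λ ∧ h w.1 = A) := by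
    intro w hw
    by_cases hwW : w ∈ W
    · exact Or.inl hwW
    · right
      obtain ⟨v, hv, rfl⟩ := mem_vertices_imageFan hK.fan (k4 _ hw (by simpa using hwW))
      exact ⟨rfl, hK.mem v hv, hK.height v hv⟩
  have hvΛ₁ : ∀ w, {w} ∈ K₁ → w ∈ congLat Λ h A ρ := by
    intro w hw
    rcases hv₁ w hw with h' | ⟨h1, h2, h3⟩
    · obtain ⟨h1, h2, h3⟩ := hWm w h'
      exact ⟨h2, ⟨1, by simp [h1]⟩, ⟨0, by simp [h1, h3]⟩⟩
    · exact ⟨h2, ⟨0, by simp [h1]⟩, ⟨1, by simp [h1, h3]⟩⟩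
  obtain ⟨B, hB⟩ := (hΛ.congLat h A ρ).exists_good k1 hvΛ₁
  obtain ⟨D, hD, hDA, K₂, hs₂, hv₂, hM₂⟩ := reductionBelow B (E × ℝ) (congLat Λ h A ρ) K₁ k1
    (LinearMap.snd ℝ E ℝ) hvΛ₁ (by
      intro w hw
      rcases hv₁ w hw with h' | h'
      · exact Or.inr (hWm w h').1
      · exact Or.inl h'.1) (fun x hx => hx.2.1) (by
      intro S hS h0
      obtain ⟨S', hS', rfl⟩ := k4 S hS fun w hw hwW => by
        have h1 : w.2 = 0 := h0 w hw
        rw [(hWm w hwW).1] at h1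
        exact one_ne_zero h1
      refine (hK.mult S' hS').image hinj.injOn fun l _ hl => ⟨hl.1, ?_⟩
      simpa using hl.2.2) hB A hA
  have hD0 : (0 : ℝ) < D := by exact_mod_cast hD
  obtain ⟨n₁, hn₁⟩ : ∃ n₁ : ℕ, ∀ w, {w} ∈ K₂ → h w.1 ≤ n₁ := by
    have hfin : {w | {w} ∈ K₂}.Finite :=
      Set.Finite.preimage Finset.singleton_injective.injOn hs₂.fan.finite
    obtain ⟨c, hc⟩ := (hfin.image fun w => h w.1).bddAbove
    obtain ⟨n₁, hn₁⟩ := exists_nat_ge c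
    exact ⟨n₁, fun w hw => (hc ⟨w, hw, rfl⟩).trans hn₁⟩
  refine ⟨max n₁ (ρ * D), fun n hn hnρ => ?_⟩
  have hnn₁ : (n₁ : ℝ) ≤ n := by exact_mod_cast (le_max_left _ _).trans hn
  have hnD : (ρ : ℝ) * D ≤ n := by exact_mod_cast (le_max_right _ _).trans hn
  have hn0 : (0 : ℝ) < n := (mul_pos hρ0 hD0).trans_le hnD
  obtain ⟨q, hq⟩ : ∃ q : ℤ, (n : ℝ) = ρ + A * q := by
    obtain ⟨q, hq⟩ := Nat.modEq_iff_dvd.1 hnρ.symm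
    refine ⟨q, ?_⟩
    have : (n : ℤ) = ρ + A * q := by linarith
    exact_mod_cast this
  obtain ⟨m, hm⟩ : ∃ m : ℤ, (D : ℝ) = 1 + A * m := by
    obtain ⟨m, hm⟩ := Nat.modEq_iff_dvd.1 hDA.symm
    refine ⟨m, ?_⟩
    have : (D : ℤ) = 1 + A * m := by push_cast at hm; linarith
    exact_mod_cast this
  set s : E × ℝ →ₗ[ℝ] ℝ := (A : ℝ)⁻¹ • tilt h (n / D) with hs
  have hsa : ∀ x, s x = (h x.1 - n / D * x.2) / A := fun x => by
    simp [hs, div_eq_inv_mul]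
  have hs0 : ∀ w : E × ℝ, w.2 = 0 → h w.1 = A → s w = 1 := fun w h1 h2 => by
    rw [hsa, h1, h2]; field_simp; ring
  have hsD : ∀ w : E × ℝ, {w} ∈ K₂ → w ∈ congLat Λ h A ρ → w.2 = D → ∃ z : ℕ, s w = -z := by
    rintro w hw ⟨-, -, z, hz⟩ hwD
    have h1 : s w = ((ρ * m + z - q : ℤ) : ℝ) := by
      rw [hsa, hz, hwD]
      push_cast
      field_simp
      rw [hq, hm]; ring
    have h2 : s w ≤ 0 := by
      rw [hsa, hwD, div_mul_cancel₀ _ hD0.ne']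
      exact div_nonpos_of_nonpos_of_nonneg (by linarith [hn₁ w hw]) hA0.le
    rw [h1] at h2 ⊢
    have h3 : ρ * m + z - q ≤ 0 := by exact_mod_cast h2
    obtain ⟨t, ht⟩ := Int.eq_ofNat_of_zero_le (neg_nonneg.2 h3)
    refine ⟨t, ?_⟩
    rw [← neg_neg (ρ * m + z - q), ht]; push_cast; rfl
  have hv₂' : ∀ w, {w} ∈ K₂ → w.1 ∈ Λ ∧ ((w.2 = 0 ∧ s w = 1) ∨ (w.2 = D ∧ ∃ z : ℕ, s w = -z)) := by
    intro w hw
    obtain ⟨h1, h2⟩ := hv₂ w hw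
    refine ⟨h1.1, h2.imp ?_ fun h3 => ⟨h3, hsD w hw h1 h3⟩⟩
    rintro ⟨h3, h4⟩
    have h3 : w.2 = 0 := h3
    refine ⟨h3, ?_⟩
    rcases hv₁ w h4 with h' | h'
    · rw [(hWm w h').1] at h3; exact absurd h3 one_ne_zero
    · exact hs0 w h3 h'.2.2
  obtain ⟨K₃, f1, -, f3, f4⟩ := exists_fold hs₂.fan s
    (fun w hw => (hv₂' w hw).2.imp (fun h => h.2) fun h => h.2)
    (Q := fun T => (∀ w ∈ T, w.1 ∈ Λ ∧ ((w.2 = 0 ∧ s w = 1) ∨ (w.2 = D ∧ ∃ z : ℕ, s w = -z))) ∧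
      Mult (divLat (congLat Λ h A ρ) (LinearMap.snd ℝ E ℝ) D) 1 T)
    (fun S R hR ⟨h1, h2⟩ => ⟨fun w hw => h1 w (hR hw), h2.mono le_rfl hR⟩)
    (by
      rintro T b v ⟨h1, h2⟩ hb hv hsb hsv hbv
      have hne : b ≠ v := by rintro rfl; linarith
      obtain ⟨h3, h4⟩ := h2.stellar_pair hne hb hv hbv
      have hnew : (b + v).1 ∈ Λ ∧ (((b + v).2 = 0 ∧ s (b + v) = 1) ∨
          ((b + v).2 = D ∧ ∃ z : ℕ, s (b + v) = -z)) := by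
        obtain ⟨b1, b2⟩ := h1 b hb
        obtain ⟨v1, v2⟩ := h1 v hv
        refine ⟨Λ.add_mem b1 v1, Or.inr ?_⟩
        obtain ⟨b3, z, hz⟩ := b2.resolve_left fun h => by linarith [h.2]
        obtain ⟨v3, -⟩ := v2.resolve_right fun ⟨_, z, hz⟩ => by
          have : (0 : ℝ) ≤ z := z.cast_nonneg
          linarith
        refine ⟨by rw [Prod.snd_add, b3, v3, add_zero], z - 1, ?_⟩
        have hz1 : 1 ≤ z := by
          by_contra hz1
          have : z = 0 := by omega
          rw [hz, this] at hsb; simp at hsb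
        rw [map_add, hz, hsv]; push_cast [hz1]; ring
      refine ⟨⟨fun w hw => ?_, h3⟩, ⟨fun w hw => ?_, h4⟩⟩ <;>
      · rcases Finset.mem_insert.1 hw with rfl | hw
        · exact hnew
        · exact h1 w (Finset.mem_of_mem_erase hw))
    (fun S hS => ⟨fun w hw => hv₂' w (hs₂.fan.mono S hS _ (by simpa using hw)), hM₂ S hS⟩)
  have hφ : ∀ x, s x = 0 ↔ x.2 = (((D : ℝ) / n) • h) x.1 := by
    intro x
    rw [hsa, div_eq_zero_iff, or_iff_left hA0.ne', LinearMap.smul_apply, smul_eq_mul, sub_eq_zero]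
    constructor
    · intro h'; rw [h']; field_simp
    · intro h'; rw [h']; field_simp
  obtain ⟨g1, g2, g3⟩ := exists_slice f1.fan s f4 (((D : ℝ) / n) • h) hφ
  have hvert : ∀ v, {v} ∈ imageFan (LinearMap.fst ℝ E ℝ)
      {S | S ∈ K₃ ∧ ∀ w ∈ S, w ∈ {x | s x = 0}} → v ∈ Λ ∧ h v = n := by
    intro v hv
    obtain ⟨w, ⟨hw, hw0⟩, rfl⟩ := mem_vertices_imageFan (f1.fan.subcomplex _) hv
    obtain ⟨h1, h2⟩ := (f3 _ hw).1 w (by simp)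
    have hw0 : s w = 0 := hw0 w (by simp)
    refine ⟨h1, ?_⟩
    obtain ⟨h3, -⟩ := h2.resolve_left fun h' => by linarith [h'.2]
    have := (hφ w).1 hw0
    rw [h3, LinearMap.smul_apply, smul_eq_mul] at this
    show h w.1 = n
    field_simp at this
    linarith
  refine ⟨_, g1, ?_, fun v hv => (hvert v hv).1, fun v hv => (hvert v hv).2, ?_⟩
  · rw [g2, f1.spt_eq, hs₂.spt_eq, k2]
    ext x
    constructor
    · intro hx
      refine map_mem_coneHull (LinearMap.fst ℝ E ℝ) (fun w hw => ?_) hx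
      rcases Finset.mem_union.1 hw with hw | hw
      · obtain ⟨v, hv, rfl⟩ := Finset.mem_image.1 hw
        exact coneHull_smul hρ0.le (mem_coneHull_self hv)
      · obtain ⟨v, hv, rfl⟩ := Finset.mem_image.1 hw
        exact mem_coneHull_self hv
    · intro hx
      refine map_mem_coneHull (LinearMap.id.prod (((D : ℝ) / n) • h)) (fun v hv => ?_) hx
      have h1 := coneHull_smul (V := W ∪ V') (t := D / n) (by positivity)
        (mem_coneHull_self (Finset.mem_union_left _
          (Finset.mem_image_of_mem (fun v => ((ρ : ℝ) • v, (1 : ℝ))) hv)))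
      have h2 := coneHull_smul (V := W ∪ V') (t := 1 - ρ * D / n)
        (sub_nonneg.2 ((div_le_one hn0).2 hnD))
        (mem_coneHull_self (Finset.mem_union_right _
          (Finset.mem_image_of_mem (LinearMap.inl ℝ E ℝ) hv)))
      convert coneHull_add h1 h2 using 1
      refine Prod.ext ?_ ?_
      · change v = ((D : ℝ) / n) • ((ρ : ℝ) • v) + (1 - (ρ : ℝ) * D / n) • v
        rw [smul_smul, ← add_smul, show (D : ℝ) / n * ρ + (1 - ρ * D / n) = 1 by ring, one_smul]
      · simp [hV v hv]
  · rintro _ ⟨S, ⟨hS, hS0⟩, rfl⟩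
    refine g3 S (fun w hw => hS0 w hw) (divLat Λ h n) _ ?_ 1 (f3 S hS).2
    rintro x ⟨hx, z, hz⟩
    have hDz : (((D : ℝ) / n) • h) x = D * z := by
      rw [LinearMap.smul_apply, smul_eq_mul, hz]; field_simp
    refine ⟨⟨hx, ⟨D * z, by simp [hDz]⟩, ⟨z * (q - ρ * m), ?_⟩⟩, z, hDz⟩
    simp only [hDz, hz]
    push_cast
    rw [hq, hm]; ring

/-- Cones over lattice polytopes: all large dilates have unimodular triangulations. -/
theorem exists_isDilateFan_of_ge (hΛ : HasIntCoords Λ) (hInt : ∀ x ∈ Λ, ∃ z : ℤ, h x = z)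
    (hVΛ : ∀ v ∈ V, v ∈ Λ) (hV : ∀ v ∈ V, h v = 1) :
    ∃ n₀ : ℕ, ∀ n ≥ n₀, ∃ K, IsDilateFan Λ h V n K := by
  obtain ⟨A, hA, K, hK⟩ := exists_isDilateFan hΛ hInt hVΛ hV
  have : ∀ i : ℕ, ∃ n₁ : ℕ, ∀ n ≥ n₁, n ≡ i + A [MOD A] → ∃ K', IsDilateFan Λ h V n K' :=
    fun i => hK.exists_of_modEq hΛ hVΛ hV hA (by omega)
  choose f hf using this
  refine ⟨(Finset.range A).sup f, fun n hn => hf (n % A) n ?_ ?_⟩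
  · exact (Finset.le_sup (f := f) (Finset.mem_range.2 (Nat.mod_lt _ hA))).trans hn
  · simp [Nat.ModEq]

end Dilates

section Triangulations

open Classical

variable {d : ℕ}

noncomputable local instance decidableEqVec : DecidableEq (Fin d → ℝ) :=
  fun a b => Classical.propDecidable (a = b)

/-- The sum of the coordinates. -/
noncomputable def total {E : Type} : (E →₀ ℝ) →ₗ[ℝ] ℝ :=
  Finsupp.linearCombination ℝ fun _ => 1

@[simp] lemma total_single {E : Type} (v : E) (t : ℝ) : total (Finsupp.single v t) = t := by
  simp [total]

lemma total_eq_sum {E : Type} (l : E →₀ ℝ) {S : Finset E} (h : l.support ⊆ S) :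
    total l = ∑ v ∈ S, l v := by
  simp only [total, Finsupp.linearCombination_apply, smul_eq_mul, mul_one]
  exact Finsupp.sum_of_support_subset _ h _ (by simp)

lemma mem_convexHull_iff_coords {E : Type} [AddCommGroup E] [Module ℝ E] {S : Finset E} {x : E} :
    x ∈ convexHull ℝ (S : Set E) ↔
      ∃ l : E →₀ ℝ, (∀ v, 0 ≤ l v) ∧ l.support ⊆ S ∧ total l = 1 ∧ lc l = x := by
  rw [Finset.mem_convexHull']
  constructor
  · rintro ⟨w, h0, h1, h2⟩
    set l : E →₀ ℝ := Finsupp.onFinset S (fun v => if v ∈ S then w v else 0)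
      (fun v hv => by by_contra h; simp [h] at hv) with hl
    have hS : l.support ⊆ S := Finsupp.support_onFinset_subset
    refine ⟨l, fun v => ?_, hS, ?_, ?_⟩
    · simp only [hl, Finsupp.onFinset_apply]
      split_ifs with h
      exacts [h0 v h, le_rfl]
    · rw [total_eq_sum l hS, ← h1]
      exact Finset.sum_congr rfl fun v hv => by simp [hl, hv]
    · rw [lc_support_eq_sum l hS, ← h2]
      exact Finset.sum_congr rfl fun v hv => by simp [hl, hv]
  · rintro ⟨l, h0, hS, h1, rfl⟩
    exact ⟨l, fun v _ => h0 v, by rw [← total_eq_sum l hS, h1], (lc_support_eq_sum l hS).symm⟩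

/-- A geometric simplicial complex, given by the vertex sets of its simplices. -/
structure IsComplex {E : Type} [AddCommGroup E] [Module ℝ E] (C : Set (Finset E)) : Prop where
  finite : C.Finite
  mono : ∀ S ∈ C, ∀ R ⊆ S, R ∈ C
  inj : ∀ l l' : E →₀ ℝ, l ∈ realization C → l' ∈ realization C → total l = 1 → total l' = 1 →
    lc l = lc l' → l = l'

section Complexes

variable {E : Type} [AddCommGroup E] [Module ℝ E] {C : Set (Finset E)}

lemma IsComplex.mem_realization (hC : IsComplex C) {S : Finset E} (hS : S ∈ C) {l : E →₀ ℝ}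
    (h0 : ∀ v, 0 ≤ l v) (hl : l.support ⊆ S) : l ∈ realization C :=
  ⟨h0, hC.mono S hS _ hl⟩

lemma IsComplex.eq_zero (hC : IsComplex C) {S : Finset E} (hS : S ∈ C) {l : E →₀ ℝ}
    (hl : l.support ⊆ S) (ht : total l = 0) (h : lc l = 0) : l = 0 := by
  rcases S.eq_empty_or_nonempty with rfl | hne
  · exact Finsupp.support_eq_empty.1 (Finset.subset_empty.1 hl)
  set M : ℝ := 1 + ∑ v ∈ S, |l v| with hM
  have hM0 : 0 < M := by
    have := Finset.sum_nonneg fun v (_ : v ∈ S) => abs_nonneg (l v)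
    linarith
  have hc : (0 : ℝ) < S.card := by exact_mod_cast hne.card_pos
  set u : E →₀ ℝ := Finsupp.onFinset S (fun v => if v ∈ S then (S.card : ℝ)⁻¹ else 0)
      (fun v hv => by by_contra h; simp [h] at hv) with hu
  have huS : u.support ⊆ S := Finsupp.support_onFinset_subset
  have huv : ∀ v ∈ S, u v = (S.card : ℝ)⁻¹ := fun v hv => by simp [hu, hv]
  have hut : total u = 1 := by
    rw [total_eq_sum u huS, Finset.sum_congr rfl huv, Finset.sum_const, nsmul_eq_mul,
      mul_inv_cancel₀ hc.ne']
  have hu0 : ∀ v, 0 ≤ u v := fun v => by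
    simp only [hu, Finsupp.onFinset_apply]
    split_ifs
    exacts [by positivity, le_rfl]
  have hsupp : (u + (M * S.card)⁻¹ • l).support ⊆ S := by
    refine Finsupp.support_add.trans (Finset.union_subset huS ?_)
    exact Finsupp.support_smul.trans hl
  have key := hC.inj (u + (M * S.card)⁻¹ • l) u (hC.mem_realization hS (fun v => ?_) hsupp)
    (hC.mem_realization hS hu0 huS) (by simp [ht, hut]) hut (by simp [h])
  · rw [add_eq_left, smul_eq_zero] at key
    exact key.resolve_left (by positivity)
  · rw [Finsupp.add_apply, Finsupp.smul_apply, smul_eq_mul]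
    by_cases hv : v ∈ S
    · have h1 : |l v| ≤ M := by
        have := Finset.single_le_sum (f := fun v => |l v|) (fun v _ => abs_nonneg _) hv
        linarith
      have h2 : -M ≤ l v := (abs_le.1 h1).1
      rw [huv v hv, mul_inv]
      have : M⁻¹ * (S.card : ℝ)⁻¹ * -M ≤ M⁻¹ * (S.card : ℝ)⁻¹ * l v :=
        mul_le_mul_of_nonneg_left h2 (by positivity)
      have h3 : M⁻¹ * (S.card : ℝ)⁻¹ * -M = -(S.card : ℝ)⁻¹ := by field_simp
      linarith
    · have : l v = 0 := by
        by_contra h'; exact hv (hl (Finsupp.mem_support_iff.2 h'))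
      simpa [this] using hu0 v

lemma IsComplex.affineIndependent (hC : IsComplex C) {S : Finset E} (hS : S ∈ C) :
    AffineIndependent ℝ (Subtype.val : ↥(S : Set E) → E) := by
  rw [affineIndependent_iff]
  intro s w h1 h2 e he
  set l : E →₀ ℝ := ∑ e ∈ s, Finsupp.single (e : E) (w e) with hl
  have hlS : l.support ⊆ S := by
    intro v hv
    obtain ⟨e, -, h⟩ := Finset.mem_biUnion.1 (Finsupp.support_finsetSum hv)
    have := Finsupp.support_single_subset h
    rw [Finset.mem_singleton] at this
    rw [this]; exact e.2
  have h0 := hC.eq_zero hS hlS (by simp [hl, h1]) (by simpa [hl] using h2)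
  have h3 : l e = w e := by
    rw [hl, Finsupp.finsetSum_apply, Finset.sum_eq_single e]
    · simp
    · intro b _ hb
      rw [Finsupp.single_apply, if_neg fun h => hb (Subtype.ext h)]
    · exact fun h => absurd he h
  rw [← h3, h0, Finsupp.zero_apply]

lemma IsComplex.mem_extremePoints (hC : IsComplex C) {S : Finset E} (hS : S ∈ C) {v : E}
    (hv : v ∈ S) : v ∈ (convexHull ℝ (S : Set E)).extremePoints ℝ := by
  rw [mem_extremePoints_iff_left]
  refine ⟨subset_convexHull ℝ _ hv, fun x hx y hy hxy => ?_⟩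
  obtain ⟨l, l0, lS, l1, rfl⟩ := mem_convexHull_iff_coords.1 hx
  obtain ⟨m, m0, mS, m1, rfl⟩ := mem_convexHull_iff_coords.1 hy
  obtain ⟨a, b, ha, hb, hab, h⟩ := hxy
  have key : a • l + b • m = Finsupp.single v 1 := by
    refine hC.inj _ _ (hC.mem_realization hS (fun w => ?_) ?_)
      (hC.mem_realization hS (single_nonneg_apply v) ?_) (by simp [l1, m1, hab]) (by simp)
      (by simp [h])
    · simpa using add_nonneg (mul_nonneg ha.le (l0 w)) (mul_nonneg hb.le (m0 w))
    · exact Finsupp.support_add.trans (Finset.union_subset (Finsupp.support_smul.trans lS)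
        (Finsupp.support_smul.trans mS))
    · exact Finsupp.support_single_subset.trans (Finset.singleton_subset_iff.2 hv)
  have hl : ∀ w, w ≠ v → l w = 0 := fun w hw => by
    have h1 := DFunLike.congr_fun key w
    simp only [Finsupp.add_apply, Finsupp.smul_apply, smul_eq_mul,
      Finsupp.single_apply, if_neg hw.symm] at h1
    have := mul_nonneg hb.le (m0 w)
    have := mul_nonneg ha.le (l0 w)
    exact (mul_eq_zero.1 (by linarith : a * l w = 0)).resolve_left ha.ne'
  have hlv : l = Finsupp.single v (l v) := by
    ext w
    by_cases hw : w = v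
    · simp [hw]
    · rw [hl w hw, Finsupp.single_apply, if_neg (Ne.symm hw)]
  rw [hlv, total_single] at l1
  rw [hlv, lc_single, l1, one_smul]

lemma IsComplex.convexHull_inter (hC : IsComplex C) {S R : Finset E} (hS : S ∈ C) (hR : R ∈ C) :
    convexHull ℝ (S : Set E) ∩ convexHull ℝ (R : Set E) =
      convexHull ℝ ((S ∩ R : Finset E) : Set E) := by
  refine Set.Subset.antisymm ?_ (Set.subset_inter (convexHull_mono (by simp))
    (convexHull_mono (by simp)))
  rintro x ⟨hx, hy⟩
  obtain ⟨l, l0, lS, l1, rfl⟩ := mem_convexHull_iff_coords.1 hx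
  obtain ⟨m, m0, mS, m1, h⟩ := mem_convexHull_iff_coords.1 hy
  have := hC.inj l m (hC.mem_realization hS l0 lS) (hC.mem_realization hR m0 mS) l1 m1 h.symm
  exact mem_convexHull_iff_coords.2 ⟨l, l0, Finset.subset_inter lS (this ▸ mS), l1, rfl⟩

/-- Every vertex subset of a simplex is cut out by a supporting hyperplane. -/
lemma IsComplex.exists_supporting (hC : IsComplex C) {S : Finset E} (hS : S ∈ C) (R : Finset E) :
    ∃ (φ : E →ₗ[ℝ] ℝ) (m : ℝ), (∀ v ∈ S, v ∈ R → φ v = m) ∧ ∀ v ∈ S, v ∉ R → φ v < m := by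
  have hli : LinearIndepOn ℝ (fun v : E => (v, (1 : ℝ))) (S : Set E) := by
    rw [linearIndepOn_iff]
    intro l hl h
    rw [Finsupp.mem_supported] at hl
    have hl' : l.support ⊆ S := by exact_mod_cast hl
    have h1 : (lc l, total l) = 0 := by
      rw [← h, lc_support_eq_sum l hl', total_eq_sum l hl', Finsupp.linearCombination_apply,
        Finsupp.sum_of_support_subset l hl' _ (by simp)]
      ext <;> simp [Prod.fst_sum, Prod.snd_sum]
    exact hC.eq_zero hS hl' (Prod.ext_iff.1 h1).2 (Prod.ext_iff.1 h1).1
  have hli' : LinearIndependent ℝ (fun v : (S : Set E) => ((v : E), (1 : ℝ))) := hli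
  obtain ⟨g, hg⟩ := LinearMap.exists_extend
    ((Finsupp.linearCombination ℝ fun v : (S : Set E) => if (v : E) ∈ R then (0 : ℝ) else -1) ∘ₗ
      hli'.repr)
  have hg' : ∀ v (hv : v ∈ S), g (v, 1) = if v ∈ R then (0 : ℝ) else -1 := by
    intro v hv
    have hm : ((v, (1 : ℝ)) : E × ℝ) ∈ Submodule.span ℝ
        (Set.range fun v : (S : Set E) => ((v : E), (1 : ℝ))) :=
      Submodule.subset_span ⟨⟨v, hv⟩, rfl⟩
    have h1 := LinearMap.congr_fun hg ⟨_, hm⟩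
    have h2 : hli'.repr ⟨_, hm⟩ = Finsupp.single ⟨v, hv⟩ 1 := hli'.repr_eq_single ⟨v, hv⟩ _ rfl
    simp only [LinearMap.comp_apply, Submodule.subtype_apply, h2,
      Finsupp.linearCombination_single, one_smul] at h1
    exact h1
  have hs : ∀ v : E, g (v, 1) = g (v, 0) + g (0, 1) := fun v => by rw [← map_add]; simp
  refine ⟨g ∘ₗ LinearMap.inl ℝ E ℝ, -g (0, 1), fun v hv hR => ?_, fun v hv hR => ?_⟩
  · have := hg' v hv
    rw [if_pos hR, hs] at this
    simp only [LinearMap.comp_apply, LinearMap.inl_apply]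
    linarith
  · have := hg' v hv
    rw [if_neg hR, hs] at this
    simp only [LinearMap.comp_apply, LinearMap.inl_apply]
    linarith

end Complexes

lemma setOf_isMax_convexHull {S : Finset (Fin d → ℝ)} (φ : (Fin d → ℝ) →ₗ[ℝ] ℝ) {m : ℝ}
    (hm : ∀ v ∈ S, φ v ≤ m) (hex : ∃ v ∈ S, φ v = m) :
    {x ∈ convexHull ℝ (S : Set (Fin d → ℝ)) | ∀ y ∈ convexHull ℝ (S : Set (Fin d → ℝ)), φ y ≤ φ x} =
      convexHull ℝ ((S.filter fun v => φ v = m : Finset _) : Set (Fin d → ℝ)) := by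
  have hle : ∀ l : (Fin d → ℝ) →₀ ℝ, l.support ⊆ S → total l = 1 →
      m - φ (lc l) = ∑ v ∈ S, l v * (m - φ v) := by
    intro l lS l1
    rw [map_lc_eq_sum φ l lS]
    simp only [mul_sub, Finset.sum_sub_distrib, ← Finset.sum_mul, ← total_eq_sum l lS, l1, one_mul,
      smul_eq_mul]
  have hmax : ∀ y ∈ convexHull ℝ (S : Set (Fin d → ℝ)), φ y ≤ m := by
    intro y hy
    obtain ⟨l, l0, lS, l1, rfl⟩ := mem_convexHull_iff_coords.1 hy
    have := hle l lS l1
    have h2 := Finset.sum_nonneg fun v (hv : v ∈ S) =>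
      mul_nonneg (l0 v) (sub_nonneg.2 (hm v hv))
    linarith
  ext x
  constructor
  · rintro ⟨hx, hx'⟩
    obtain ⟨l, l0, lS, l1, rfl⟩ := mem_convexHull_iff_coords.1 hx
    obtain ⟨v, hv, hvm⟩ := hex
    have h1 : m ≤ φ (lc l) := hvm ▸ hx' v (subset_convexHull ℝ _ hv)
    have h2 : ∑ v ∈ S, l v * (m - φ v) = 0 := by
      rw [← hle l lS l1]; linarith [hmax _ hx]
    rw [Finset.sum_eq_zero_iff_of_nonneg fun v hv =>
      mul_nonneg (l0 v) (sub_nonneg.2 (hm v hv))] at h2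
    refine mem_convexHull_iff_coords.2 ⟨l, l0, fun w hw => ?_, l1, rfl⟩
    have h3 := (mul_eq_zero.1 (h2 w (lS hw))).resolve_left (Finsupp.mem_support_iff.1 hw)
    exact Finset.mem_filter.2 ⟨lS hw, by linarith⟩
  · intro hx
    obtain ⟨l, l0, lS, l1, rfl⟩ := mem_convexHull_iff_coords.1 hx
    have lS' := lS.trans (Finset.filter_subset _ _)
    have h1 : φ (lc l) = m := by
      rw [map_lc_eq_sum φ l lS, Finset.sum_congr rfl fun v hv => by
        rw [(Finset.mem_filter.1 hv).2], ← Finset.sum_smul, ← total_eq_sum l lS, l1, one_smul]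
    exact ⟨mem_convexHull_iff_coords.2 ⟨l, l0, lS', l1, rfl⟩, fun y hy => h1 ▸ hmax y hy⟩

lemma IsComplex.isFaceOf {C : Set (Finset (Fin d → ℝ))} (hC : IsComplex C)
    {S R : Finset (Fin d → ℝ)} (hS : S ∈ C) (hRS : R ⊆ S) (hR : R.Nonempty) :
    IsFaceOf (convexHull ℝ (R : Set (Fin d → ℝ))) (convexHull ℝ (S : Set (Fin d → ℝ))) := by
  obtain ⟨φ, m, h1, h2⟩ := hC.exists_supporting hS R
  refine ⟨by simpa using hR, φ, ?_⟩
  rw [setOf_isMax_convexHull φ (m := m)]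
  · congr 2
    ext v
    rw [Finset.mem_filter]
    refine ⟨fun hv => ⟨hRS hv, h1 v (hRS hv) hv⟩, fun hv => ?_⟩
    by_contra h
    exact (h2 v hv.1 h).ne hv.2
  · intro v hv
    by_cases h : v ∈ R
    exacts [(h1 v hv h).le, (h2 v hv h).le]
  · obtain ⟨v, hv⟩ := hR
    exact ⟨v, hRS hv, h1 v (hRS hv) hv⟩

lemma exists_of_isFaceOf {S : Finset (Fin d → ℝ)} {F : Set (Fin d → ℝ)}
    (h : IsFaceOf F (convexHull ℝ (S : Set (Fin d → ℝ)))) :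
    ∃ R ⊆ S, R.Nonempty ∧ F = convexHull ℝ (R : Set (Fin d → ℝ)) := by
  obtain ⟨⟨x, hx⟩, φ, rfl⟩ := h
  have hne : S.Nonempty := by
    have := convexHull_nonempty_iff.1 ⟨x, hx.1⟩
    exact_mod_cast this
  obtain ⟨v, hv, hmax⟩ := Finset.exists_max_image S φ hne
  exact ⟨S.filter fun w => φ w = φ v, Finset.filter_subset _ _,
    ⟨v, Finset.mem_filter.2 ⟨hv, rfl⟩⟩, setOf_isMax_convexHull φ hmax ⟨v, hv, rfl⟩⟩

lemma IsComplex.polyIndex_eq_one {C : Set (Finset (Fin d → ℝ))} (hC : IsComplex C)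
    {S : Finset (Fin d → ℝ)} (hS : S ∈ C) (hne : S.Nonempty)
    (hmult : ∀ l : (Fin d → ℝ) →₀ ℝ, l.support ⊆ S → total l = 0 → IsLatticePt (lc l) →
      ∀ v, ∃ z : ℤ, l v = z) :
    polyIndex (convexHull ℝ (S : Set (Fin d → ℝ))) = 1 := by
  rw [polyIndex, AddSubgroup.index_eq_one, AddSubgroup.addSubgroupOf_eq_top]
  rintro x ⟨hx, hxl⟩
  obtain ⟨v₀, hv₀⟩ := hne
  have hspan : Submodule.span ℝ (vertexDiffs (convexHull ℝ (S : Set (Fin d → ℝ)))) ≤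
      Submodule.map lc (Finsupp.supported ℝ ℝ (S : Set (Fin d → ℝ)) ⊓ LinearMap.ker total) := by
    rw [Submodule.span_le]
    rintro _ ⟨u, hu, v, hv, rfl⟩
    have hu : u ∈ S := extremePoints_convexHull_subset hu
    have hv : v ∈ S := extremePoints_convexHull_subset hv
    refine ⟨Finsupp.single u 1 - Finsupp.single v 1, ⟨?_, by simp⟩, by simp⟩
    exact Submodule.sub_mem _ (Finsupp.single_mem_supported ℝ _ hu)
      (Finsupp.single_mem_supported ℝ _ hv)
  obtain ⟨l, ⟨lS, lt⟩, rfl⟩ := hspan hx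
  have lS : l.support ⊆ S := by
    have := (Finsupp.mem_supported _ _).1 lS
    exact_mod_cast this
  have lt : total l = 0 := lt
  choose z hz using hmult l lS lt hxl
  have h1 : lc l = ∑ v ∈ S, z v • (v - v₀) := by
    have h2 : ∑ v ∈ S, l v • v₀ = 0 := by
      rw [← Finset.sum_smul, ← total_eq_sum l lS, lt, zero_smul]
    rw [lc_support_eq_sum l lS, ← sub_zero (∑ v ∈ S, l v • v), ← h2, ← Finset.sum_sub_distrib]
    refine Finset.sum_congr rfl fun v _ => ?_
    rw [← smul_sub, hz v, Int.cast_smul_eq_zsmul]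
  rw [h1]
  refine AddSubgroup.sum_mem _ fun v hv => AddSubgroup.zsmul_mem _ (AddSubgroup.subset_closure ?_) _
  exact ⟨v, hC.mem_extremePoints hS hv, v₀, hC.mem_extremePoints hS hv₀, rfl⟩

/-- The simplices of a complex of unimodular lattice simplices form a unimodular triangulation. -/
lemma IsComplex.isUnimodularTriangulation {C : Set (Finset (Fin d → ℝ))} (hC : IsComplex C)
    (hlat : ∀ S ∈ C, ∀ v ∈ S, IsLatticePt v)
    (hmult : ∀ S ∈ C, ∀ l : (Fin d → ℝ) →₀ ℝ, l.support ⊆ S → total l = 0 → IsLatticePt (lc l) →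
      ∀ v, ∃ z : ℤ, l v = z) :
    IsUnimodularTriangulation
      ((fun S : Finset (Fin d → ℝ) => convexHull ℝ (S : Set (Fin d → ℝ))) '' {S ∈ C | S.Nonempty})
      {x | ∃ l ∈ realization C, total l = 1 ∧ lc l = x} := by
  refine ⟨⟨(hC.finite.subset fun S hS => hS.1).image _, ?_, ?_, ?_, ?_⟩, ?_⟩
  · rintro _ ⟨S, ⟨hS, hne⟩, rfl⟩
    exact ⟨S, hne, hC.affineIndependent hS, rfl⟩
  · ext x
    constructor
    · rintro ⟨_, ⟨S, ⟨hS, hne⟩, rfl⟩, hx⟩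
      obtain ⟨l, l0, lS, l1, rfl⟩ := mem_convexHull_iff_coords.1 hx
      exact ⟨l, hC.mem_realization hS l0 lS, l1, rfl⟩
    · rintro ⟨l, ⟨l0, lS⟩, l1, rfl⟩
      refine ⟨_, ⟨l.support, ⟨lS, ?_⟩, rfl⟩, mem_convexHull_iff_coords.2 ⟨l, l0, subset_rfl, l1, rfl⟩⟩
      rw [Finset.nonempty_iff_ne_empty, Ne, Finsupp.support_eq_empty]
      rintro rfl
      simp at l1
  · rintro _ ⟨S, ⟨hS, hne⟩, rfl⟩ F hF
    obtain ⟨R, hRS, hR, rfl⟩ := exists_of_isFaceOf hF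
    exact ⟨R, ⟨hC.mono S hS R hRS, hR⟩, rfl⟩
  · rintro _ ⟨S, ⟨hS, hne⟩, rfl⟩ _ ⟨R, ⟨hR, hne'⟩, rfl⟩
    simp only [hC.convexHull_inter hS hR]
    rcases (S ∩ R).eq_empty_or_nonempty with h | h
    · left; simp [h]
    · exact Or.inr ⟨hC.isFaceOf hS Finset.inter_subset_left h,
        hC.isFaceOf hR Finset.inter_subset_right h⟩
  · rintro _ ⟨S, ⟨hS, hne⟩, rfl⟩
    exact ⟨⟨S, hne, hlat S hS, hC.affineIndependent hS, rfl⟩,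
      hC.polyIndex_eq_one hS hne (hmult S hS)⟩

end Triangulations

section LargeDilates

open Classical

variable {d : ℕ}

noncomputable local instance decidableEqVec' : DecidableEq (Fin d → ℝ) :=
  fun a b => Classical.propDecidable (a = b)

noncomputable local instance decidableEqVecProd : DecidableEq ((Fin d → ℝ) × ℝ) :=
  fun a b => Classical.propDecidable (a = b)

/-- The lattice of integral points of `ℝ^d × ℝ`. -/
def prodLattice (d : ℕ) : AddSubgroup ((Fin d → ℝ) × ℝ) :=
  (intLattice d).prod (AddSubgroup.zmultiples 1)

lemma mem_prodLattice {x : (Fin d → ℝ) × ℝ} :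
    x ∈ prodLattice d ↔ IsLatticePt x.1 ∧ ∃ z : ℤ, x.2 = z := by
  rw [prodLattice, AddSubgroup.mem_prod, AddSubgroup.mem_zmultiples_iff]
  refine and_congr Iff.rfl (exists_congr fun z => ?_)
  rw [zsmul_one, eq_comm]

lemma hasIntCoords_prodLattice : HasIntCoords (prodLattice d) := by
  refine ⟨Option (Fin d), inferInstance, LinearMap.pi fun i => i.elim
    (LinearMap.snd ℝ (Fin d → ℝ) ℝ)
    fun j => (LinearMap.proj j : (Fin d → ℝ) →ₗ[ℝ] ℝ) ∘ₗ LinearMap.fst ℝ (Fin d → ℝ) ℝ, ?_, ?_⟩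
  · intro x y h
    refine Prod.ext (funext fun j => ?_) ?_
    · exact congrFun h (some j)
    · exact congrFun h none
  · intro x hx i
    obtain ⟨h1, h2⟩ := mem_prodLattice.1 hx
    cases i with
    | none => exact h2
    | some j => exact h1 j

/-- Slicing a dilate fan at its height gives a unimodular triangulation of the dilated polytope. -/
lemma IsDilateFan.exists_isUnimodularTriangulation {V : Finset (Fin d → ℝ)} {n : ℕ} (hn : 0 < n)
    {K : Set (Finset ((Fin d → ℝ) × ℝ))}
    (hK : IsDilateFan (prodLattice d) (LinearMap.snd ℝ (Fin d → ℝ) ℝ)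
      (V.image fun v => (v, (1 : ℝ))) n K) :
    ∃ T : Set (Set (Fin d → ℝ)),
      IsUnimodularTriangulation T ((n : ℝ) • convexHull ℝ (V : Set (Fin d → ℝ))) := by
  have hn0 : (0 : ℝ) < n := by exact_mod_cast hn
  set j : (Fin d → ℝ) → (Fin d → ℝ) × ℝ := fun u => (u, (n : ℝ)) with hj
  have hji : Function.Injective j := fun a b h => (Prod.ext_iff.1 h).1
  set C : Set (Finset (Fin d → ℝ)) := {R | R.image j ∈ K} with hC
  have hlc : ∀ l : (Fin d → ℝ) →₀ ℝ, lc (l.mapDomain j) = (lc l, n * total l) := by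
    intro l
    induction l using Finsupp.induction_linear with
    | zero => simp [Prod.ext_iff]
    | add f g hf hg => simp [Finsupp.mapDomain_add, hf, hg, mul_add]
    | single v t => simp [Finsupp.mapDomain_single, hj, mul_comm]
  have hreal : ∀ l : (Fin d → ℝ) →₀ ℝ, l ∈ realization C ↔ l.mapDomain j ∈ realization K := by
    intro l
    refine and_congr ⟨fun h w => ?_, fun h v => ?_⟩ ?_
    · by_cases hw : w ∈ Set.range j
      · obtain ⟨v, rfl⟩ := hw
        rw [Finsupp.mapDomain_apply hji]; exact h v
      · rw [Finsupp.mapDomain_of_notMem_range _ _ hw]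
    · rw [← Finsupp.mapDomain_apply hji l v]; exact h _
    · rw [Finsupp.mapDomain_support_of_injective hji]; rfl
  have hcomplex : IsComplex C := by
    refine ⟨hK.fan.finite.preimage (Finset.image_injective hji).injOn,
      fun S hS R hR => hK.fan.mono _ hS _ (Finset.image_subset_image hR), ?_⟩
    intro l l' hl hl' h1 h2 h
    refine Finsupp.mapDomain_injective hji (hK.fan.inj ((hreal l).1 hl) ((hreal l').1 hl') ?_)
    rw [hlc, hlc, h, h1, h2]
  have hvert : ∀ S ∈ K, ∀ w ∈ S, {w} ∈ K := fun S hS w hw =>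
    hK.fan.mono S hS _ (Finset.singleton_subset_iff.2 hw)
  have key := hcomplex.isUnimodularTriangulation (fun S hS v hv => ?_) (fun S hS l lS lt hlat v => ?_)
  · suffices h : (n : ℝ) • convexHull ℝ (V : Set (Fin d → ℝ)) =
        {x | ∃ l ∈ realization C, total l = 1 ∧ lc l = x} from ⟨_, h ▸ key⟩
    ext x
    rw [Set.mem_smul_set_iff_inv_smul_mem₀ hn0.ne', mem_convexHull_iff_coords]
    have h1 : (∃ l ∈ realization C, total l = 1 ∧ lc l = x) ↔ (x, (n : ℝ)) ∈ spt K := by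
      constructor
      · rintro ⟨l, hl, ht, rfl⟩
        exact ⟨_, (hreal l).1 hl, by rw [hlc, ht, mul_one]⟩
      · rintro ⟨m, hm, h⟩
        have hmj : (m.mapDomain Prod.fst).mapDomain j = m := by
          rw [← Finsupp.mapDomain_comp]
          conv_rhs => rw [← Finsupp.mapDomain_id (v := m)]
          refine Finsupp.mapDomain_congr fun w hw => ?_
          exact Prod.ext rfl (hK.height w (hvert _ hm.2 w hw)).symm
        rw [← hmj, hlc, Prod.mk.injEq] at h
        refine ⟨m.mapDomain Prod.fst, (hreal _).2 (by rwa [hmj]), ?_, h.1⟩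
        exact mul_left_cancel₀ hn0.ne' (by rw [h.2, mul_one])
    show _ ↔ ∃ l ∈ realization C, total l = 1 ∧ lc l = x
    rw [h1, hK.spt_eq]
    have hi : Function.Injective fun v : Fin d → ℝ => (v, (1 : ℝ)) :=
      fun a b h => (Prod.ext_iff.1 h).1
    have hlc' : ∀ l : (Fin d → ℝ) →₀ ℝ,
        lc (l.mapDomain fun v => (v, (1 : ℝ))) = (lc l, total l) := by
      intro l
      induction l using Finsupp.induction_linear with
      | zero => simp [Prod.ext_iff]
      | add f g hf hg => simp [Finsupp.mapDomain_add, hf, hg]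
      | single v t => simp [Finsupp.mapDomain_single]
    constructor
    · rintro ⟨l, l0, lV, l1, hx⟩
      have h2 : ((n : ℝ)⁻¹ • x, (1 : ℝ)) ∈ coneHull (V.image fun v => (v, (1 : ℝ))) := by
        refine ⟨l.mapDomain fun v => (v, (1 : ℝ)), fun w => ?_, ?_, by rw [hlc', l1, hx]⟩
        · by_cases hw : w ∈ Set.range fun v : Fin d → ℝ => (v, (1 : ℝ))
          · obtain ⟨v, rfl⟩ := hw
            rw [Finsupp.mapDomain_apply hi l v]; exact l0 v
          · rw [Finsupp.mapDomain_of_notMem_range _ _ hw]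
        · rw [Finsupp.mapDomain_support_of_injective hi]
          exact Finset.image_subset_image lV
      have h3 := coneHull_smul hn0.le h2
      rwa [Prod.smul_mk, smul_inv_smul₀ hn0.ne', smul_eq_mul, mul_one] at h3
    · intro hx
      obtain ⟨m, m0, mV, h⟩ := coneHull_smul (inv_nonneg.2 hn0.le) hx
      rw [Prod.smul_mk, smul_eq_mul, inv_mul_cancel₀ hn0.ne'] at h
      have hsm : ∀ w ∈ m.support, w.1 ∈ V ∧ w.2 = 1 := by
        intro w hw
        obtain ⟨v, hv, rfl⟩ := Finset.mem_image.1 (mV hw)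
        exact ⟨hv, rfl⟩
      have hmj : (m.mapDomain Prod.fst).mapDomain (fun v => (v, (1 : ℝ))) = m := by
        rw [← Finsupp.mapDomain_comp]
        conv_rhs => rw [← Finsupp.mapDomain_id (v := m)]
        exact Finsupp.mapDomain_congr fun w hw => Prod.ext rfl (hsm w hw).2.symm
      rw [← hmj, hlc', Prod.mk.injEq] at h
      refine ⟨m.mapDomain Prod.fst, fun v => ?_, ?_, h.2, h.1⟩
      · rw [← Finsupp.mapDomain_apply hi (m.mapDomain Prod.fst) v, hmj]; exact m0 _
      · refine Finsupp.mapDomain_support.trans fun v hv => ?_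
        obtain ⟨w, hw, rfl⟩ := Finset.mem_image.1 hv
        exact (hsm w hw).1
  · exact (mem_prodLattice.1 (hK.mem _ (hvert _ hS (j v) (Finset.mem_image_of_mem j hv)))).1
  · have h1 := hK.mult _ hS (l.mapDomain j)
      (by rw [Finsupp.mapDomain_support_of_injective hji]; exact Finset.image_subset_image lS)
      ⟨?_, 0, ?_⟩ (j v)
    · obtain ⟨z, hz⟩ := h1
      exact ⟨z, by rwa [Finsupp.mapDomain_apply hji, Nat.cast_one, one_mul] at hz⟩
    · rw [hlc, lt, mul_zero]
      exact mem_prodLattice.2 ⟨hlat, 0, by simp⟩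
    · rw [hlc, lt]; simp

/-- All sufficiently large dilates of an integral polytope have unimodular triangulations. -/
theorem exists_isUnimodularTriangulation_of_ge {P : Set (Fin d → ℝ)} (hP : IsIntegralPolytope P) :
    ∃ n₀ : ℕ, ∀ n ≥ n₀, 0 < n → ∃ T : Set (Set (Fin d → ℝ)),
      IsUnimodularTriangulation T ((n : ℝ) • P) := by
  obtain ⟨V, -, hV, rfl⟩ := hP
  have h1 : ∀ w ∈ V.image (fun v => (v, (1 : ℝ))), w ∈ prodLattice d := by
    intro w hw
    obtain ⟨v, hv, rfl⟩ := Finset.mem_image.1 hw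
    exact mem_prodLattice.2 ⟨hV v hv, 1, by simp⟩
  have h2 : ∀ w ∈ V.image (fun v => (v, (1 : ℝ))), LinearMap.snd ℝ (Fin d → ℝ) ℝ w = 1 := by
    intro w hw
    obtain ⟨v, hv, rfl⟩ := Finset.mem_image.1 hw
    rfl
  obtain ⟨n₀, h⟩ := exists_isDilateFan_of_ge hasIntCoords_prodLattice
    (fun x hx => (mem_prodLattice.1 hx).2) h1 h2
  refine ⟨n₀, fun n hn hn0 => ?_⟩
  obtain ⟨K, hK⟩ := h n hn
  exact hK.exists_isUnimodularTriangulation hn0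

end LargeDilates

section Segments

open Classical

noncomputable local instance decidableEqVec'' {d : ℕ} : DecidableEq (Fin d → ℝ) :=
  fun a b => Classical.propDecidable (a = b)

/-- The integral point `z` of the line. -/
def linePt (z : ℤ) : Fin 1 → ℝ := fun _ => z

lemma linePt_injective : Function.Injective linePt := fun a b h => by
  have := congrFun h 0
  exact Int.cast_injective (α := ℝ) this

lemma total_eq_of_subset_pair {i : ℤ} {l : (Fin 1 → ℝ) →₀ ℝ}
    (h : l.support ⊆ {linePt i, linePt (i + 1)}) :
    total l = l (linePt i) + l (linePt (i + 1)) := by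
  rw [total_eq_sum l h, Finset.sum_pair fun h => by have := linePt_injective h; omega]

lemma lc_eq_of_subset_pair {i : ℤ} {l : (Fin 1 → ℝ) →₀ ℝ}
    (h : l.support ⊆ {linePt i, linePt (i + 1)}) :
    lc l 0 = i * total l + l (linePt (i + 1)) := by
  rw [total_eq_of_subset_pair h, lc_support_eq_sum l h,
    Finset.sum_pair fun h => by have := linePt_injective h; omega]
  simp only [linePt, Pi.add_apply, Pi.smul_apply, smul_eq_mul]
  push_cast
  ring

/-- Barycentric coordinates in the subdivision of the line are given by hat functions. -/
lemma apply_linePt_eq {i : ℤ} {l : (Fin 1 → ℝ) →₀ ℝ} (h0 : ∀ v, 0 ≤ l v)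
    (h : l.support ⊆ {linePt i, linePt (i + 1)}) (h1 : total l = 1) (z : ℤ) :
    l (linePt z) = max 0 (1 - |lc l 0 - z|) := by
  have ht := total_eq_of_subset_pair h
  have hx := lc_eq_of_subset_pair h
  have h2 := h0 (linePt i)
  have h3 := h0 (linePt (i + 1))
  rw [h1] at ht hx
  rw [mul_one] at hx
  by_cases hz : z = i
  · subst hz
    rw [hx, add_sub_cancel_left, abs_of_nonneg h3, max_eq_right] <;> linarith
  by_cases hz' : z = i + 1
  · subst hz'
    rw [abs_of_nonpos (by push_cast; linarith), max_eq_right] <;> push_cast <;> linarith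
  have hl : l (linePt z) = 0 := by
    by_contra hl
    have := h (Finsupp.mem_support_iff.2 hl)
    rw [Finset.mem_insert, Finset.mem_singleton] at this
    rcases this with h | h
    exacts [hz (linePt_injective h), hz' (linePt_injective h)]
  rw [hl, max_eq_left]
  rcases lt_or_gt_of_ne hz with h | h
  · have : (z : ℝ) + 1 ≤ i := by exact_mod_cast h
    linarith [le_abs_self (lc l 0 - z)]
  · have : (i : ℝ) + 2 ≤ z := by exact_mod_cast (by omega : i + 2 ≤ z)
    linarith [neg_le_abs (lc l 0 - z)]

/-- Lattice segments have unimodular triangulations. -/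
lemma exists_isUnimodularTriangulation_segment (a b : ℤ) :
    ∃ T : Set (Set (Fin 1 → ℝ)),
      IsUnimodularTriangulation T {x : Fin 1 → ℝ | (a : ℝ) ≤ x 0 ∧ x 0 ≤ b} := by
  set C : Set (Finset (Fin 1 → ℝ)) := {R | (∃ i : ℤ, R ⊆ {linePt i, linePt (i + 1)}) ∧
    ∀ v ∈ R, (a : ℝ) ≤ v 0 ∧ v 0 ≤ b} with hC
  have hlat : ∀ S ∈ C, ∀ v ∈ S, ∃ z : ℤ, v = linePt z := by
    rintro S ⟨⟨i, hi⟩, -⟩ v hv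
    have := hi hv
    rw [Finset.mem_insert, Finset.mem_singleton] at this
    rcases this with rfl | rfl
    exacts [⟨_, rfl⟩, ⟨_, rfl⟩]
  have hcomplex : IsComplex C := by
    refine ⟨?_, fun S hS R hR => ⟨hS.1.imp fun i hi => hR.trans hi, fun v hv => hS.2 v (hR hv)⟩, ?_⟩
    · refine ((Finset.Icc a b).image linePt).powerset.finite_toSet.subset fun S hS => ?_
      rw [Finset.mem_coe, Finset.mem_powerset]
      intro v hv
      obtain ⟨z, rfl⟩ := hlat S hS v hv
      have : (a : ℝ) ≤ z ∧ (z : ℝ) ≤ b := hS.2 _ hv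
      refine Finset.mem_image_of_mem _ (Finset.mem_Icc.2 ?_)
      exact_mod_cast this
    · rintro l l' ⟨h0, hl⟩ ⟨h0', hl'⟩ h1 h1' h
      obtain ⟨i, hi⟩ := hl.1
      obtain ⟨i', hi'⟩ := hl'.1
      ext v
      by_cases hv : ∃ z, v = linePt z
      · obtain ⟨z, rfl⟩ := hv
        rw [apply_linePt_eq h0 hi h1, apply_linePt_eq h0' hi' h1', h]
      · have h2 : l v = 0 := by
          by_contra h; exact hv (hlat _ hl v (Finsupp.mem_support_iff.2 h))
        have h3 : l' v = 0 := by
          by_contra h; exact hv (hlat _ hl' v (Finsupp.mem_support_iff.2 h))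
        rw [h2, h3]
  have key := hcomplex.isUnimodularTriangulation (fun S hS v hv => ?_) (fun S hS l lS lt hlt v => ?_)
  · suffices h : {x : Fin 1 → ℝ | (a : ℝ) ≤ x 0 ∧ x 0 ≤ b} =
        {x | ∃ l ∈ realization C, total l = 1 ∧ lc l = x} from ⟨_, h ▸ key⟩
    ext x
    constructor
    · rintro ⟨hax, hxb⟩
      set i : ℤ := ⌊x 0⌋ with hi
      set t : ℝ := Int.fract (x 0) with ht
      have hxt : x 0 = i + t := (Int.floor_add_fract _).symm
      have t0 : 0 ≤ t := Int.fract_nonneg _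
      have t1 : t < 1 := Int.fract_lt_one _
      have hai : a ≤ i := Int.le_floor.2 hax
      set l : (Fin 1 → ℝ) →₀ ℝ :=
        Finsupp.single (linePt i) (1 - t) + Finsupp.single (linePt (i + 1)) t with hl
      have hsupp : l.support ⊆ {linePt i, linePt (i + 1)} := by
        refine Finsupp.support_add.trans (Finset.union_subset ?_ ?_)
        · exact Finsupp.support_single_subset.trans (by simp)
        · exact Finsupp.support_single_subset.trans (by simp)
      refine ⟨l, ⟨fun v => ?_, ⟨i, hsupp⟩, fun v hv => ?_⟩, by simp [hl], ?_⟩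
      · rw [hl, Finsupp.add_apply, Finsupp.single_apply, Finsupp.single_apply]
        split_ifs <;> linarith
      · have h1 : (a : ℝ) ≤ i := by exact_mod_cast hai
        have h2 := hsupp hv
        rw [Finset.mem_insert, Finset.mem_singleton] at h2
        rcases h2 with rfl | rfl
        · exact ⟨h1, by simp only [linePt]; linarith⟩
        · refine ⟨by simp only [linePt]; push_cast; linarith, ?_⟩
          have hne : linePt i ≠ linePt (i + 1) := fun h => by have := linePt_injective h; omega
          have h3 : t ≠ 0 := by
            intro h3
            rw [Finsupp.mem_support_iff, hl, h3, Finsupp.add_apply, Finsupp.single_apply,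
              if_neg hne] at hv
            simp at hv
          have h4 : (i : ℝ) < b := by
            have := lt_of_le_of_ne t0 h3.symm
            linarith
          have h5 : i + 1 ≤ b := by exact_mod_cast h4
          simp only [linePt]
          exact_mod_cast h5
      · ext k
        rw [Subsingleton.elim k 0, lc_eq_of_subset_pair hsupp]
        have hne : linePt i ≠ linePt (i + 1) := fun h => by have := linePt_injective h; omega
        have : l (linePt (i + 1)) = t := by
          rw [hl, Finsupp.add_apply, Finsupp.single_apply, if_neg hne, Finsupp.single_eq_same,
            zero_add]
        rw [this, hxt]
        simp [hl]
    · rintro ⟨l, ⟨h0, hl⟩, h1, rfl⟩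
      have h2 : lc l 0 = ∑ v ∈ l.support, l v * v 0 := by
        rw [lc_support_eq_sum l subset_rfl]; simp
      have h3 := total_eq_sum l subset_rfl
      rw [h1] at h3
      constructor
      · calc (a : ℝ) = ∑ v ∈ l.support, l v * a := by rw [← Finset.sum_mul, ← h3, one_mul]
          _ ≤ _ := by
            rw [h2]
            exact Finset.sum_le_sum fun v hv => mul_le_mul_of_nonneg_left (hl.2 v hv).1 (h0 v)
      · calc lc l 0 ≤ ∑ v ∈ l.support, l v * b := by
              rw [h2]
              exact Finset.sum_le_sum fun v hv => mul_le_mul_of_nonneg_left (hl.2 v hv).2 (h0 v)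
          _ = b := by rw [← Finset.sum_mul, ← h3, one_mul]
  · obtain ⟨z, rfl⟩ := hlat S hS v hv
    exact fun _ => ⟨z, rfl⟩
  · obtain ⟨i, hi⟩ := hS.1
    have hi := lS.trans hi
    obtain ⟨z, hz⟩ := hlt 0
    rw [lc_eq_of_subset_pair hi, lt, mul_zero, zero_add] at hz
    rw [total_eq_of_subset_pair hi, hz] at lt
    by_cases hv : v = linePt i
    · exact ⟨-z, by rw [hv]; push_cast; linarith⟩
    by_cases hv' : v = linePt (i + 1)
    · exact ⟨z, by rw [hv', hz]⟩
    refine ⟨0, ?_⟩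
    by_contra h
    rw [Int.cast_zero] at h
    have := hi (Finsupp.mem_support_iff.2 h)
    simp [hv, hv'] at this

/-- One-dimensional integral polytopes are lattice segments. -/
lemma IsIntegralPolytope.eq_segment {P : Set (Fin 1 → ℝ)} (hP : IsIntegralPolytope P) :
    ∃ a b : ℤ, P = {x : Fin 1 → ℝ | (a : ℝ) ≤ x 0 ∧ x 0 ≤ b} := by
  obtain ⟨V, hne, hV, rfl⟩ := hP
  obtain ⟨u, hu, hmin⟩ := Finset.exists_min_image V (fun v => v 0) hne
  obtain ⟨w, hw, hmax⟩ := Finset.exists_max_image V (fun v => v 0) hne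
  obtain ⟨a, ha⟩ := hV u hu 0
  obtain ⟨b, hb⟩ := hV w hw 0
  refine ⟨a, b, Set.Subset.antisymm ?_ ?_⟩
  · intro x hx
    obtain ⟨l, h0, hl, h1, rfl⟩ := mem_convexHull_iff_coords.1 hx
    have h2 : lc l 0 = ∑ v ∈ V, l v * v 0 := by
      rw [lc_support_eq_sum l hl]; simp
    have h3 := total_eq_sum l hl
    rw [h1] at h3
    rw [← ha, ← hb]
    constructor
    · calc u 0 = ∑ v ∈ V, l v * u 0 := by rw [← Finset.sum_mul, ← h3, one_mul]
        _ ≤ _ := by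
          rw [h2]
          exact Finset.sum_le_sum fun v hv => mul_le_mul_of_nonneg_left (hmin v hv) (h0 v)
    · calc lc l 0 ≤ ∑ v ∈ V, l v * w 0 := by
            rw [h2]
            exact Finset.sum_le_sum fun v hv => mul_le_mul_of_nonneg_left (hmax v hv) (h0 v)
        _ = w 0 := by rw [← Finset.sum_mul, ← h3, one_mul]
  · rintro x ⟨h1, h2⟩
    rw [← ha] at h1
    rw [← hb] at h2
    refine segment_subset_convexHull hu hw ?_
    have h3 : x 0 ∈ segment ℝ (u 0) (w 0) := by
      rw [segment_eq_Icc (h1.trans h2)]; exact ⟨h1, h2⟩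
    obtain ⟨p, q, hp, hq, hpq, h⟩ := h3
    refine ⟨p, q, hp, hq, hpq, funext fun k => ?_⟩
    rw [Subsingleton.elim k 0]
    exact h

lemma exists_isUnimodularTriangulation_of_dim_one {P : Set (Fin 1 → ℝ)}
    (hP : IsIntegralPolytope P) {m : ℤ} (hm : 0 < m) :
    ∃ T : Set (Set (Fin 1 → ℝ)), IsUnimodularTriangulation T ((m : ℝ) • P) := by
  obtain ⟨a, b, rfl⟩ := hP.eq_segment
  have hm0 : (0 : ℝ) < m := by exact_mod_cast hm
  convert exists_isUnimodularTriangulation_segment (m * a) (m * b) using 3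
  ext x
  rw [Set.mem_smul_set_iff_inv_smul_mem₀ hm0.ne']
  simp only [Set.mem_ofPred_eq, Pi.smul_apply, smul_eq_mul]
  push_cast
  rw [le_inv_mul_iff₀ hm0, inv_mul_le_iff₀ hm0]

end Segments

theorem statement2 (d : ℕ) (hd : 0 < d) (c : ℤ) (hc : (d.factorial : ℤ) + (d : ℤ) ≤ c)
    (P : Set (Fin d → ℝ)) (hP : IsIntegralPolytope P)
    (hdim : affineSpan ℝ P = ⊤) :
    ∃ N : ℕ, 0 < N ∧ ∀ r s : ℕ, 0 < r + s →
      ∃ T : Set (Set (Fin d → ℝ)),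
        IsUnimodularTriangulation T
          ((((r : ℤ) * c ^ N + (s : ℤ) * (d.factorial : ℤ) ^ N : ℤ) : ℝ) • P) := by
  have hf : (0 : ℤ) < d.factorial := by exact_mod_cast d.factorial_pos
  have hc0 : 0 < c := by omega
  rcases Nat.lt_or_ge 1 d with hd2 | hd1
  · have hf2 : (2 : ℤ) ≤ d.factorial := by exact_mod_cast (show 2 ≤ d from hd2).trans d.self_le_factorial
    have hc2 : 2 ≤ c := by omega
    obtain ⟨n₀, h⟩ := exists_isUnimodularTriangulation_of_ge hP
    refine ⟨n₀ + 1, n₀.succ_pos, fun r s hrs => ?_⟩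
    have h1 : (2 : ℤ) ^ (n₀ + 1) ≤ c ^ (n₀ + 1) := pow_le_pow_left₀ (by norm_num) hc2 _
    have h2 : (2 : ℤ) ^ (n₀ + 1) ≤ (d.factorial : ℤ) ^ (n₀ + 1) :=
      pow_le_pow_left₀ (by norm_num) hf2 _
    have h3 : ((n₀ + 1 : ℕ) : ℤ) < 2 ^ (n₀ + 1) := by exact_mod_cast Nat.lt_two_pow_self
    have h4 : ((n₀ + 1 : ℕ) : ℤ) < r * c ^ (n₀ + 1) + s * (d.factorial : ℤ) ^ (n₀ + 1) := by
      have h5 : (1 : ℤ) ≤ r + s := by exact_mod_cast hrs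
      have h6 := mul_le_mul_of_nonneg_left h1 (Int.natCast_nonneg r)
      have h7 := mul_le_mul_of_nonneg_left h2 (Int.natCast_nonneg s)
      have h8 := mul_le_mul_of_nonneg_right h5 (pow_nonneg (by norm_num : (0 : ℤ) ≤ 2) (n₀ + 1))
      linarith
    obtain ⟨n, hn⟩ := Int.eq_ofNat_of_zero_le
      (show 0 ≤ (r : ℤ) * c ^ (n₀ + 1) + s * (d.factorial : ℤ) ^ (n₀ + 1) by omega)
    rw [hn] at h4 ⊢
    rw [Int.cast_natCast]
    exact h n (by omega) (by omega)
  · obtain rfl : d = 1 := by omega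
    refine ⟨1, one_pos, fun r s hrs => exists_isUnimodularTriangulation_of_dim_one hP ?_⟩
    have h6 := mul_nonneg (Int.natCast_nonneg r) hc0.le
    rw [pow_one, pow_one]
    rcases Nat.eq_zero_or_pos r with rfl | hr
    · have : (0 : ℤ) < s := by exact_mod_cast (by omega : 0 < s)
      simpa using this
    · have : (0 : ℤ) < r * c := mul_pos (by exact_mod_cast hr) hc0
      have := mul_nonneg (Int.natCast_nonneg s) hf.le
      linarith
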